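/- Let n ≥ 2. Every continuous, translation invariant, SU(n)-invariant valuation μ on ℂⁿ can be written in exactly one way as μ = μ₋₂ + μ₋₁ + μ₀ + μ₁ + μ₂, where for each l ∈ {−2,−1,0,1,2} the function μ_l is a continuous, translation invariant valuation on ℂⁿ satisfying μ_l(gK) = (det g)^l μ_l(K) for all g ∈ U(n) and all convex bodies K. -/

import Mathlib

open MeasureTheory
open scoped ENNReal

noncomputable section

/-- `ℂⁿ`, regarded as a real inner product space via `Re⟨z,w⟫`. -/
abbrev Cn (n : ℕ) := EuclideanSpace ℂ (Fin n)

/-- `μ` is a valuation: it is finitely additive on convex bodies of `ℂⁿ`. -/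
def IsValuation {n : ℕ} (μ : ConvexBody (Cn n) → ℂ) : Prop :=
  ∀ K L U I : ConvexBody (Cn n),
    (U : Set (Cn n)) = (K : Set (Cn n)) ∪ (L : Set (Cn n)) →
    (I : Set (Cn n)) = (K : Set (Cn n)) ∩ (L : Set (Cn n)) →
    μ U + μ I = μ K + μ L

/-- `μ` is translation invariant. -/
def TranslationInvariant {n : ℕ} (μ : ConvexBody (Cn n) → ℂ) : Prop :=
  ∀ (x : Cn n) (K L : ConvexBody (Cn n)),
    (L : Set (Cn n)) = (fun y => x + y) '' (K : Set (Cn n)) → μ L = μ K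

/-- `μ` is invariant under the special unitary group `SU(n)` acting on `ℂⁿ`. -/
def SUInvariant {n : ℕ} (μ : ConvexBody (Cn n) → ℂ) : Prop :=
  ∀ g ∈ Matrix.specialUnitaryGroup (Fin n) ℂ, ∀ K L : ConvexBody (Cn n),
    (L : Set (Cn n)) = (Matrix.toEuclideanLin g) '' (K : Set (Cn n)) → μ L = μ K

/-- `μ` has weight `l` : `μ (g K) = (det g)^l • μ K` for all `g ∈ U(n)`. -/
def HasWeight {n : ℕ} (l : ℤ) (μ : ConvexBody (Cn n) → ℂ) : Prop :=
  ∀ g ∈ Matrix.unitaryGroup (Fin n) ℂ, ∀ K L : ConvexBody (Cn n),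
    (L : Set (Cn n)) = (Matrix.toEuclideanLin g) '' (K : Set (Cn n)) →
    μ L = (Matrix.det g) ^ l * μ K

namespace SUVal

section
set_option linter.unusedSectionVars false

variable {E F : Type*} [NormedAddCommGroup E] [InnerProductSpace ℝ E]
  [NormedAddCommGroup F] [InnerProductSpace ℝ F]

/-- Support functions: sublinear functions bounded by a multiple of the norm. -/
structure Sublin (f : E → ℝ) : Prop where
  add_le : ∀ x y, f (x + y) ≤ f x + f y
  smul : ∀ t : ℝ, 0 ≤ t → ∀ x, f (t • x) = t * f x
  bdd : ∃ C, ∀ x, f x ≤ C * ‖x‖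

theorem Sublin.add {f g : E → ℝ} (hf : Sublin f) (hg : Sublin g) : Sublin (f + g) := by
  obtain ⟨C, hC⟩ := hf.bdd
  obtain ⟨D, hD⟩ := hg.bdd
  refine ⟨fun x y => ?_, fun t ht x => ?_, C + D, fun x => ?_⟩
  · have := hf.add_le x y; have := hg.add_le x y; simp only [Pi.add_apply]; linarith
  · simp only [Pi.add_apply, hf.smul t ht, hg.smul t ht]; ring
  · have := hC x; have := hD x; simp only [Pi.add_apply]; linarith

theorem Sublin.const_smul {f : E → ℝ} (hf : Sublin f) {c : ℝ} (hc : 0 ≤ c) : Sublin (c • f) := by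
  obtain ⟨C, hC⟩ := hf.bdd
  refine ⟨fun x y => ?_, fun t ht x => ?_, c * C, fun x => ?_⟩
  · have := mul_le_mul_of_nonneg_left (hf.add_le x y) hc
    simp only [Pi.smul_apply, smul_eq_mul]; linarith
  · simp only [Pi.smul_apply, smul_eq_mul, hf.smul t ht]; ring
  · have := mul_le_mul_of_nonneg_left (hC x) hc
    simp only [Pi.smul_apply, smul_eq_mul]; linarith

theorem Sublin.sup {f g : E → ℝ} (hf : Sublin f) (hg : Sublin g) : Sublin (f ⊔ g) := by
  obtain ⟨C, hC⟩ := hf.bdd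
  obtain ⟨D, hD⟩ := hg.bdd
  refine ⟨fun x y => ?_, fun t ht x => ?_, max C D, fun x => ?_⟩
  · simp only [Pi.sup_apply]
    refine sup_le ((hf.add_le x y).trans ?_) ((hg.add_le x y).trans ?_)
    · exact add_le_add le_sup_left le_sup_left
    · exact add_le_add le_sup_right le_sup_right
  · simp only [Pi.sup_apply, hf.smul t ht, hg.smul t ht]
    exact (mul_max_of_nonneg _ _ ht).symm
  · simp only [Pi.sup_apply]
    refine sup_le ((hC x).trans ?_) ((hD x).trans ?_)
    · exact mul_le_mul_of_nonneg_right (le_max_left _ _) (norm_nonneg x)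
    · exact mul_le_mul_of_nonneg_right (le_max_right _ _) (norm_nonneg x)

theorem Sublin.clm (l : E →L[ℝ] ℝ) : Sublin (⇑l) :=
  ⟨fun x y => by simp, fun t _ x => by simp, ‖l‖, fun x =>
    (Real.le_norm_self _).trans (l.le_opNorm x)⟩

theorem Sublin.zero : Sublin (0 : E → ℝ) := by simpa using Sublin.clm (0 : E →L[ℝ] ℝ)

theorem Sublin.norm : Sublin (fun x : E => ‖x‖) :=
  ⟨fun x y => norm_add_le x y, fun t ht x => by rw [norm_smul, Real.norm_of_nonneg ht],
    1, fun x => by simp⟩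

theorem Sublin.comp {f : E → ℝ} (hf : Sublin f) (A : F →L[ℝ] E) : Sublin (f ∘ A) := by
  obtain ⟨C, hC⟩ := hf.bdd
  refine ⟨fun x y => ?_, fun t ht x => ?_, |C| * ‖A‖, fun x => ?_⟩
  · simpa using hf.add_le (A x) (A y)
  · simp [hf.smul t ht]
  · have h1 := hC (A x)
    have h2 := A.le_opNorm x
    calc f (A x) ≤ C * ‖A x‖ := h1
      _ ≤ |C| * ‖A x‖ := mul_le_mul_of_nonneg_right (le_abs_self C) (norm_nonneg _)
      _ ≤ |C| * (‖A‖ * ‖x‖) := mul_le_mul_of_nonneg_left h2 (abs_nonneg _)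
      _ = _ := by ring

theorem Sublin.map_zero {f : E → ℝ} (hf : Sublin f) : f 0 = 0 := by
  simpa using hf.smul 0 le_rfl 0

theorem Sublin.neg_le {f : E → ℝ} (hf : Sublin f) (x : E) : -f (-x) ≤ f x := by
  have := hf.add_le x (-x)
  rw [add_neg_cancel, hf.map_zero] at this
  linarith

theorem Sublin.lip {f : E → ℝ} (hf : Sublin f) :
    ∃ C, 0 ≤ C ∧ ∀ x y, |f x - f y| ≤ C * ‖x - y‖ := by
  obtain ⟨C, hC⟩ := hf.bdd
  refine ⟨|C|, abs_nonneg C, fun x y => ?_⟩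
  have key : ∀ x y, f x - f y ≤ |C| * ‖x - y‖ := fun x y => by
    have h := hf.add_le y (x - y)
    rw [add_sub_cancel] at h
    have h2 := hC (x - y)
    have := mul_le_mul_of_nonneg_right (le_abs_self C) (norm_nonneg (x - y))
    linarith
  rw [abs_le]
  constructor
  · have := key y x; rw [norm_sub_rev] at this; linarith
  · exact key x y

theorem Sublin.continuous {f : E → ℝ} (hf : Sublin f) : Continuous f := by
  obtain ⟨C, h0, hC⟩ := hf.lip
  exact (LipschitzWith.of_dist_le_mul (K := ⟨C, h0⟩) (fun x y => by
    rw [Real.dist_eq, dist_eq_norm]; exact hC x y)).continuous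

theorem Sublin.abs_bdd {f : E → ℝ} (hf : Sublin f) : ∃ C, 0 ≤ C ∧ ∀ x, |f x| ≤ C * ‖x‖ := by
  obtain ⟨C, h0, hC⟩ := hf.lip
  exact ⟨C, h0, fun x => by simpa [hf.map_zero] using hC x 0⟩

theorem Sublin.of_approx {f : E → ℝ}
    (h : ∀ ε > 0, ∃ g, Sublin g ∧ ∀ x, |g x - f x| ≤ ε * ‖x‖) : Sublin f := by
  refine ⟨fun x y => ?_, fun t ht x => ?_, ?_⟩
  · refine le_of_forall_pos_le_add fun η hη => ?_
    obtain ⟨g, hg, hgf⟩ := h (η / (‖x + y‖ + ‖x‖ + ‖y‖ + 1)) (by positivity)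
    have h1 := abs_le.1 (hgf (x + y))
    have h2 := abs_le.1 (hgf x)
    have h3 := abs_le.1 (hgf y)
    have h4 := hg.add_le x y
    have : η / (‖x + y‖ + ‖x‖ + ‖y‖ + 1) * ‖x + y‖ + η / (‖x + y‖ + ‖x‖ + ‖y‖ + 1) * ‖x‖
      + η / (‖x + y‖ + ‖x‖ + ‖y‖ + 1) * ‖y‖ ≤ η := by
      rw [← mul_add, ← mul_add, div_mul_eq_mul_div, div_le_iff₀ (by positivity)]
      nlinarith
    linarith [h1.1, h2.2, h3.2]
  · refine eq_of_abs_sub_le_all fun η hη => ?_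
    obtain ⟨g, hg, hgf⟩ := h (η / (2 * t * ‖x‖ + 1)) (by positivity)
    have h1 := hgf (t • x)
    have h2 := hgf x
    rw [norm_smul, Real.norm_of_nonneg ht, hg.smul t ht] at h1
    have h3 := mul_le_mul_of_nonneg_left h2 ht
    have h4 : η / (2 * t * ‖x‖ + 1) * (2 * t * ‖x‖) ≤ η := by
      rw [div_mul_eq_mul_div, div_le_iff₀ (by positivity)]; nlinarith
    have h5 := abs_le.1 h1
    have h6 := abs_le.1 h2
    rw [abs_le]
    constructor <;> nlinarith
  · obtain ⟨g, hg, hgf⟩ := h 1 one_pos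
    obtain ⟨C, hC⟩ := hg.bdd
    exact ⟨C + 1, fun x => by linarith [(abs_le.1 (hgf x)).1, hC x]⟩

/-- The support function of the segment `[-v, v]`. -/
def seg (v : E) : E → ℝ := fun x => |inner ℝ v x|

theorem seg_eq (v : E) : seg v = ⇑(innerSL ℝ v) ⊔ ⇑(-(innerSL ℝ v)) := by
  ext x; simp [seg, abs]

theorem Sublin.seg (v : E) : Sublin (seg v) := by
  rw [seg_eq]; exact (Sublin.clm _).sup (Sublin.clm _)

theorem seg_zero : seg (0 : E) = 0 := by ext; simp [seg]

theorem seg_smul (t : ℝ) (v : E) : seg (t • v) = |t| • seg v := by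
  ext; simp [seg, inner_smul_left, abs_mul]

theorem seg_neg (v : E) : seg (-v) = seg v := by
  ext; simp [seg]

/-- Continuous translation invariant valuations, as functionals on support functions. -/
structure IsVal (m : (E → ℝ) → ℂ) : Prop where
  cont : ∀ f, Sublin f → ∀ ε > 0, ∃ δ > 0, ∀ g, Sublin g → (∀ x, |g x - f x| ≤ δ * ‖x‖) →
    ‖m g - m f‖ ≤ ε
  trans : ∀ f, Sublin f → ∀ l : E →L[ℝ] ℝ, m (f + ⇑l) = m f
  lat : ∀ f g, Sublin f → Sublin g → Sublin (f ⊓ g) → m (f ⊔ g) + m (f ⊓ g) = m f + m g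

theorem IsVal.sub {m m' : (E → ℝ) → ℂ} (h : IsVal m) (h' : IsVal m') :
    IsVal (fun f => m f - m' f) := by
  refine ⟨fun f hf ε hε => ?_, fun f hf l => by simp [h.trans f hf l, h'.trans f hf l],
    fun f g hf hg hfg => ?_⟩
  · obtain ⟨δ, hδ, H⟩ := h.cont f hf (ε / 2) (by positivity)
    obtain ⟨δ', hδ', H'⟩ := h'.cont f hf (ε / 2) (by positivity)
    refine ⟨min δ δ', lt_min hδ hδ', fun g hg hgf => ?_⟩
    have h1 := H g hg fun x => (hgf x).trans
      (mul_le_mul_of_nonneg_right (min_le_left _ _) (norm_nonneg _))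
    have h2 := H' g hg fun x => (hgf x).trans
      (mul_le_mul_of_nonneg_right (min_le_right _ _) (norm_nonneg _))
    have : m g - m' g - (m f - m' f) = (m g - m f) - (m' g - m' f) := by ring
    rw [this]
    exact (norm_sub_le _ _).trans (by linarith)
  · have h1 := h.lat f g hf hg hfg
    have h2 := h'.lat f g hf hg hfg
    linear_combination h1 - h2

theorem sup_add_fun (f g c : E → ℝ) : (f ⊔ g) + c = (f + c) ⊔ (g + c) := by
  ext x; simp [max_add_add_right]

theorem inf_add_fun (f g c : E → ℝ) : (f ⊓ g) + c = (f + c) ⊓ (g + c) := by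
  ext x; simp [min_add_add_right]

theorem IsVal.comp_add {m : (F → ℝ) → ℂ} (h : IsVal m) (A : F →L[ℝ] E) {c : F → ℝ}
    (hc : Sublin c) : IsVal (fun f : E → ℝ => m (f ∘ A + c)) := by
  refine ⟨fun f hf ε hε => ?_, fun f hf l => ?_, fun f g hf hg hfg => ?_⟩
  · obtain ⟨δ, hδ, H⟩ := h.cont _ ((hf.comp A).add hc) ε hε
    refine ⟨δ / (‖A‖ + 1), by positivity, fun g hg hgf => H _ ((hg.comp A).add hc) fun x => ?_⟩
    simp only [Pi.add_apply, Function.comp_apply, add_sub_add_right_eq_sub]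
    refine (hgf _).trans ?_
    have h1 : ‖A x‖ ≤ (‖A‖ + 1) * ‖x‖ := (A.le_opNorm x).trans (by nlinarith [norm_nonneg x])
    rw [div_mul_eq_mul_div, div_le_iff₀ (by positivity)]
    nlinarith
  · have : (f + ⇑l) ∘ A + c = (f ∘ A + c) + ⇑(l.comp A) := by ext; simp; ring
    rw [this, h.trans _ ((hf.comp A).add hc)]
  · have h1 : (f ⊔ g) ∘ A + c = (f ∘ A + c) ⊔ (g ∘ A + c) := by
      rw [← sup_add_fun]; rfl
    have h2 : (f ⊓ g) ∘ A + c = (f ∘ A + c) ⊓ (g ∘ A + c) := by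
      rw [← inf_add_fun]; rfl
    have h3 := (hfg.comp A).add hc
    rw [h2] at h3
    simp only [h1, h2]
    exact h.lat _ _ ((hf.comp A).add hc) ((hg.comp A).add hc) h3

theorem IsVal.shift {m : (E → ℝ) → ℂ} (h : IsVal m) {c : E → ℝ}
    (hc : Sublin c) : IsVal (fun f : E → ℝ => m (f + c)) :=
  h.comp_add (ContinuousLinearMap.id ℝ E) hc

/-- The difference of `m` in the direction of the segment `[-v, v]`. -/
def D (v : E) (m : (E → ℝ) → ℂ) : (E → ℝ) → ℂ := fun f => m (f + seg v) - m f

theorem IsVal.D {m : (E → ℝ) → ℂ} (h : IsVal m) (v : E) : IsVal (D v m) :=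
  (h.shift (Sublin.seg v)).sub h

theorem D_comm (v w : E) (m : (E → ℝ) → ℂ) : D v (D w m) = D w (D v m) := by
  ext f; simp only [D]; rw [add_right_comm]; ring

/-- Equality on support functions. -/
def Eqv (m m' : (E → ℝ) → ℂ) : Prop := ∀ f, Sublin f → m f = m' f

theorem Eqv.D {m m' : (E → ℝ) → ℂ} (h : Eqv m m') (v : E) : Eqv (D v m) (SUVal.D v m') :=
  fun f hf => by simp only [SUVal.D, h _ hf, h _ (hf.add (Sublin.seg v))]

theorem Eqv.trans {m m' m'' : (E → ℝ) → ℂ} (h : Eqv m m') (h' : Eqv m' m'') : Eqv m m'' :=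
  fun f hf => (h f hf).trans (h' f hf)

theorem Eqv.symm {m m' : (E → ℝ) → ℂ} (h : Eqv m m') : Eqv m' m := fun f hf => (h f hf).symm

theorem D_zero_dir (m : (E → ℝ) → ℂ) : D (0 : E) m = 0 := by
  ext f; simp [D, seg_zero]

theorem D_zero (v : E) : D v (0 : (E → ℝ) → ℂ) = 0 := by ext f; simp [D]

theorem D_smul (v : E) (c : ℂ) (m : (E → ℝ) → ℂ) : D v (c • m) = c • D v m := by
  ext f; simp [D, mul_sub]

theorem D_neg (v : E) (m : (E → ℝ) → ℂ) : D (-v) m = D v m := by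
  ext f; simp [D, seg_neg]

theorem IsVal.seg_add {m : (E → ℝ) → ℂ} (h : IsVal m) {f : E → ℝ} (hf : Sublin f) (v : E)
    {s t : ℝ} (hs : 0 ≤ s) (ht : 0 ≤ t) :
    m (f + (s + t) • seg v) + m f = m (f + s • seg v) + m (f + t • seg v) := by
  have hfs := hf.add ((Sublin.seg v).const_smul hs)
  have hft := hf.add ((Sublin.seg v).const_smul ht)
  have e1 : (f + s • seg v + ⇑((-t) • innerSL ℝ v)) ⊔ (f + t • seg v + ⇑(s • innerSL ℝ v))
      = f + (s + t) • seg v := by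
    ext x
    simp only [Pi.sup_apply, Pi.add_apply, Pi.smul_apply, seg, smul_eq_mul,
      _root_.smul_apply, innerSL_apply_apply]
    rcases le_total 0 (inner ℝ v x) with hx | hx
    · rw [abs_of_nonneg hx, sup_eq_right.2] <;> nlinarith
    · rw [abs_of_nonpos hx, sup_eq_left.2] <;> nlinarith
  have e2 : (f + s • seg v + ⇑((-t) • innerSL ℝ v)) ⊓ (f + t • seg v + ⇑(s • innerSL ℝ v))
      = f + ⇑((s - t) • innerSL ℝ v) := by
    ext x
    simp only [Pi.inf_apply, Pi.add_apply, Pi.smul_apply, seg, smul_eq_mul,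
      _root_.smul_apply, innerSL_apply_apply]
    rcases le_total 0 (inner ℝ v x) with hx | hx
    · rw [abs_of_nonneg hx, inf_eq_left.2] <;> nlinarith
    · rw [abs_of_nonpos hx, inf_eq_right.2] <;> nlinarith
  have := h.lat _ _ (hfs.add (Sublin.clm ((-t) • innerSL ℝ v)))
    (hft.add (Sublin.clm (s • innerSL ℝ v))) (by rw [e2]; exact hf.add (Sublin.clm _))
  rwa [e1, e2, h.trans _ hf, h.trans _ hfs, h.trans _ hft] at this

theorem linear_of_additive {φ : ℝ → ℂ} (hadd : ∀ s t, 0 ≤ s → 0 ≤ t → φ (s + t) = φ s + φ t)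
    (hc : ∀ ε > 0, ∃ δ > 0, ∀ t, 0 ≤ t → t ≤ δ → ‖φ t‖ ≤ ε) {t : ℝ} (ht : 0 ≤ t) :
    φ t = t * φ 1 := by
  have h0 : φ 0 = 0 := by simpa using hadd 0 0 le_rfl le_rfl
  let ψ : ℝ →+ ℂ := AddMonoidHom.mk' (fun t => φ (max t 0) - φ (max (-t) 0)) (by
    intro a b
    have e : max (a + b) 0 + (max (-a) 0 + max (-b) 0)
        = max (-(a + b)) 0 + (max a 0 + max b 0) := by
      have k : ∀ r : ℝ, max r 0 = r + max (-r) 0 := fun r => by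
        rcases le_total 0 r with h | h
        · rw [max_eq_left h, max_eq_right (by linarith)]; ring
        · rw [max_eq_right h, max_eq_left (by linarith)]; ring
      rw [k (a + b), k a, k b]; ring
    have hh := congrArg φ e
    rw [hadd _ _ (le_max_right _ _) (add_nonneg (le_max_right _ _) (le_max_right _ _)),
      hadd _ _ (le_max_right _ _) (le_max_right _ _),
      hadd _ _ (le_max_right _ _) (add_nonneg (le_max_right _ _) (le_max_right _ _)),
      hadd _ _ (le_max_right _ _) (le_max_right _ _)] at hh
    linear_combination hh)
  have hψ : Continuous ψ := by
    refine continuous_of_continuousAt_zero ψ ?_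
    rw [Metric.continuousAt_iff]
    intro ε hε
    obtain ⟨δ, hδ, H⟩ := hc (ε / 3) (by positivity)
    refine ⟨δ, hδ, fun {x} hx => ?_⟩
    rw [map_zero, dist_zero_right]
    rw [Real.dist_eq, sub_zero, abs_lt] at hx
    have h1 := H (max x 0) (le_max_right _ _) (max_le hx.2.le hδ.le)
    have h2 := H (max (-x) 0) (le_max_right _ _) (max_le (by linarith) hδ.le)
    calc ‖ψ x‖ ≤ ‖φ (max x 0)‖ + ‖φ (max (-x) 0)‖ := norm_sub_le _ _
      _ < ε := by linarith
  have hp : ∀ t, 0 ≤ t → ψ t = φ t := fun t ht => by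
    change φ (max t 0) - φ (max (-t) 0) = φ t
    rw [max_eq_left ht, max_eq_right (by linarith), h0, sub_zero]
  have := (ψ.toRealLinearMap hψ).map_smul t 1
  simp only [smul_eq_mul, mul_one, AddMonoidHom.coe_toRealLinearMap] at this
  rw [hp t ht, hp 1 zero_le_one] at this
  simpa using this

theorem IsVal.seg_linear {m : (E → ℝ) → ℂ} (h : IsVal m) {f : E → ℝ} (hf : Sublin f) (v : E)
    {t : ℝ} (ht : 0 ≤ t) : m (f + t • seg v) - m f = t * (m (f + seg v) - m f) := by
  have := linear_of_additive (φ := fun t => m (f + t • seg v) - m f) (fun s t hs ht => by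
      have := h.seg_add hf v hs ht
      linear_combination this) (fun ε hε => by
      obtain ⟨δ, hδ, H⟩ := h.cont f hf ε hε
      refine ⟨δ / (‖v‖ + 1), by positivity, fun t ht htδ => H _
        (hf.add ((Sublin.seg v).const_smul ht)) fun x => ?_⟩
      simp only [Pi.add_apply, Pi.smul_apply, smul_eq_mul, add_sub_cancel_left, seg, abs_mul,
        abs_abs, abs_of_nonneg ht]
      have h1 := abs_real_inner_le_norm v x
      rw [le_div_iff₀ (by positivity)] at htδ
      calc t * |inner ℝ v x| ≤ t * (‖v‖ * ‖x‖) := mul_le_mul_of_nonneg_left h1 ht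
        _ = (t * ‖v‖) * ‖x‖ := by ring
        _ ≤ δ * ‖x‖ := mul_le_mul_of_nonneg_right (by nlinarith) (norm_nonneg _)) ht
  simpa using this

theorem IsVal.D_smul_dir {m : (E → ℝ) → ℂ} (h : IsVal m) (t : ℝ) (v : E) :
    Eqv (SUVal.D (t • v) m) (((|t| : ℝ) : ℂ) • SUVal.D v m) := fun f hf => by
  have := h.seg_linear hf v (abs_nonneg t)
  simpa [SUVal.D, seg_smul] using this

theorem IsVal.D_congr_of_abs {m : (E → ℝ) → ℂ} (h : IsVal m) {f g : E → ℝ} (hf : Sublin f)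
    (hg : Sublin g) {v : E} {C : ℝ} (hC : 0 ≤ C)
    (hfg : ∀ x, |f x - g x| ≤ C * |inner ℝ v x|) :
    m (f + C • seg v) - m f = m (g + C • seg v) - m g := by
  have hfC := hf.add ((Sublin.seg v).const_smul hC)
  set a := C • innerSL ℝ v with ha
  have hax : ∀ x, a x = C * inner ℝ v x := fun x => by simp [ha]
  have s1 := hf.sup (hg.add (Sublin.clm a))
  have s2 := hf.sup (hg.add (Sublin.clm (-a)))
  have hC' : ∀ x, C * |inner ℝ v x| = |a x| := fun x => by rw [hax, abs_mul, abs_of_nonneg hC]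
  simp_rw [hC'] at hfg
  have e1 : (f ⊔ (g + ⇑a)) ⊔ (f ⊔ (g + ⇑(-a))) = g + C • seg v := by
    ext x
    have h1 := abs_le.1 (hfg x)
    simp only [Pi.sup_apply, Pi.add_apply, Pi.smul_apply, seg, smul_eq_mul, hC' x,
      _root_.neg_apply]
    rcases le_total 0 (a x) with hx | hx
    · rw [abs_of_nonneg hx] at *
      rw [sup_eq_right.2 (by linarith : f x ≤ g x + a x), sup_eq_left.2]
      exact sup_le (by linarith) (by linarith)
    · rw [abs_of_nonpos hx] at *
      rw [sup_eq_right.2 (by linarith : f x ≤ g x + -a x), sup_eq_right.2]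
      exact sup_le (by linarith) (by linarith)
  have e2 : (f ⊔ (g + ⇑a)) ⊓ (f ⊔ (g + ⇑(-a))) = f := by
    ext x
    have h1 := abs_le.1 (hfg x)
    simp only [Pi.sup_apply, Pi.inf_apply, Pi.add_apply, _root_.neg_apply]
    rcases le_total 0 (a x) with hx | hx
    · rw [abs_of_nonneg hx] at *
      rw [sup_eq_left.2 (by linarith : g x + -a x ≤ f x), inf_eq_right.2 le_sup_left]
    · rw [abs_of_nonpos hx] at *
      rw [sup_eq_left.2 (by linarith : g x + a x ≤ f x), inf_eq_left.2 le_sup_left]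
  have e3 : (f ⊔ (g + ⇑a)) ⊔ (f ⊔ (g + ⇑(-a)) + ⇑(a + a)) = f + C • seg v + ⇑a := by
    ext x
    have h1 := abs_le.1 (hfg x)
    simp only [Pi.sup_apply, Pi.add_apply, Pi.smul_apply, seg, smul_eq_mul, hC' x,
      _root_.neg_apply, _root_.add_apply]
    rcases le_total 0 (a x) with hx | hx
    · rw [abs_of_nonneg hx] at *
      rw [sup_eq_right.2 (by linarith : f x ≤ g x + a x),
        sup_eq_left.2 (by linarith : g x + - a x ≤ f x), sup_eq_right.2 (by linarith)]
      ring
    · rw [abs_of_nonpos hx] at *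
      rw [sup_eq_left.2 (by linarith : g x + a x ≤ f x),
        sup_eq_right.2 (by linarith : f x ≤ g x + - a x), sup_eq_left.2 (by linarith)]
      ring
  have e4 : (f ⊔ (g + ⇑a)) ⊓ (f ⊔ (g + ⇑(-a)) + ⇑(a + a)) = g + ⇑a := by
    ext x
    have h1 := abs_le.1 (hfg x)
    simp only [Pi.sup_apply, Pi.inf_apply, Pi.add_apply, 
      _root_.neg_apply, _root_.add_apply]
    rcases le_total 0 (a x) with hx | hx
    · rw [abs_of_nonneg hx] at *
      rw [sup_eq_right.2 (by linarith : f x ≤ g x + a x),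
        sup_eq_left.2 (by linarith : g x + - a x ≤ f x), inf_eq_left.2 (by linarith)]
    · rw [abs_of_nonpos hx] at *
      rw [sup_eq_left.2 (by linarith : g x + a x ≤ f x),
        sup_eq_right.2 (by linarith : f x ≤ g x + - a x), inf_eq_right.2 (by linarith)]
      ring
  have l1 := h.lat _ _ s1 s2 (by rw [e2]; exact hf)
  have l2 := h.lat _ _ s1 (s2.add (Sublin.clm (a + a))) (by rw [e4]; exact hg.add (Sublin.clm _))
  rw [e1, e2] at l1
  rw [e3, e4, h.trans _ hfC, h.trans _ hg, h.trans _ s2] at l2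
  linear_combination l2 - l1

theorem Sublin.abs_sub_le_of_eq {f g : E → ℝ} (hf : Sublin f) (hg : Sublin g) {v : E}
    (hfg : ∀ x, inner ℝ v x = 0 → f x = g x) :
    ∃ C, 0 < C ∧ ∀ x, |f x - g x| ≤ C * |inner ℝ v x| := by
  obtain ⟨C, hC0, hC⟩ := hf.lip
  obtain ⟨C', hC0', hC'⟩ := hg.lip
  by_cases hv : v = 0
  · refine ⟨1, one_pos, fun x => ?_⟩
    rw [hfg x (by simp [hv])]; simp
  have hv' : 0 < ‖v‖ := norm_pos_iff.2 hv
  refine ⟨(C + C' + 1) / ‖v‖, by positivity, fun x => ?_⟩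
  set y := x - (inner ℝ v x / ‖v‖ ^ 2) • v with hy
  have hvy : inner ℝ v y = 0 := by
    rw [hy, inner_sub_right, inner_smul_right, real_inner_self_eq_norm_sq]
    field_simp; ring
  have hn : ‖x - y‖ = |inner ℝ v x| / ‖v‖ := by
    rw [hy, sub_sub_cancel, norm_smul, Real.norm_eq_abs, abs_div, abs_of_nonneg (sq_nonneg ‖v‖)]
    field_simp
  have h1 := hC x y
  have h2 := hC' x y
  rw [hn] at h1 h2
  have h3 := hfg y hvy
  have : |f x - g x| ≤ |f x - f y| + |g x - g y| := by
    have : f x - g x = (f x - f y) - (g x - g y) := by rw [h3]; ring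
    rw [this]; exact abs_sub _ _
  have h5 : 0 ≤ |inner ℝ v x| / ‖v‖ := by positivity
  calc _ ≤ C * (|inner ℝ v x| / ‖v‖) + C' * (|inner ℝ v x| / ‖v‖) := by linarith
    _ ≤ (C + C' + 1) * (|inner ℝ v x| / ‖v‖) := by linarith
    _ = _ := by ring

theorem IsVal.D_congr {m : (E → ℝ) → ℂ} (h : IsVal m) {f g : E → ℝ} (hf : Sublin f)
    (hg : Sublin g) {v : E} (hfg : ∀ x, inner ℝ v x = 0 → f x = g x) :
    SUVal.D v m f = SUVal.D v m g := by
  obtain ⟨C, hC0, hC⟩ := hf.abs_sub_le_of_eq hg hfg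
  have := h.D_congr_of_abs hf hg hC0.le hC
  rw [h.seg_linear hf v hC0.le, h.seg_linear hg v hC0.le] at this
  exact mul_left_cancel₀ (by exact_mod_cast hC0.ne') this

/-- The iterated difference in the directions of a list of segments. -/
def DL : List E → ((E → ℝ) → ℂ) → (E → ℝ) → ℂ
  | [], m => m
  | v :: l, m => D v (DL l m)

theorem IsVal.DL {m : (E → ℝ) → ℂ} (h : IsVal m) : ∀ l : List E, IsVal (DL l m)
  | [] => h
  | v :: l => (h.DL l).D v

theorem DL_zero : ∀ l : List E, DL l (0 : (E → ℝ) → ℂ) = 0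
  | [] => rfl
  | v :: l => by rw [DL, DL_zero l, D_zero]

theorem Eqv.DL {m m' : (E → ℝ) → ℂ} (h : Eqv m m') : ∀ l : List E, Eqv (DL l m) (SUVal.DL l m')
  | [] => h
  | v :: l => (h.DL l).D v

theorem Eqv.smul {m m' : (E → ℝ) → ℂ} (h : Eqv m m') (c : ℂ) : Eqv (c • m) (c • m') :=
  fun f hf => by simp [h f hf]

theorem Eqv.refl (m : (E → ℝ) → ℂ) : Eqv m m := fun _ _ => rfl

theorem D_DL (v : E) (m : (E → ℝ) → ℂ) : ∀ l : List E, D v (DL l m) = DL l (D v m)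
  | [] => rfl
  | w :: l => by rw [DL, D_comm, D_DL v m l, DL]

theorem DL_append (m : (E → ℝ) → ℂ) : ∀ l l' : List E, DL (l ++ l') m = DL l (DL l' m)
  | [], _ => rfl
  | w :: l, l' => by rw [List.cons_append, DL, DL, DL_append m l l']

theorem IsVal.D_add_span {m : (E → ℝ) → ℂ} (h : IsVal m) (l : List E) {s : E}
    (hs : s ∈ Submodule.span ℝ {v | v ∈ l}) (y : E) :
    Eqv (SUVal.D (y + s) (SUVal.DL l m)) (SUVal.D y (SUVal.DL l m)) := by
  have key : ∀ v ∈ l, ∀ (c : ℝ) (y : E),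
      Eqv (SUVal.D (y + c • v) (SUVal.DL l m)) (SUVal.D y (SUVal.DL l m)) := by
    intro v hv c y
    obtain ⟨l1, l2, rfl⟩ := List.append_of_mem hv
    have e : SUVal.DL (l1 ++ v :: l2) m = SUVal.D v (SUVal.DL (l1 ++ l2) m) := by
      rw [DL_append, DL_append, SUVal.DL, D_DL, D_DL, D_DL]
    rw [e]
    intro f hf
    have := (h.DL (l1 ++ l2)).D_congr (v := v) (hf.add (Sublin.seg (y + c • v)))
      (hf.add (Sublin.seg y)) (fun x hx => by
        simp [seg, inner_add_left, inner_smul_left, hx])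
    simp only [SUVal.D] at this ⊢
    rw [this]
  induction hs using Submodule.span_induction generalizing y with
  | mem v hv => simpa using key v hv 1 y
  | zero => rw [add_zero]; exact Eqv.refl _
  | add a b _ _ ha hb => rw [← add_assoc]; exact (hb (y + a)).trans (ha y)
  | smul c a _ ha =>
    by_cases hc : c = 0
    · rw [hc, zero_smul, add_zero]; exact Eqv.refl _
    have e : y + c • a = c • (c⁻¹ • y + a) := by rw [smul_add, smul_inv_smul₀ hc]
    rw [e]
    refine ((h.DL l).D_smul_dir c _).trans (((ha _).smul _).trans ?_)
    refine ((h.DL l).D_smul_dir c _).symm.trans ?_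
    rw [smul_inv_smul₀ hc]; exact Eqv.refl _

theorem IsVal.D_of_mem_span {m : (E → ℝ) → ℂ} (h : IsVal m) (l : List E) {s : E}
    (hs : s ∈ Submodule.span ℝ {v | v ∈ l}) : Eqv (SUVal.D s (SUVal.DL l m)) 0 := by
  have := h.D_add_span l hs 0
  rwa [zero_add, D_zero_dir] at this

theorem setOf_mem_cons (v : E) (l : List E) : {w | w ∈ v :: l} = insert v {w | w ∈ l} := by
  ext; simp

theorem IsVal.DL_eqv_zero_or {m : (E → ℝ) → ℂ} (h : IsVal m) [FiniteDimensional ℝ E] :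
    ∀ l : List E, Eqv (SUVal.DL l m) 0 ∨
      Module.finrank ℝ (Submodule.span ℝ {v | v ∈ l}) = l.length
  | [] => Or.inr (by simp)
  | v :: l => by
    by_cases hv : v ∈ Submodule.span ℝ {v | v ∈ l}
    · exact Or.inl (h.D_of_mem_span l hv)
    rcases h.DL_eqv_zero_or l with h0 | h1
    · left
      have := h0.D v
      rwa [D_zero] at this
    · right
      rw [setOf_mem_cons, Submodule.span_insert, List.length_cons, ← h1, sup_comm]
      exact Submodule.finrank_sup_span_singleton hv

theorem IsVal.DL_exchange {m : (E → ℝ) → ℂ} (h : IsVal m) {a : E} (ha : a ≠ 0) :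
    ∀ l : List E, a ∈ Submodule.span ℝ {v | v ∈ l} → ∃ (l' : List E) (c : ℂ),
      l'.length + 1 = l.length ∧ (∀ v ∈ l', v ∈ l) ∧
      (Submodule.span ℝ {v | v ∈ l} ≤ Submodule.span ℝ {v | v ∈ a :: l'}) ∧
      Eqv (SUVal.DL l m) (c • SUVal.DL (a :: l') m)
  | [], h0 => absurd (by simpa using h0) ha
  | v :: l, h0 => by
    rw [setOf_mem_cons, Submodule.mem_span_insert] at h0
    obtain ⟨α, s, hs, hav⟩ := h0
    by_cases hα : α = 0
    · rw [hα, zero_smul, zero_add] at hav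
      rw [← hav] at hs
      obtain ⟨l', c, h1, h2, h3, h4⟩ := h.DL_exchange ha l hs
      refine ⟨v :: l', c, by simp [h1], fun w hw => ?_, ?_, ?_⟩
      · rcases List.mem_cons.1 hw with rfl | hw
        · exact List.mem_cons_self
        · exact List.mem_cons_of_mem _ (h2 w hw)
      · rw [setOf_mem_cons, setOf_mem_cons, setOf_mem_cons, Set.insert_comm,
          Submodule.span_insert v, Submodule.span_insert v, ← setOf_mem_cons]
        exact sup_le_sup_left h3 _
      · have := h4.D v
        rw [D_smul] at this
        refine this.trans ?_
        simp only [SUVal.DL]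
        rw [D_comm]; exact Eqv.refl _
    · have hv : v = α⁻¹ • (a + (-s)) := by
        rw [hav, add_neg_cancel_right, inv_smul_smul₀ hα]
      refine ⟨l, ((|α⁻¹| : ℝ) : ℂ), rfl, fun w hw => List.mem_cons_of_mem _ hw, ?_, ?_⟩
      · rw [Submodule.span_le, setOf_mem_cons, setOf_mem_cons]
        intro w hw
        rcases hw with rfl | hw
        · rw [hv]
          refine Submodule.smul_mem _ _ (Submodule.add_mem _
            (Submodule.subset_span (Set.mem_insert _ _)) (Submodule.neg_mem _ ?_))
          exact Submodule.span_mono (Set.subset_insert _ _) hs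
        · exact Submodule.subset_span (Set.mem_insert_of_mem _ hw)
      · simp only [SUVal.DL]
        conv_lhs => rw [hv]
        exact ((h.DL l).D_smul_dir _ _).trans ((h.D_add_span l (Submodule.neg_mem _ hs) a).smul _)

/-- Rotating an orthonormal pair does not change the second difference. -/
theorem IsVal.D_D_rotate {m : (E → ℝ) → ℂ} (h : IsVal m) (x y : E) {c s : ℝ}
    (hcs : c ^ 2 + s ^ 2 = 1) :
    Eqv (SUVal.D (c • x + s • y) (SUVal.D (-s • x + c • y) m)) (SUVal.D x (SUVal.D y m)) := by
  by_cases hc : c = 0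
  · have hs : |s| = 1 := by
      rw [hc] at hcs; rw [← sq_eq_sq₀ (abs_nonneg _) zero_le_one, sq_abs]; linarith
    rw [hc, zero_smul, zero_smul, zero_add, add_zero]
    refine ((h.D (-s • x)).D_smul_dir s y).trans ?_
    rw [hs, D_comm]
    refine (((h.D y).D_smul_dir (-s) x).smul _).trans ?_
    rw [abs_neg, hs]; simp [Eqv.refl]
  · set v := c • x + s • y with hv
    have e : -s • x + c • y = c⁻¹ • y + (-(s / c)) • v := by
      rw [hv, smul_add, smul_smul, smul_smul]
      have h1 : -(s / c) * c = -s := by field_simp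
      have h2 : c = c⁻¹ + -(s / c) * s := by field_simp; linarith
      rw [h1]; nth_rewrite 1 [h2]; rw [add_smul]; abel
    have k1 := h.D_add_span [v] (s := (-(s / c)) • v)
      (Submodule.smul_mem _ _ (Submodule.subset_span (by simp))) (c⁻¹ • y)
    simp only [SUVal.DL] at k1
    rw [← e] at k1
    rw [D_comm]
    refine k1.trans (((h.D v).D_smul_dir _ _).trans ?_)
    have k2 := h.D_add_span [y] (s := s • y)
      (Submodule.smul_mem _ _ (Submodule.subset_span (by simp))) (c • x)
    simp only [SUVal.DL] at k2
    rw [← hv] at k2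
    rw [D_comm]
    refine ((k2.trans ((h.D y).D_smul_dir _ _)).smul _).trans ?_
    intro f hf
    simp only [Pi.smul_apply, smul_eq_mul, ← mul_assoc, ← Complex.ofReal_mul, ← abs_mul,
      inv_mul_cancel₀ hc]
    simp

theorem IsVal.DL_dim {m : (E → ℝ) → ℂ} (h : IsVal m) [FiniteDimensional ℝ E] {l : List E}
    (hl : Module.finrank ℝ E < l.length) : Eqv (SUVal.DL l m) 0 := by
  rcases h.DL_eqv_zero_or l with h0 | h1
  · exact h0
  · have := Submodule.finrank_le (Submodule.span ℝ {v | v ∈ l})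
    omega

/-- All differences of `m` in segment directions vanish. -/
def SegInv (m : (E → ℝ) → ℂ) : Prop := ∀ v, Eqv (D v m) 0

/-- Orthonormal pairs: values only depend on the restriction to the orthogonal complement. -/
theorem IsVal.D_D_congr {m : (E → ℝ) → ℂ} (h : IsVal m) {f g : E → ℝ} (hf : Sublin f)
    (hg : Sublin g) {a b : E} (hab : inner ℝ a b = 0)
    (hfg : ∀ x, inner ℝ a x = 0 → inner ℝ b x = 0 → f x = g x) :
    SUVal.D a (SUVal.D b m) f = SUVal.D a (SUVal.D b m) g := by
  by_cases ha : a = 0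
  · subst ha; rw [D_zero_dir]; rfl
  let A : E →L[ℝ] E := ContinuousLinearMap.id ℝ E - ((‖a‖ ^ 2)⁻¹ • innerSL ℝ a).smulRight a
  have hA : ∀ x, A x = x - ((‖a‖ ^ 2)⁻¹ * inner ℝ a x) • a := fun x => by simp [A]
  have h1 : ∀ x, inner ℝ a x = 0 → A x = x := fun x hx => by rw [hA, hx]; simp
  have h2 : ∀ x, inner ℝ b x = 0 → inner ℝ b (A x) = 0 := fun x hx => by
    rw [hA, inner_sub_right, inner_smul_right, hx, real_inner_comm a b, hab]; simp
  have h3 : ∀ x, inner ℝ a (A x) = 0 := fun x => by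
    have : ‖a‖ ≠ 0 := norm_ne_zero_iff.2 ha
    rw [hA, inner_sub_right, inner_smul_right, real_inner_self_eq_norm_sq]; field_simp; ring
  rw [(h.D b).D_congr hf (hf.comp A) (v := a) (fun x hx => by simp [h1 x hx]),
    (h.D b).D_congr hg (hg.comp A) (v := a) (fun x hx => by simp [h1 x hx]), D_comm]
  exact (h.D a).D_congr (hf.comp A) (hg.comp A) (fun x hx => hfg _ (h3 x) (h2 x hx))

theorem integral_comp_simpleFunc {X G : Type*} [MeasurableSpace X] [NormedAddCommGroup G]
    [NormedSpace ℝ G] [CompleteSpace G] {Y : Type*} (ν : Measure X) [IsFiniteMeasure ν]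
    (π : SimpleFunc X Y) (F : Y → G) :
    ∫ x, F (π x) ∂ν = ∑ y ∈ π.range, ν.real (π ⁻¹' {y}) • F y := by
  have e : ∀ x, F (π x) = ∑ y ∈ π.range, (π ⁻¹' {y}).indicator (fun _ => F y) x := fun x => by
    rw [Finset.sum_eq_single (π x)]
    · simp
    · intro y _ hy
      exact Set.indicator_of_notMem (fun h => hy (by simpa using h.symm)) _
    · intro h; exact absurd (SimpleFunc.mem_range_self π x) h
  simp_rw [e]
  rw [integral_finsetSum]
  · exact Finset.sum_congr rfl fun y _ =>
      integral_indicator_const _ (π.measurableSet_fiber y)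
  · intro y _
    exact (integrable_const _).indicator (π.measurableSet_fiber y)

/-- Integrals over compact sets are approximated by finite sums, uniformly for functions with a
given modulus of continuity. -/
theorem exists_quadrature {X G : Type*} [MetricSpace X] [MeasurableSpace X]
    [OpensMeasurableSpace X] [NormedAddCommGroup G] [NormedSpace ℝ G] [CompleteSpace G]
    (ν : Measure X) {K : Set X}
    (hK : IsCompact K) (hν : ν K < ⊤) {δ : ℝ} (hδ : 0 < δ) :
    ∃ (s : Finset X) (w : X → ℝ), (∀ y ∈ s, y ∈ K) ∧ (∀ y, 0 ≤ w y) ∧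
      (∑ y ∈ s, w y = ν.real K) ∧
      ∀ (F : X → G) (η : ℝ), IntegrableOn F K ν →
        (∀ y ∈ K, ∀ y' ∈ K, dist y y' < δ → ‖F y - F y'‖ ≤ η) →
        ‖(∫ y in K, F y ∂ν) - ∑ y ∈ s, w y • F y‖ ≤ η * ν.real K := by
  rcases K.eq_empty_or_nonempty with rfl | hne
  · exact ⟨∅, 0, by simp, by simp, by simp, by simp⟩
  obtain ⟨t, htK, htf, hcov⟩ := hK.finite_cover_balls hδ
  have htne : t.Nonempty := by
    obtain ⟨x, hx⟩ := hne
    have := hcov hx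
    simp only [Set.mem_iUnion] at this
    obtain ⟨i, hi, _⟩ := this
    exact ⟨i, hi⟩
  obtain ⟨e, he⟩ := htf.countable.exists_eq_range htne
  have heK : ∀ k, e k ∈ K := fun k => htK (he ▸ Set.mem_range_self k)
  obtain ⟨N, hN⟩ : ∃ N, ∀ y ∈ t, ∃ k ≤ N, e k = y := by
    have : ∀ y ∈ t, ∃ k, e k = y := fun y hy => by rw [he] at hy; exact hy
    choose! k hk using this
    obtain ⟨N, hN⟩ := (htf.image k).bddAbove
    exact ⟨N, fun y hy => ⟨k y, hN ⟨y, hy, rfl⟩, hk y hy⟩⟩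
  let π := SimpleFunc.nearestPt e N
  have hπ : ∀ x ∈ K, dist (π x) x < δ := fun x hx => by
    have := hcov hx
    simp only [Set.mem_iUnion, Metric.mem_ball] at this
    obtain ⟨i, hi, hxi⟩ := this
    obtain ⟨k, hkN, rfl⟩ := hN i hi
    have h1 := SimpleFunc.edist_nearestPt_le e x hkN
    rw [edist_dist, edist_dist, ENNReal.ofReal_le_ofReal_iff dist_nonneg] at h1
    rw [dist_comm] at hxi
    exact h1.trans_lt hxi
  have hπK : ∀ x, π x ∈ K := fun x => heK _
  have : IsFiniteMeasure (ν.restrict K) := ⟨by rwa [Measure.restrict_apply_univ]⟩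
  refine ⟨π.range, fun y => (ν.restrict K).real (π ⁻¹' {y}), fun y hy => ?_,
    fun y => measureReal_nonneg, ?_, fun F η hF hη => ?_⟩
  · obtain ⟨x, rfl⟩ := SimpleFunc.mem_range.1 hy
    exact hπK x
  · have := integral_comp_simpleFunc (ν.restrict K) π (fun _ => (1 : ℝ))
    simp only [smul_eq_mul, mul_one, integral_const] at this
    rw [← this, measureReal_restrict_apply_univ]
  · have hI : Integrable (fun x => F (π x)) (ν.restrict K) :=
      SimpleFunc.integrable_of_isFiniteMeasure (π.map F)
    have h1 := integral_comp_simpleFunc (ν.restrict K) π F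
    rw [← h1, ← integral_sub hF hI]
    refine norm_setIntegral_le_of_norm_le_const hν fun x hx => ?_
    exact hη x hx _ (hπK x) (by rw [dist_comm]; exact hπ x hx)

/-- Finite sums of segments. -/
inductive Zon0 : (E → ℝ) → Prop
  | zero : Zon0 0
  | add_seg (q : E → ℝ) (v : E) : Zon0 q → Zon0 (q + seg v)

theorem Zon0.sublin {q : E → ℝ} (h : Zon0 q) : Sublin q := by
  induction h with
  | zero => exact Sublin.zero
  | add_seg q v _ ih => exact ih.add (Sublin.seg v)

theorem Zon0.add {p q : E → ℝ} (hp : Zon0 p) (hq : Zon0 q) : Zon0 (p + q) := by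
  induction hq with
  | zero => simpa using hp
  | add_seg q v _ ih => rw [← add_assoc]; exact ih.add_seg _ v

theorem Zon0.const_smul {q : E → ℝ} (hq : Zon0 q) {c : ℝ} (hc : 0 ≤ c) : Zon0 (c • q) := by
  induction hq with
  | zero => rw [smul_zero]; exact Zon0.zero
  | add_seg q v _ ih =>
    have := ih.add_seg _ (c • v)
    rwa [seg_smul, abs_of_nonneg hc, ← smul_add] at this

theorem Zon0.seg (v : E) : Zon0 (seg v) := by
  simpa using Zon0.zero.add_seg 0 v

theorem Zon0.sum {ι : Type*} (s : Finset ι) (q : ι → E → ℝ) (h : ∀ i ∈ s, Zon0 (q i)) :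
    Zon0 (∑ i ∈ s, q i) := by
  classical
  induction s using Finset.induction_on with
  | empty => simpa using Zon0.zero
  | insert a s ha ih =>
    rw [Finset.sum_insert ha]
    exact (h a (by simp)).add (ih fun i hi => h i (by simp [hi]))

/-- Limits of finite sums of segments. -/
def Zonoid (q : E → ℝ) : Prop := ∀ ε > 0, ∃ p, Zon0 p ∧ ∀ x, |p x - q x| ≤ ε * ‖x‖

theorem Zon0.zonoid {q : E → ℝ} (h : Zon0 q) : Zonoid q := fun ε hε => ⟨q, h, fun x => by
  simp; positivity⟩

theorem Zonoid.sublin {q : E → ℝ} (h : Zonoid q) : Sublin q :=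
  Sublin.of_approx fun ε hε => by
    obtain ⟨p, hp, H⟩ := h ε hε
    exact ⟨p, hp.sublin, H⟩

theorem Zonoid.add {p q : E → ℝ} (hp : Zonoid p) (hq : Zonoid q) : Zonoid (p + q) := by
  intro ε hε
  obtain ⟨p', hp', H⟩ := hp (ε / 2) (by positivity)
  obtain ⟨q', hq', H'⟩ := hq (ε / 2) (by positivity)
  refine ⟨p' + q', hp'.add hq', fun x => ?_⟩
  have h1 := H x; have h2 := H' x
  have : (p' + q') x - (p + q) x = (p' x - p x) + (q' x - q x) := by
    simp only [Pi.add_apply]; ring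
  rw [this]
  exact (abs_add_le _ _).trans (by linarith)

theorem Zonoid.const_smul {q : E → ℝ} (hq : Zonoid q) {c : ℝ} (hc : 0 ≤ c) :
    Zonoid (c • q) := by
  intro ε hε
  obtain ⟨q', hq', H⟩ := hq (ε / (c + 1)) (by positivity)
  refine ⟨c • q', hq'.const_smul hc, fun x => ?_⟩
  have h1 := H x
  simp only [Pi.smul_apply, smul_eq_mul, ← mul_sub, abs_mul, abs_of_nonneg hc]
  rw [div_mul_eq_mul_div, le_div_iff₀ (by positivity)] at h1
  nlinarith [abs_nonneg (q' x - q x)]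

theorem Zonoid.zero : Zonoid (0 : E → ℝ) := Zon0.zero.zonoid

theorem Zonoid.sum {ι : Type*} (s : Finset ι) (q : ι → E → ℝ) (h : ∀ i ∈ s, Zonoid (q i)) :
    Zonoid (∑ i ∈ s, q i) := by
  classical
  induction s using Finset.induction_on with
  | empty => simpa using Zonoid.zero
  | insert a s ha ih =>
    rw [Finset.sum_insert ha]
    exact (h a (by simp)).add (ih fun i hi => h i (by simp [hi]))

theorem Zon0.comp [CompleteSpace E] [CompleteSpace F] {q : E → ℝ} (h : Zon0 q)
    (A : F →L[ℝ] E) : Zon0 (q ∘ A) := by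
  induction h with
  | zero => exact Zon0.zero
  | add_seg q v _ ih =>
    have := ih.add_seg _ (ContinuousLinearMap.adjoint A v)
    convert this using 1
    ext x
    simp [SUVal.seg, ContinuousLinearMap.adjoint_inner_left]

theorem Zonoid.comp [CompleteSpace E] [CompleteSpace F] {q : E → ℝ} (h : Zonoid q)
    (A : F →L[ℝ] E) : Zonoid (q ∘ A) := fun ε hε => by
  obtain ⟨p, hp, H⟩ := h (ε / (‖A‖ + 1)) (by positivity)
  refine ⟨p ∘ A, hp.comp A, fun x => (H (A x)).trans ?_⟩
  have h1 : ‖A x‖ ≤ (‖A‖ + 1) * ‖x‖ := (A.le_opNorm x).trans (by nlinarith [norm_nonneg x])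
  rw [div_mul_eq_mul_div, div_le_iff₀ (by positivity)]
  nlinarith

theorem zonoid_integral {X : Type*} [MetricSpace X] [MeasurableSpace X] [OpensMeasurableSpace X]
    (ν : Measure X) {K : Set X} (hK : IsCompact K) (hν : ν K < ⊤) {V : X → E}
    (hV : ContinuousOn V K) : Zonoid (fun x => ∫ y in K, |inner ℝ (V y) x| ∂ν) := by
  intro ε hε
  set ε' := ε / (ν.real K + 1) with hε'
  have hν0 : 0 ≤ ν.real K := measureReal_nonneg
  have hε0 : 0 < ε' := by positivity
  obtain ⟨δ, hδ, H⟩ := Metric.uniformContinuousOn_iff.1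
    (hK.uniformContinuousOn_of_continuous hV) ε' hε0
  obtain ⟨s, w, hs, hw, -, hQ⟩ := exists_quadrature (G := ℝ) ν hK hν hδ
  refine ⟨∑ y ∈ s, w y • seg (V y), Zon0.sum _ _ fun y _ => (Zon0.seg _).const_smul (hw y),
    fun x => ?_⟩
  have := hQ (fun y => |inner ℝ (V y) x|) (ε' * ‖x‖)
    (ContinuousOn.integrableOn_of_subset_isCompact (by fun_prop) hK hK.measurableSet
      subset_rfl hν.ne) (fun y hy y' hy' hd => by
    have h1 := H y hy y' hy' hd
    rw [dist_eq_norm] at h1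
    refine (abs_abs_sub_abs_le _ _).trans ?_
    rw [← inner_sub_left]
    exact (abs_real_inner_le_norm _ _).trans
      (mul_le_mul_of_nonneg_right h1.le (norm_nonneg _)))
  rw [Real.norm_eq_abs, abs_sub_comm] at this
  simp only [Finset.sum_apply, Pi.smul_apply]
  refine this.trans ?_
  have h2 : ε' * ν.real K ≤ ε := by
    rw [hε', div_mul_eq_mul_div, div_le_iff₀ (by positivity)]; nlinarith
  nlinarith [norm_nonneg x]

theorem Zonoid.norm [FiniteDimensional ℝ E] : Zonoid (fun x : E => ‖x‖) := by
  rcases subsingleton_or_nontrivial E with hE | hE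
  · convert Zonoid.zero (E := E) using 1
    ext x; simp [Subsingleton.elim x 0]
  borelize E
  let K : Set E := Metric.closedBall 0 1
  have hK : IsCompact K := isCompact_closedBall 0 1
  have hν : (volume : Measure E) K < ⊤ := hK.measure_lt_top
  have hz := zonoid_integral (volume : Measure E) hK hν (V := id) continuousOn_id
  obtain ⟨e, he⟩ := exists_norm_eq E zero_le_one
  let J : E → ℝ := fun x => ∫ y in K, |inner ℝ (id y) x|
  have hcont : ∀ x : E, Continuous fun y : E => |inner ℝ (id y) x| := fun x => by
    simp only [id]; fun_prop
  have hJ : ∀ x, J x = ‖x‖ * J e := by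
    intro x
    have hn : ‖x‖ = ‖‖x‖ • e‖ := by simp [norm_smul, he]
    obtain ⟨A, hA⟩ : ∃ A : E ≃ₗᵢ[ℝ] E, A x = ‖x‖ • e :=
      ⟨_, Submodule.reflection_sub hn⟩
    have h1 : J x = J (‖x‖ • e) := by
      rw [← hA]
      have hp := A.measurePreserving
      have h2 := hp.setIntegral_preimage_emb A.toHomeomorph.measurableEmbedding
        (fun y => |inner ℝ (id y) (A x)|) K
      have hpre : A ⁻¹' K = K := by ext y; simp [K]
      rw [hpre] at h2
      simp only [J]
      rw [← h2]
      simp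
    rw [h1]
    simp only [J, inner_smul_right, abs_mul, abs_norm]
    exact integral_const_mul _ _
  have hpos : 0 < J e := by
    have hI : IntegrableOn (fun y : E => |inner ℝ (id y) e|) K :=
      (hcont e).continuousOn.integrableOn_compact hK
    rw [setIntegral_pos_iff_support_of_nonneg_ae
      (Filter.Eventually.of_forall fun y => abs_nonneg _) hI]
    refine lt_of_lt_of_le ?_ (measure_mono (s := Metric.ball ((1 / 2 : ℝ) • e) (1 / 4)) ?_)
    · exact Metric.measure_ball_pos _ _ (by norm_num)
    · intro y hy
      rw [Metric.mem_ball, dist_eq_norm] at hy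
      have h3 : ‖(1 / 2 : ℝ) • e‖ = 1 / 2 := by rw [norm_smul, he]; norm_num
      have h4 := abs_le.1 ((abs_real_inner_le_norm (y - (1 / 2 : ℝ) • e) e))
      rw [inner_sub_left, inner_smul_left, real_inner_self_eq_norm_sq, he] at h4
      simp only [one_pow, mul_one, conj_trivial] at h4
      constructor
      · simp only [Function.mem_support, id]
        have : 0 < inner ℝ y e := by linarith
        positivity
      · rw [mem_closedBall_zero_iff]
        have := norm_add_le (y - (1 / 2 : ℝ) • e) ((1 / 2 : ℝ) • e)
        rw [sub_add_cancel] at this; linarith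
  convert hz.const_smul (c := (J e)⁻¹) (inv_nonneg.2 hpos.le) using 1
  ext x
  have := hJ x
  simp only [J, Pi.smul_apply, smul_eq_mul] at this ⊢
  rw [this]
  change _ = (J e)⁻¹ * (‖x‖ * J e)
  field_simp

/-- The Euclidean norm as a function. -/
def nrm : E → ℝ := fun x => ‖x‖

theorem Sublin.nrm : Sublin (nrm : E → ℝ) := Sublin.norm

/-- `e` is a difference of support functions, of size at most `R`. -/
structure Bd (R : ℝ) (e : E → ℝ) : Prop where
  add : Sublin (R • nrm + e)
  sub : Sublin (R • nrm - e)
  abs : ∀ x, |e x| ≤ R * ‖x‖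

theorem Bd.neg {R : ℝ} {e : E → ℝ} (h : Bd R e) : Bd R (-e) :=
  ⟨by rw [← sub_eq_add_neg]; exact h.sub, by rw [sub_neg_eq_add]; exact h.add, fun x => by
    rw [Pi.neg_apply, abs_neg]; exact h.abs x⟩

theorem Bd.sum2 {R R' : ℝ} {e e' : E → ℝ} (h : Bd R e) (h' : Bd R' e') :
    Bd (R + R') (e + e') :=
  ⟨by rw [add_smul, add_add_add_comm]; exact h.add.add h'.add,
   by rw [add_smul, add_sub_add_comm]; exact h.sub.add h'.sub,
   fun x => (abs_add_le _ _).trans (by rw [add_mul]; exact add_le_add (h.abs x) (h'.abs x))⟩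

theorem Bd.mono {R R' : ℝ} {e : E → ℝ} (h : Bd R e) (hR : R ≤ R') : Bd R' e :=
  ⟨by
    have := h.add.add (Sublin.nrm.const_smul (sub_nonneg.2 hR))
    convert this using 1; rw [sub_smul]; abel,
   by
    have := h.sub.add (Sublin.nrm.const_smul (sub_nonneg.2 hR))
    convert this using 1; rw [sub_smul]; abel,
   fun x => (h.abs x).trans (mul_le_mul_of_nonneg_right hR (norm_nonneg x))⟩

theorem Bd.zero : Bd 0 (0 : E → ℝ) :=
  ⟨by simpa using Sublin.zero, by simpa using Sublin.zero, fun x => by simp⟩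

theorem Bd.const_smul {R : ℝ} {e : E → ℝ} (h : Bd R e) (c : ℝ) : Bd (|c| * R) (c • e) := by
  have key : ∀ c : ℝ, 0 ≤ c → Bd (c * R) (c • e) := fun c hc =>
    ⟨by rw [mul_smul, ← smul_add]; exact h.add.const_smul hc,
     by rw [mul_smul, ← smul_sub]; exact h.sub.const_smul hc,
     fun x => by
      rw [Pi.smul_apply, smul_eq_mul, abs_mul, abs_of_nonneg hc, mul_assoc]
      exact mul_le_mul_of_nonneg_left (h.abs x) hc⟩
  rcases le_total 0 c with hc | hc
  · rw [abs_of_nonneg hc]; exact key c hc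
  · rw [abs_of_nonpos hc]
    have := (key (-c) (by linarith)).neg
    rwa [neg_smul, neg_neg] at this

theorem Bd.sum {ι : Type*} (s : Finset ι) (R : ι → ℝ) (e : ι → E → ℝ)
    (h : ∀ i ∈ s, Bd (R i) (e i)) : Bd (∑ i ∈ s, R i) (∑ i ∈ s, e i) := by
  classical
  induction s using Finset.induction_on with
  | empty => simpa using Bd.zero
  | insert a s ha ih =>
    rw [Finset.sum_insert ha, Finset.sum_insert ha]
    exact (h a (by simp)).sum2 (ih fun i hi => h i (by simp [hi]))

/-- The closure of the differences of zonoids. -/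
def Nn (e : E → ℝ) : Prop := ∀ ε > 0, ∃ p q, Zonoid p ∧ Zonoid q ∧ Bd ε (e - (p - q))

theorem Nn.of_limit {e : E → ℝ} (h : ∀ ε > 0, ∃ e', Nn e' ∧ Bd ε (e - e')) : Nn e := by
  intro ε hε
  obtain ⟨e', he', hb⟩ := h (ε / 2) (by positivity)
  obtain ⟨p, q, hp, hq, hb'⟩ := he' (ε / 2) (by positivity)
  refine ⟨p, q, hp, hq, ?_⟩
  have := hb.sum2 hb'
  rwa [add_halves, sub_add_sub_cancel] at this

theorem Zonoid.nn {p : E → ℝ} (hp : Zonoid p) : Nn p := fun ε hε =>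
  ⟨p, 0, hp, Zonoid.zero, by simpa using Bd.zero.mono hε.le⟩

theorem Nn.neg {e : E → ℝ} (h : Nn e) : Nn (-e) := fun ε hε => by
  obtain ⟨p, q, hp, hq, hb⟩ := h ε hε
  refine ⟨q, p, hq, hp, ?_⟩
  convert hb.neg using 1
  abel

theorem Nn.add {e e' : E → ℝ} (h : Nn e) (h' : Nn e') : Nn (e + e') := fun ε hε => by
  obtain ⟨p, q, hp, hq, hb⟩ := h (ε / 2) (by positivity)
  obtain ⟨p', q', hp', hq', hb'⟩ := h' (ε / 2) (by positivity)
  refine ⟨p + p', q + q', hp.add hp', hq.add hq', ?_⟩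
  have := hb.sum2 hb'
  rw [add_halves] at this
  convert this using 1
  abel

theorem Nn.sub {e e' : E → ℝ} (h : Nn e) (h' : Nn e') : Nn (e - e') := by
  rw [sub_eq_add_neg]; exact h.add h'.neg

theorem Nn.const_smul {e : E → ℝ} (h : Nn e) (c : ℝ) : Nn (c • e) := by
  have key : ∀ c : ℝ, 0 ≤ c → Nn (c • e) := fun c hc ε hε => by
    obtain ⟨p, q, hp, hq, hb⟩ := h (ε / (c + 1)) (by positivity)
    refine ⟨c • p, c • q, hp.const_smul hc, hq.const_smul hc, ?_⟩
    have := hb.const_smul c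
    rw [smul_sub, smul_sub] at this
    refine this.mono ?_
    rw [abs_of_nonneg hc, mul_div_assoc', div_le_iff₀ (by positivity)]
    nlinarith
  rcases le_total 0 c with hc | hc
  · exact key c hc
  · have := (key (-c) (by linarith)).neg
    rwa [neg_smul, neg_neg] at this

theorem Nn.zero : Nn (0 : E → ℝ) := Zonoid.zero.nn

theorem Nn.sum {ι : Type*} (s : Finset ι) (e : ι → E → ℝ) (h : ∀ i ∈ s, Nn (e i)) :
    Nn (∑ i ∈ s, e i) := by
  classical
  induction s using Finset.induction_on with
  | empty => simpa using Nn.zero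
  | insert a s ha ih =>
    rw [Finset.sum_insert ha]
    exact (h a (by simp)).add (ih fun i hi => h i (by simp [hi]))

theorem IsVal.eq_of_approx {m : (E → ℝ) → ℂ} (hm : IsVal m) {f : E → ℝ} (hf : Sublin f) {c : ℂ}
    (h : ∀ ε > 0, ∃ g, Sublin g ∧ (∀ x, |g x - f x| ≤ ε * ‖x‖) ∧ m g = c) : m f = c := by
  by_contra hne
  have hpos : 0 < ‖c - m f‖ := norm_pos_iff.2 (sub_ne_zero.2 (Ne.symm hne))
  obtain ⟨δ, hδ, H⟩ := hm.cont f hf (‖c - m f‖ / 2) (by positivity)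
  obtain ⟨g, hg, hgf, hgc⟩ := h δ hδ
  have := H g hg hgf
  rw [hgc] at this
  linarith

theorem SegInv.zon0 {m : (E → ℝ) → ℂ} (h : SegInv m) {f z : E → ℝ} (hf : Sublin f)
    (hz : Zon0 z) : m (f + z) = m f := by
  induction hz with
  | zero => rw [add_zero]
  | add_seg q v hq ih =>
    rw [← add_assoc, ← ih]
    have := h v _ (hf.add hq.sublin)
    simpa [D, sub_eq_zero] using this

theorem SegInv.zonoid {m : (E → ℝ) → ℂ} (h : SegInv m) (hm : IsVal m) {f z : E → ℝ}
    (hf : Sublin f) (hz : Zonoid z) : m (f + z) = m f :=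
  hm.eq_of_approx (hf.add hz.sublin) fun ε hε => by
    obtain ⟨p, hp, H⟩ := hz ε hε
    exact ⟨f + p, hf.add hp.sublin, fun x => by simpa using H x, h.zon0 hf hp⟩

theorem SegInv.nn [FiniteDimensional ℝ E] {m : (E → ℝ) → ℂ} (h : SegInv m) (hm : IsVal m)
    {f e : E → ℝ} (hf : Sublin f) (he : Nn e) (hfe : Sublin (f + e)) : m (f + e) = m f := by
  refine (hm.eq_of_approx hf fun ε hε => ?_).symm
  obtain ⟨p, q, hp, hq, hb⟩ := he (ε / 2) (by positivity)
  have hz : Zonoid ((ε / 2) • (nrm : E → ℝ)) := Zonoid.norm.const_smul (by positivity)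
  refine ⟨f + ((ε / 2) • nrm + (e - (p - q))), hf.add hb.add, fun x => ?_, ?_⟩
  · have := hb.abs x
    simp only [Pi.add_apply, add_sub_cancel_left]
    refine (abs_add_le _ _).trans ?_
    simp only [Pi.smul_apply, nrm, smul_eq_mul, abs_mul, abs_norm]
    rw [abs_of_pos (by positivity : (0 : ℝ) < ε / 2)]
    linarith
  · rw [← h.zonoid hm (hf.add hb.add) hp, ← h.zonoid hm hfe (hz.add hq)]
    congr 1
    abel

theorem sublin_of_support {g : E → ℝ} (hom : ∀ t : ℝ, 0 ≤ t → ∀ x, g (t • x) = t * g x)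
    (bdd : ∃ C, ∀ x, g x ≤ C * ‖x‖)
    (h : ∀ x : E, ‖x‖ = 1 → ∃ l : E →ₗ[ℝ] ℝ, l x = g x ∧ ∀ z, ‖z‖ = 1 → l z ≤ g z) :
    Sublin g := by
  have g0 : g 0 = 0 := by simpa using hom 0 le_rfl 0
  have h' : ∀ x : E, x ≠ 0 → ∃ l : E →ₗ[ℝ] ℝ, l x = g x ∧ ∀ z, l z ≤ g z := fun x hx => by
    have hx' : ‖x‖ ≠ 0 := norm_ne_zero_iff.2 hx
    have hu : ∀ z : E, z ≠ 0 → ‖(‖z‖⁻¹ : ℝ) • z‖ = 1 := fun z hz => by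
      rw [norm_smul, norm_inv, norm_norm, inv_mul_cancel₀ (norm_ne_zero_iff.2 hz)]
    obtain ⟨l, hl, H⟩ := h _ (hu x hx)
    refine ⟨l, ?_, fun z => ?_⟩
    · rw [map_smul, hom _ (by positivity), smul_eq_mul] at hl
      exact mul_left_cancel₀ (inv_ne_zero hx') hl
    · by_cases hz : z = 0
      · rw [hz, map_zero, g0]
      · have := H _ (hu z hz)
        rw [map_smul, hom _ (by positivity), smul_eq_mul] at this
        have hz' : 0 < ‖z‖⁻¹ := by have := norm_pos_iff.2 hz; positivity
        exact le_of_mul_le_mul_left this hz'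
  refine ⟨fun x y => ?_, hom, bdd⟩
  by_cases hxy : x + y = 0
  · by_cases hx : x = 0
    · have hy : y = 0 := by rwa [hx, zero_add] at hxy
      rw [hx, hy]; simp [g0]
    · obtain ⟨l, hl, H⟩ := h' x hx
      have := H y
      rw [hxy, g0, ← hl]
      have h0 : l x + l y = 0 := by rw [← map_add, hxy, map_zero]
      linarith
  · obtain ⟨l, hl, H⟩ := h' _ hxy
    rw [← hl, map_add]
    exact add_le_add (H x) (H y)

/-- Zonal functions. -/
def Zn (y : E) (κ : ℝ → ℝ) : E → ℝ := fun x => ‖x‖ * κ (inner ℝ y x / ‖x‖)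

theorem Zn_hom (y : E) (κ : ℝ → ℝ) (t : ℝ) (ht : 0 ≤ t) (x : E) :
    Zn y κ (t • x) = t * Zn y κ x := by
  rcases ht.eq_or_lt with rfl | ht
  · simp [Zn]
  · simp only [Zn, norm_smul, Real.norm_of_nonneg ht.le, inner_smul_right]
    rw [mul_div_mul_left _ _ ht.ne', mul_assoc]

theorem inner_div_norm_le (y x : E) : |inner ℝ y x / ‖x‖| ≤ ‖y‖ := by
  by_cases hx : x = 0
  · simp [hx]
  · have := norm_pos_iff.2 hx
    rw [abs_div, abs_norm, div_le_iff₀ this]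
    exact abs_real_inner_le_norm y x

theorem Bd.zonal (y : E) {κ κ' : ℝ → ℝ} {S : ℝ}
    (h0 : ∀ t, |t| ≤ ‖y‖ → |κ t| ≤ S) (h1 : ∀ t, |t| ≤ ‖y‖ → |κ' t| ≤ S)
    (h2 : ∀ s t, |s| ≤ ‖y‖ → |t| ≤ ‖y‖ → |κ s - κ t - κ' t * (s - t)| ≤ S * (s - t) ^ 2) :
    Bd (S * (1 + ‖y‖ + 2 * ‖y‖ ^ 2)) (Zn y κ) := by
  have hS : 0 ≤ S := (abs_nonneg _).trans (h0 0 (by simp))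
  set R := S * (1 + ‖y‖ + 2 * ‖y‖ ^ 2) with hR
  have hSR : S ≤ R := by
    rw [hR]; nlinarith [norm_nonneg y, mul_nonneg hS (norm_nonneg y),
      mul_nonneg hS (sq_nonneg ‖y‖)]
  have habs : ∀ x, |Zn y κ x| ≤ S * ‖x‖ := fun x => by
    rw [Zn, abs_mul, abs_norm, mul_comm]
    exact mul_le_mul_of_nonneg_right (h0 _ (inner_div_norm_le y x)) (norm_nonneg x)
  have main : ∀ κ κ' : ℝ → ℝ, (∀ t, |t| ≤ ‖y‖ → |κ t| ≤ S) → (∀ t, |t| ≤ ‖y‖ → |κ' t| ≤ S) →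
    (∀ s t, |s| ≤ ‖y‖ → |t| ≤ ‖y‖ → |κ s - κ t - κ' t * (s - t)| ≤ S * (s - t) ^ 2) →
    Sublin (R • nrm + Zn y κ) := by
    intro κ κ' h0 h1 h2
    refine sublin_of_support (fun t ht x => ?_) ⟨R + S, fun x => ?_⟩ fun x hx => ?_
    · simp only [Pi.add_apply, Zn_hom y κ t ht x, Pi.smul_apply, nrm, norm_smul,
        Real.norm_of_nonneg ht, smul_eq_mul]; ring
    · have : |Zn y κ x| ≤ S * ‖x‖ := by
        rw [Zn, abs_mul, abs_norm, mul_comm]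
        exact mul_le_mul_of_nonneg_right (h0 _ (inner_div_norm_le y x)) (norm_nonneg x)
      have := (abs_le.1 this).2
      simp only [Pi.add_apply, Pi.smul_apply, nrm, smul_eq_mul]; linarith
    · set t : ℝ := inner ℝ y x with ht
      refine ⟨((κ t + R) • innerₛₗ ℝ x + κ' t • (innerₛₗ ℝ y - t • innerₛₗ ℝ x)), ?_,
        fun z hz => ?_⟩
      · simp only [LinearMap.add_apply, LinearMap.smul_apply, LinearMap.sub_apply,
          innerₛₗ_apply_apply, real_inner_self_eq_norm_sq, hx, smul_eq_mul, Pi.add_apply,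
          Pi.smul_apply, nrm, Zn, ← ht, div_one]
        ring
      · simp only [LinearMap.add_apply, LinearMap.smul_apply, LinearMap.sub_apply,
          innerₛₗ_apply_apply, smul_eq_mul, Pi.add_apply,
          Pi.smul_apply, nrm, Zn, hz, div_one]
        set s : ℝ := inner ℝ y z with hs
        set c : ℝ := inner ℝ x z with hc
        have hsy : |s| ≤ ‖y‖ := by simpa [hz] using abs_real_inner_le_norm y z
        have hty : |t| ≤ ‖y‖ := by simpa [hx] using abs_real_inner_le_norm y x
        have hc1 : ‖z - x‖ ^ 2 = 2 * (1 - c) := by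
          rw [norm_sub_sq_real, hz, hx, hc, real_inner_comm x z]; ring
        have hst : (s - t) ^ 2 ≤ ‖y‖ ^ 2 * (2 * (1 - c)) := by
          rw [← hc1, ← mul_pow, hs, ht, ← inner_sub_right, ← sq_abs]
          exact pow_le_pow_left₀ (abs_nonneg _) (abs_real_inner_le_norm _ _) 2
        have hc0 : 0 ≤ 1 - c := by nlinarith [sq_nonneg ‖z - x‖]
        have a1 := (abs_le.1 (h2 s t hsy hty)).1
        have a2 := (abs_le.1 (h0 t hty)).1
        have a3 : |κ' t * t| ≤ S * ‖y‖ := by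
          rw [abs_mul]; exact mul_le_mul (h1 t hty) hty (abs_nonneg _) hS
        have a4 := (abs_le.1 a3).2
        have a5 := mul_le_mul_of_nonneg_left hst hS
        have a6 : 0 ≤ (1 - c) * (S + κ t) := mul_nonneg hc0 (by linarith)
        have a7 : 0 ≤ (1 - c) * (S * ‖y‖ - κ' t * t) := mul_nonneg hc0 (by linarith)
        rw [hR]
        nlinarith
  refine ⟨main κ κ' h0 h1 h2, ?_, fun x => (habs x).trans
    (mul_le_mul_of_nonneg_right hSR (norm_nonneg x))⟩
  have := main (-κ) (-κ') (fun t ht => by simpa using h0 t ht) (fun t ht => by simpa using h1 t ht)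
    (fun s t hs ht => by
      have := h2 s t hs ht
      rw [← abs_neg] at this
      convert this using 2
      simp only [Pi.neg_apply]; ring)
  convert this using 1
  ext x
  simp [Zn, sub_eq_add_neg]

/-- The even function vanishing at `0` to second order with second derivative `γ (s ^ 2)`. -/
def prim2 (γ : ℝ → ℝ) (s : ℝ) : ℝ := ∫ t in (0 : ℝ)..s, (s - t) * γ (t ^ 2)

theorem prim2_sub {γ : ℝ → ℝ} (hγ : Continuous γ) (s t : ℝ) :
    prim2 γ s - prim2 γ t - (∫ u in (0 : ℝ)..t, γ (u ^ 2)) * (s - t)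
      = ∫ u in t..s, (s - u) * γ (u ^ 2) := by
  have hi : ∀ a b c : ℝ, IntervalIntegrable (fun u => (c - u) * γ (u ^ 2)) volume a b :=
    fun a b c => Continuous.intervalIntegrable (by fun_prop) _ _
  have hi' : ∀ a b : ℝ, IntervalIntegrable (fun u => γ (u ^ 2)) volume a b :=
    fun a b => Continuous.intervalIntegrable (by fun_prop) _ _
  rw [prim2, prim2, ← intervalIntegral.integral_add_adjacent_intervals (hi 0 t s) (hi t s s),
    mul_comm, ← intervalIntegral.integral_const_mul]
  have : ∫ u in (0 : ℝ)..t, (s - u) * γ (u ^ 2) =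
      (∫ u in (0 : ℝ)..t, (t - u) * γ (u ^ 2)) + ∫ u in (0 : ℝ)..t, (s - t) * γ (u ^ 2) := by
    rw [← intervalIntegral.integral_add (hi _ _ _) ((hi' _ _).const_mul _)]
    congr 1; ext u; ring
  rw [this]; ring

theorem prim2_hasDerivAt {γ : ℝ → ℝ} (hγ : Continuous γ) (s : ℝ) :
    HasDerivAt (prim2 γ) (∫ u in (0 : ℝ)..s, γ (u ^ 2)) s := by
  have e : prim2 γ = fun s => s * (∫ u in (0 : ℝ)..s, γ (u ^ 2))
      - ∫ u in (0 : ℝ)..s, u * γ (u ^ 2) := by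
    ext s
    rw [prim2, ← intervalIntegral.integral_const_mul, ← intervalIntegral.integral_sub]
    · congr 1; ext u; ring
    · exact Continuous.intervalIntegrable (by fun_prop) _ _
    · exact Continuous.intervalIntegrable (by fun_prop) _ _
  have h1 : HasDerivAt (fun s => ∫ u in (0 : ℝ)..s, γ (u ^ 2)) (γ (s ^ 2)) s :=
    (by fun_prop : Continuous fun u : ℝ => γ (u ^ 2)).integral_hasStrictDerivAt 0 s |>.hasDerivAt
  have h2 : HasDerivAt (fun s => ∫ u in (0 : ℝ)..s, u * γ (u ^ 2)) (s * γ (s ^ 2)) s :=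
    (by fun_prop : Continuous fun u : ℝ => u * γ (u ^ 2)).integral_hasStrictDerivAt 0 s
      |>.hasDerivAt
  rw [e]
  exact (((hasDerivAt_id s).mul h1).sub h2).congr_deriv (by simp)

theorem eq_prim2 {κ κ1 γ : ℝ → ℝ} (hγ : Continuous γ) (h1 : ∀ s, HasDerivAt κ (κ1 s) s)
    (h2 : ∀ s, HasDerivAt κ1 (γ (s ^ 2)) s) (h0 : κ1 0 = 0) (s : ℝ) :
    κ s = κ 0 + prim2 γ s := by
  have hI : ∀ s, HasDerivAt (fun s => ∫ u in (0 : ℝ)..s, γ (u ^ 2)) (γ (s ^ 2)) s := fun s =>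
    (by fun_prop : Continuous fun u : ℝ => γ (u ^ 2)).integral_hasStrictDerivAt 0 s |>.hasDerivAt
  have e1 : ∀ s, κ1 s = ∫ u in (0 : ℝ)..s, γ (u ^ 2) := fun s => by
    have hd : ∀ s, HasDerivAt (fun s => κ1 s - ∫ u in (0 : ℝ)..s, γ (u ^ 2)) 0 s := fun s => by
      exact ((h2 s).sub (hI s)).congr_deriv (by simp)
    have := is_const_of_deriv_eq_zero (fun s => (hd s).differentiableAt)
      (fun s => (hd s).deriv) s 0
    simpa [h0, sub_eq_zero] using this
  have hd : ∀ s, HasDerivAt (fun s => κ s - prim2 γ s) 0 s := fun s => by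
    exact ((h1 s).sub (prim2_hasDerivAt hγ s)).congr_deriv (by simp [e1])
  have := is_const_of_deriv_eq_zero (fun s => (hd s).differentiableAt)
    (fun s => (hd s).deriv) s 0
  have h00 : prim2 γ 0 = 0 := by simp [prim2]
  simp only [h00, sub_zero] at this
  linarith

theorem prim2_add {γ γ' : ℝ → ℝ} (hγ : Continuous γ) (hγ' : Continuous γ') :
    prim2 (γ + γ') = prim2 γ + prim2 γ' := by
  ext s
  simp only [prim2, Pi.add_apply, mul_add]
  exact intervalIntegral.integral_add (Continuous.intervalIntegrable (by fun_prop) _ _)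
    (Continuous.intervalIntegrable (by fun_prop) _ _)

theorem prim2_smul (γ : ℝ → ℝ) (c : ℝ) : prim2 (c • γ) = c • prim2 γ := by
  ext s
  simp only [prim2, Pi.smul_apply, smul_eq_mul]
  rw [← intervalIntegral.integral_const_mul]
  congr 1; ext u; ring

/-- The zonal function about `e` with profile `prim2 γ`. -/
def zon (e : E) (γ : ℝ → ℝ) : E → ℝ := Zn e (prim2 γ)

theorem zon_add (e : E) {γ γ' : ℝ → ℝ} (hγ : Continuous γ) (hγ' : Continuous γ') :
    zon e (γ + γ') = zon e γ + zon e γ' := by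
  ext x; simp [zon, Zn, prim2_add hγ hγ', mul_add]

theorem zon_smul (e : E) (γ : ℝ → ℝ) (c : ℝ) : zon e (c • γ) = c • zon e γ := by
  ext x; simp only [zon, Zn, prim2_smul, Pi.smul_apply, smul_eq_mul]; ring

theorem zon_sub (e : E) {γ γ' : ℝ → ℝ} (hγ : Continuous γ) (hγ' : Continuous γ') :
    zon e (γ - γ') = zon e γ - zon e γ' := by
  have : γ - γ' = γ + (-1 : ℝ) • γ' := by simp [sub_eq_add_neg]
  rw [this, zon_add e hγ (hγ'.const_smul _), zon_smul]; simp [sub_eq_add_neg]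

theorem sq_mem_Icc {u : ℝ} (hu : |u| ≤ 1) : u ^ 2 ∈ Set.Icc (0 : ℝ) 1 :=
  ⟨sq_nonneg _, by rw [← sq_abs]; exact pow_le_one₀ (abs_nonneg _) hu⟩

theorem abs_le_of_mem_uIoc {s t u : ℝ} (hs : |s| ≤ 1) (ht : |t| ≤ 1) (hu : u ∈ Set.uIoc t s) :
    |u| ≤ 1 ∧ |s - u| ≤ |s - t| := by
  have := Set.uIoc_subset_uIcc hu
  refine ⟨abs_le.2 ?_, Set.abs_sub_right_of_mem_uIcc this⟩
  have a := abs_le.1 hs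
  have b := abs_le.1 ht
  rcases Set.mem_uIcc.1 this with h | h <;> constructor <;> linarith [h.1, h.2]

theorem zon_bd {e : E} (he : ‖e‖ = 1) {γ : ℝ → ℝ} (hγ : Continuous γ) {S : ℝ}
    (hS : ∀ z ∈ Set.Icc (0 : ℝ) 1, |γ z| ≤ S) : Bd (4 * S) (zon e γ) := by
  have hS0 : 0 ≤ S := (abs_nonneg _).trans (hS 0 (by simp))
  have h2 : ∀ s t : ℝ, |s| ≤ 1 → |t| ≤ 1 →
      |prim2 γ s - prim2 γ t - (∫ u in (0 : ℝ)..t, γ (u ^ 2)) * (s - t)| ≤ S * (s - t) ^ 2 := by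
    intro s t hs ht
    rw [prim2_sub hγ, ← Real.norm_eq_abs]
    refine (intervalIntegral.norm_integral_le_of_norm_le_const (C := |s - t| * S)
      fun u hu => ?_).trans (le_of_eq ?_)
    · have := abs_le_of_mem_uIoc hs ht hu
      rw [norm_mul, Real.norm_eq_abs, Real.norm_eq_abs]
      exact mul_le_mul this.2 (hS _ (sq_mem_Icc this.1)) (abs_nonneg _) (abs_nonneg _)
    · rw [← sq_abs (s - t)]; ring
  have h1 : ∀ t : ℝ, |t| ≤ 1 → |∫ u in (0 : ℝ)..t, γ (u ^ 2)| ≤ S := fun t ht => by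
    rw [← Real.norm_eq_abs]
    refine (intervalIntegral.norm_integral_le_of_norm_le_const (C := S)
      fun u hu => ?_).trans ?_
    · exact hS _ (sq_mem_Icc (abs_le_of_mem_uIoc ht (by simp) hu).1)
    · rw [sub_zero]; exact mul_le_of_le_one_right hS0 ht
  have h0 : ∀ t : ℝ, |t| ≤ 1 → |prim2 γ t| ≤ S := fun t ht => by
    have := h2 t 0 ht (by simp)
    have h00 : prim2 γ 0 = 0 := by simp [prim2]
    rw [h00] at this
    simp only [intervalIntegral.integral_same, zero_mul, sub_zero] at this
    exact this.trans (mul_le_of_le_one_right hS0 (sq_mem_Icc ht).2)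
  have := Bd.zonal e (κ := prim2 γ) (κ' := fun t => ∫ u in (0 : ℝ)..t, γ (u ^ 2)) (S := S)
    (by rwa [he]) (by rwa [he]) (by rwa [he])
  rw [he] at this
  have e4 : 4 * S = S * (1 + 1 + 2 * 1 ^ 2) := by ring
  rw [e4]; exact this

theorem sqrt_ellipsoid {e : E} (he : ‖e‖ = 1) {t : ℝ} (ht : 0 ≤ t) [FiniteDimensional ℝ E] :
    Zonoid (Zn e (fun s => Real.sqrt (1 + t * s ^ 2))) := by
  have : CompleteSpace E := FiniteDimensional.complete ℝ E
  let A : E →L[ℝ] E := ContinuousLinearMap.id ℝ E +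
    ((Real.sqrt (1 + t) - 1) • innerSL ℝ e).smulRight e
  have hA : ∀ x, A x = x + ((Real.sqrt (1 + t) - 1) * inner ℝ e x) • e := fun x => by simp [A]
  convert Zonoid.norm.comp A using 1
  ext x
  rw [Function.comp_apply, ← Real.sqrt_sq (norm_nonneg (A x))]
  have hs := Real.sq_sqrt (by linarith : 0 ≤ 1 + t)
  have h1 : ‖A x‖ ^ 2 = ‖x‖ ^ 2 + t * inner ℝ e x ^ 2 := by
    rw [hA, norm_add_sq_real, norm_smul, he, inner_smul_right, real_inner_comm e x, mul_one,
      Real.norm_eq_abs, sq_abs]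
    linear_combination inner ℝ e x ^ 2 * hs
  rw [h1, Zn]
  by_cases hx : x = 0
  · simp [hx]
  have hx' : 0 < ‖x‖ := norm_pos_iff.2 hx
  rw [← Real.sqrt_sq hx'.le, ← Real.sqrt_mul (sq_nonneg _), Real.sqrt_sq hx'.le]
  congr 1
  field_simp

theorem Nn.zon_limit {e : E} (he : ‖e‖ = 1) {γ : ℝ → ℝ} (hγ : Continuous γ)
    (h : ∀ ε > 0, ∃ γ', Continuous γ' ∧ Nn (zon e γ') ∧
      ∀ z ∈ Set.Icc (0 : ℝ) 1, |γ z - γ' z| ≤ ε) : Nn (zon e γ) := by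
  refine Nn.of_limit fun ε hε => ?_
  obtain ⟨γ', hc, hn, hb⟩ := h (ε / 4) (by positivity)
  refine ⟨_, hn, ?_⟩
  rw [← zon_sub e hγ hc]
  convert zon_bd he (hγ.sub hc) hb using 1
  ring

/-- An auxiliary family of profiles. -/
def prof (k : ℕ) (a t z : ℝ) : ℝ := |z| ^ k * (1 + t * |z|) ^ (-a)

theorem prof_cont (k : ℕ) (a : ℝ) {t : ℝ} (ht : 0 ≤ t) : Continuous (prof k a t) := by
  unfold prof
  refine Continuous.mul (by fun_prop) (Continuous.rpow_const (by fun_prop) fun z => Or.inl ?_)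
  have : 0 ≤ t * |z| := by positivity
  linarith

theorem prof_abs_le (k : ℕ) {a t z : ℝ} (ha : 0 ≤ a) (ht : 0 ≤ t) (hz : z ∈ Set.Icc (0 : ℝ) 1) :
    |prof k a t z| ≤ 1 := by
  have h0 : 0 ≤ t * |z| := by positivity
  have h1 : |z| ≤ 1 := by rw [abs_of_nonneg hz.1]; exact hz.2
  have h3 : (0 : ℝ) ≤ (1 + t * |z|) ^ (-a) := Real.rpow_nonneg (by linarith) _
  rw [prof, abs_mul, abs_pow, abs_abs, abs_of_nonneg h3]
  refine mul_le_one₀ (pow_le_one₀ (abs_nonneg _) h1) h3 ?_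
  exact Real.rpow_le_one_of_one_le_of_nonpos (by linarith) (by linarith)

theorem prof_deriv (k : ℕ) (a z : ℝ) {t : ℝ} (ht : 0 ≤ t) :
    HasDerivAt (fun t => prof k a t z) (-a * prof (k + 1) (a + 1) t z) t := by
  have h0 : 0 ≤ t * |z| := by positivity
  have h1 : HasDerivAt (fun t => 1 + t * |z|) (1 * |z|) t :=
    ((hasDerivAt_id t).mul_const _).const_add 1
  have h2 := (h1.rpow_const (p := -a) (Or.inl (by linarith))).const_mul (|z| ^ k)
  unfold prof
  refine h2.congr_deriv ?_
  rw [show -(a + 1) = -a - 1 by ring]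
  ring

theorem prof_sub_le (k : ℕ) {a z t h : ℝ} (ha : 0 ≤ a) (ht : 0 ≤ t) (hh : 0 ≤ h)
    (hz : z ∈ Set.Icc (0 : ℝ) 1) : |prof k a (t + h) z - prof k a t z| ≤ a * h := by
  have := (convex_Icc t (t + h)).norm_image_sub_le_of_norm_hasDerivWithin_le
    (f := fun t => prof k a t z) (C := a)
    (fun u hu => (prof_deriv k a z (ht.trans hu.1)).hasDerivWithinAt) (fun u hu => by
      rw [norm_mul, norm_neg, Real.norm_of_nonneg ha]
      exact mul_le_of_le_one_right ha (prof_abs_le _ (by linarith) (ht.trans hu.1) hz))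
    (Set.left_mem_Icc.2 (by linarith)) (Set.right_mem_Icc.2 (by linarith))
  simpa [abs_of_nonneg hh] using this

theorem prof_quot (k : ℕ) {a z t h : ℝ} (ha : 0 ≤ a) (ht : 0 ≤ t) (hh : 0 ≤ h)
    (hz : z ∈ Set.Icc (0 : ℝ) 1) :
    |prof k a (t + h) z - prof k a t z + a * h * prof (k + 1) (a + 1) t z|
      ≤ a * (a + 1) * h * h := by
  have hd : ∀ u ∈ Set.Icc t (t + h), HasDerivWithinAt
      (fun u => prof k a u z + a * u * prof (k + 1) (a + 1) t z)
      (-a * prof (k + 1) (a + 1) u z + a * prof (k + 1) (a + 1) t z) (Set.Icc t (t + h)) u := by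
    intro u hu
    have h2 : HasDerivAt (fun u => a * u * prof (k + 1) (a + 1) t z)
        (a * 1 * prof (k + 1) (a + 1) t z) u :=
      ((hasDerivAt_id u).const_mul a).mul_const _
    have := ((prof_deriv k a z (ht.trans hu.1)).add h2).hasDerivWithinAt (s := Set.Icc t (t + h))
    rwa [mul_one] at this
  have := (convex_Icc t (t + h)).norm_image_sub_le_of_norm_hasDerivWithin_le
    (C := a * (a + 1) * h) hd (fun u hu => by
      have h3 := prof_sub_le (k + 1) (a := a + 1) (by linarith) ht (sub_nonneg.2 hu.1) hz
      rw [add_sub_cancel] at h3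
      have e : -a * prof (k + 1) (a + 1) u z + a * prof (k + 1) (a + 1) t z
        = -(a * (prof (k + 1) (a + 1) u z - prof (k + 1) (a + 1) t z)) := by ring
      rw [e, norm_neg, norm_mul, Real.norm_of_nonneg ha, mul_assoc]
      refine mul_le_mul_of_nonneg_left (h3.trans ?_) ha
      exact mul_le_mul_of_nonneg_left (by linarith [hu.2]) (by linarith))
    (Set.left_mem_Icc.2 (by linarith)) (Set.right_mem_Icc.2 (by linarith))
  rw [add_sub_cancel_left, Real.norm_of_nonneg hh] at this
  refine le_trans (le_of_eq ?_) this
  rw [Real.norm_eq_abs]; congr 1; ring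

theorem sqrt_eq_prim2 {t : ℝ} (ht : 0 ≤ t) (s : ℝ) :
    Real.sqrt (1 + t * s ^ 2) = 1 + prim2 (t • prof 0 (3 / 2) t) s := by
  have hp : ∀ s : ℝ, 0 < 1 + t * s ^ 2 := fun s => by positivity
  have hu : ∀ s : ℝ, HasDerivAt (fun s => 1 + t * s ^ 2) (t * (2 * s)) s := fun s => by
    simpa using ((hasDerivAt_pow 2 s).const_mul t).const_add 1
  have h1 : ∀ s : ℝ, HasDerivAt (fun s => Real.sqrt (1 + t * s ^ 2))
      (t * s * (1 + t * s ^ 2) ^ (-(1 / 2) : ℝ)) s := fun s => by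
    refine ((hu s).sqrt (hp s).ne').congr_deriv ?_
    rw [Real.rpow_neg (hp s).le, ← Real.sqrt_eq_rpow]
    field_simp
  have h2 : ∀ s : ℝ, HasDerivAt (fun s => t * s * (1 + t * s ^ 2) ^ (-(1 / 2) : ℝ))
      ((t • prof 0 (3 / 2) t) (s ^ 2)) s := fun s => by
    have := (((hasDerivAt_id s).const_mul t).mul
      ((hu s).rpow_const (p := -(1 / 2)) (Or.inl (hp s).ne')))
    refine this.congr_deriv ?_
    simp only [Pi.smul_apply, prof, smul_eq_mul, pow_zero, one_mul, abs_of_nonneg (sq_nonneg s),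
      mul_one, id]
    have e : (1 + t * s ^ 2) ^ (-(1 / 2) : ℝ)
        = (1 + t * s ^ 2) ^ (-(3 / 2) : ℝ) * (1 + t * s ^ 2) := by
      rw [← Real.rpow_add_one (hp s).ne']; norm_num
    rw [e, show (-(1 / 2) : ℝ) - 1 = -(3 / 2) by norm_num]
    ring
  have := eq_prim2 (γ := t • prof 0 (3 / 2) t) ((prof_cont 0 _ ht).const_smul t) h1 h2 (by simp) s
  rw [this]; simp

theorem Zn_one_add (e : E) (κ : ℝ → ℝ) : Zn e (fun s => 1 + κ s) = nrm + Zn e κ := by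
  ext x; simp [Zn, nrm, mul_add]

theorem ellipsoid_eq (e : E) {t : ℝ} (ht : 0 ≤ t) :
    Zn e (fun s => Real.sqrt (1 + t * s ^ 2)) = nrm + zon e (t • prof 0 (3 / 2) t) := by
  simp_rw [sqrt_eq_prim2 ht]; exact Zn_one_add e _

theorem Nn.zon_prof {e : E} (he : ‖e‖ = 1) [FiniteDimensional ℝ E] (k : ℕ) :
    ∀ t : ℝ, 0 ≤ t → Nn (zon e (prof k (k + 3 / 2) t)) := by
  induction k with
  | zero =>
    have key : ∀ t : ℝ, 0 < t → Nn (zon e (prof 0 (3 / 2) t)) := fun t ht => by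
      have h1 := (sqrt_ellipsoid he ht.le).nn
      rw [ellipsoid_eq e ht.le] at h1
      have h2 := (h1.sub Zonoid.norm.nn).const_smul t⁻¹
      rw [zon_smul] at h2
      convert h2 using 1
      ext x
      simp only [nrm, Pi.smul_apply, Pi.sub_apply, Pi.add_apply, smul_eq_mul]
      field_simp; ring
    intro t ht
    simp only [CharP.cast_eq_zero, zero_add]
    rcases ht.eq_or_lt with rfl | ht
    · refine Nn.zon_limit he (prof_cont _ _ le_rfl) fun ε hε => ?_
      have hε' : 0 < ε / (3 / 2) := by positivity
      refine ⟨_, prof_cont 0 (3 / 2) hε'.le, key _ hε', fun z hz => ?_⟩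
      have := prof_sub_le 0 (a := 3 / 2) (t := 0) (by norm_num) le_rfl hε'.le hz
      rw [zero_add, abs_sub_comm] at this
      refine this.trans (le_of_eq ?_)
      field_simp
    · exact key t ht
  | succ k ih =>
    intro t ht
    have ha : (0 : ℝ) ≤ k + 3 / 2 := by positivity
    refine Nn.zon_limit he (prof_cont _ _ ht) fun ε hε => ?_
    set a : ℝ := k + 3 / 2 with hadef
    have e1 : ((k + 1 : ℕ) : ℝ) + 3 / 2 = a + 1 := by push_cast; ring
    rw [e1]
    have hapos : 0 < a := by positivity
    set h : ℝ := ε / (a + 1) with hh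
    have hhpos : 0 < h := by positivity
    refine ⟨(-(a * h)⁻¹) • (prof k a (t + h) - prof k a t), ?_, ?_, fun z hz => ?_⟩
    · exact ((prof_cont _ _ (by linarith)).sub (prof_cont _ _ ht)).const_smul _
    · rw [zon_smul, zon_sub e (prof_cont _ _ (by linarith)) (prof_cont _ _ ht)]
      exact ((ih _ (by linarith)).sub (ih _ ht)).const_smul _
    · have := prof_quot k ha ht hhpos.le hz
      have e2 : prof (k + 1) (a + 1) t z
          - ((-(a * h)⁻¹) • (prof k a (t + h) - prof k a t)) z
          = (a * h)⁻¹ * (prof k a (t + h) z - prof k a t z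
            + a * h * prof (k + 1) (a + 1) t z) := by
        simp only [Pi.smul_apply, Pi.sub_apply, smul_eq_mul]
        field_simp; ring
      rw [e2, abs_mul, abs_of_nonneg (by positivity), inv_mul_le_iff₀ (by positivity)]
      refine this.trans (le_of_eq ?_)
      rw [hh]; field_simp

/-- Every zonal function with continuous even second derivative is a limit of differences of
zonoids. -/
theorem Nn.zon {e : E} (he : ‖e‖ = 1) [FiniteDimensional ℝ E] {γ : ℝ → ℝ} (hγ : Continuous γ) :
    Nn (zon e γ) := by
  have hmon : ∀ k : ℕ, Nn (SUVal.zon e (fun z => |z| ^ k)) := fun k => by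
    have := Nn.zon_prof he k 0 le_rfl
    convert this using 2
    ext z; simp [prof]
  refine Nn.zon_limit he hγ fun ε hε => ?_
  obtain ⟨p, hp⟩ := exists_polynomial_near_of_continuousOn 0 1 γ hγ.continuousOn ε hε
  have hall : ∀ s : Finset ℕ, Continuous (∑ k ∈ s, p.coeff k • fun z : ℝ => |z| ^ k) ∧
      Nn (SUVal.zon e (∑ k ∈ s, p.coeff k • fun z => |z| ^ k)) := fun s => by
    induction s using Finset.induction_on with
    | empty =>
      refine ⟨by simpa using continuous_zero, ?_⟩
      convert Nn.zero (E := E) using 1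
      ext x; simp [SUVal.zon, Zn, prim2]
    | insert k s hk ih =>
      have hc : Continuous (p.coeff k • fun z : ℝ => |z| ^ k) :=
        (continuous_abs.pow k).const_smul _
      rw [Finset.sum_insert hk]
      refine ⟨hc.add ih.1, ?_⟩
      rw [zon_add e hc ih.1, zon_smul]
      exact ((hmon k).const_smul _).add ih.2
  refine ⟨_, (hall p.support).1, (hall p.support).2, fun z hz => ?_⟩
  · have := hp z hz
    rw [abs_sub_comm, Polynomial.eval_eq_sum, Polynomial.sum] at this
    simp only [Finset.sum_apply, Pi.smul_apply, smul_eq_mul, abs_of_nonneg hz.1]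
    exact this.le

theorem hasDerivAt_posPart_pow (k : ℕ) (u : ℝ) :
    HasDerivAt (fun u : ℝ => max u 0 ^ (k + 2)) ((k + 2) * max u 0 ^ (k + 1)) u := by
  rcases lt_trichotomy u 0 with hu | rfl | hu
  · have h : (fun u : ℝ => max u 0 ^ (k + 2)) =ᶠ[nhds u] fun _ => 0 := by
      filter_upwards [gt_mem_nhds hu] with v hv
      rw [max_eq_right hv.le]; simp
    have := (hasDerivAt_const u (0 : ℝ)).congr_of_eventuallyEq h
    refine this.congr_deriv ?_
    rw [max_eq_right hu.le]; simp
  · have h : (fun u : ℝ => max u 0 ^ (k + 2)) =O[nhds 0] fun u : ℝ => ‖u - 0‖ ^ (k + 2) := by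
      refine Asymptotics.IsBigO.of_bound 1 (Filter.Eventually.of_forall fun u => ?_)
      rw [one_mul, norm_pow, norm_pow, norm_norm, sub_zero]
      refine pow_le_pow_left₀ (norm_nonneg _) ?_ _
      rw [Real.norm_of_nonneg (le_max_right _ _)]
      exact max_le (le_abs_self u) (abs_nonneg u)
    have := (h.hasFDerivAt (by lia)).hasDerivAt
    refine this.congr_deriv ?_
    simp
  · have h : (fun u : ℝ => max u 0 ^ (k + 2)) =ᶠ[nhds u] fun u => u ^ (k + 2) := by
      filter_upwards [lt_mem_nhds hu] with v hv
      rw [max_eq_left hv.le]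
    have := (hasDerivAt_pow (k + 2) u).congr_of_eventuallyEq h
    refine this.congr_deriv ?_
    rw [max_eq_left hu.le]; push_cast; rfl

theorem posPart_cube_taylor {u v : ℝ} (hu : u ≤ 1) (hv : v ≤ 1) :
    |max v 0 ^ 3 - max u 0 ^ 3 - 3 * max u 0 ^ 2 * (v - u)| ≤ 3 * (v - u) ^ 2 := by
  rcases le_total u 0 with h | h <;> rcases le_total v 0 with h' | h' <;>
    simp only [max_eq_left, max_eq_right, h, h'] <;> rw [abs_le]
  · constructor <;> nlinarith [sq_nonneg (v - u)]
  · have h1 : 0 ≤ v ^ 3 := by positivity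
    have h2 : v ^ 3 ≤ v ^ 2 := by nlinarith [sq_nonneg v]
    constructor <;> nlinarith [sq_nonneg (v - u), mul_nonneg h' (neg_nonneg.2 h), sq_nonneg u]
  · have e : (0 : ℝ) ^ 3 - u ^ 3 - 3 * u ^ 2 * (v - u) = u ^ 2 * (2 * u + 3 * (-v)) := by ring
    rw [e]
    have h1 : 0 ≤ u ^ 2 * (2 * u + 3 * (-v)) := by
      have : 0 ≤ -v := by linarith
      positivity
    have h2 : u * (u * (2 * u + 3 * (-v))) ≤ u * (2 * u + 3 * (-v)) :=
      mul_le_of_le_one_left (by have : 0 ≤ -v := by linarith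
                                positivity) hu
    have h3 : u * (u * (2 * u + 3 * (-v))) ≤ u * (2 * u + 3 * (-v)) := h2
    constructor
    · nlinarith [sq_nonneg (v - u)]
    · nlinarith [mul_nonneg h (neg_nonneg.2 h'), sq_nonneg v, sq_nonneg u]
  · have e : v ^ 3 - u ^ 3 - 3 * u ^ 2 * (v - u) = (v - u) ^ 2 * (v + 2 * u) := by ring
    rw [e]
    have h1 : 0 ≤ (v - u) ^ 2 * (v + 2 * u) := by positivity
    constructor
    · nlinarith [sq_nonneg (v - u)]
    · nlinarith [sq_nonneg (v - u)]

theorem Zn_smul_dir (e : E) (r : ℝ) (κ : ℝ → ℝ) : Zn (r • e) κ = Zn e (fun s => κ (r * s)) := by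
  ext x; simp only [Zn, inner_smul_left]; simp [mul_div_assoc]

theorem Zn_add (e : E) (κ κ' : ℝ → ℝ) : Zn e κ + Zn e κ' = Zn e (fun s => κ s + κ' s) := by
  ext x; simp [Zn, mul_add]

/-- Zonal functions with twice continuously differentiable even profile are limits of
differences of zonoids. -/
theorem Nn.zn_of_deriv [FiniteDimensional ℝ E] {e : E} (he : ‖e‖ = 1) {κ κ1 κ2 : ℝ → ℝ}
    (h1 : ∀ s, HasDerivAt κ (κ1 s) s) (h2 : ∀ s, HasDerivAt κ1 (κ2 s) s) (hc : Continuous κ2)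
    (hev : ∀ s, κ2 (-s) = κ2 s) (h0 : κ1 0 = 0) : Nn (Zn e κ) := by
  set γ : ℝ → ℝ := fun z => κ2 (Real.sqrt z) with hγ
  have hγc : Continuous γ := hc.comp Real.continuous_sqrt
  have h2' : ∀ s, HasDerivAt κ1 (γ (s ^ 2)) s := fun s => by
    have : γ (s ^ 2) = κ2 s := by
      simp only [hγ, Real.sqrt_sq_eq_abs]
      rcases abs_cases s with h | h <;> rw [h.1]
      exact hev s
    rw [this]; exact h2 s
  have hk : Zn e κ = κ 0 • nrm + SUVal.zon e γ := by
    ext x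
    simp only [Zn, eq_prim2 hγc h1 h2' h0 (inner ℝ e x / ‖x‖), Pi.add_apply, Pi.smul_apply, nrm,
      smul_eq_mul, SUVal.zon]
    ring
  rw [hk]
  exact (Zonoid.norm.nn.const_smul _).add (Nn.zon he hγc)

/-- A bump function concentrated on the directions within `ε` of `y`. -/
def cap (ε : ℝ) (y : E) : E → ℝ :=
  Zn y (fun s => max (ε ^ 2 - 1 - ‖y‖ ^ 2 + 2 * s) 0 ^ 3)

theorem cap_apply (ε : ℝ) (y : E) {x : E} (hx : x ≠ 0) :
    cap ε y x = ‖x‖ * max (ε ^ 2 - ‖‖x‖⁻¹ • x - y‖ ^ 2) 0 ^ 3 := by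
  have hx' : ‖x‖ ≠ 0 := norm_ne_zero_iff.2 hx
  rw [cap, Zn, norm_sub_sq_real, norm_smul, norm_inv, norm_norm, inv_mul_cancel₀ hx',
    inner_smul_left, real_inner_comm y x]
  simp only [map_inv₀, conj_trivial]
  congr 3
  field_simp; ring

theorem cap_zero (ε : ℝ) (y : E) : cap ε y 0 = 0 := by simp [cap, Zn]

theorem cap_nonneg (ε : ℝ) (y x : E) : 0 ≤ cap ε y x := by
  unfold cap Zn; positivity

theorem cap_near {ε : ℝ} (hε : 0 < ε) {y x : E} (h : cap ε y x ≠ 0) :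
    ‖‖x‖⁻¹ • x‖ = 1 ∧ ‖‖x‖⁻¹ • x - y‖ < ε := by
  have hx : x ≠ 0 := by rintro rfl; exact h (cap_zero ε y)
  have hx' : ‖x‖ ≠ 0 := norm_ne_zero_iff.2 hx
  refine ⟨by rw [norm_smul, norm_inv, norm_norm, inv_mul_cancel₀ hx'], ?_⟩
  by_contra hn
  rw [not_lt] at hn
  rw [cap_apply ε y hx, max_eq_right (by nlinarith [norm_nonneg (‖x‖⁻¹ • x - y)])] at h
  simp at h

theorem cap_disjoint {ε : ℝ} (hε : 0 < ε) (hε' : ε ≤ 1 / 4) (y z : E) :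
    (∀ x, cap ε y x = 0 ∨ cap ε z x = 0) ∨ (∀ x, cap ε y x = 0 ∨ cap ε (-z) x = 0) := by
  by_contra! h
  obtain ⟨⟨x, h1, h2⟩, x', h3, h4⟩ := h
  obtain ⟨n1, h1⟩ := cap_near hε h1
  have h2 := (cap_near hε h2).2
  have h3 := (cap_near hε h3).2
  have h4 := (cap_near hε h4).2
  set u := ‖x‖⁻¹ • x
  set u' := ‖x'‖⁻¹ • x'
  have e : (2 : ℝ) • y = -(u - y) + (u - z) + (u' - -z) + -(u' - y) := by module
  have a1 := norm_add_le (-(u - y) + (u - z) + (u' - -z)) (-(u' - y))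
  have a2 := norm_add_le (-(u - y) + (u - z)) (u' - -z)
  have a3 := norm_add_le (-(u - y)) (u - z)
  rw [← e, norm_smul, norm_neg, Real.norm_ofNat] at a1
  rw [norm_neg] at a3
  have a4 : ‖u‖ ≤ ‖u - y‖ + ‖y‖ := by simpa using norm_add_le (u - y) y
  linarith

theorem cap_bd {ε : ℝ} (hε : 0 < ε) (hε' : ε ≤ 1 / 4) {y : E} (hy : ‖y‖ ≤ 2) :
    Bd 132 (cap ε y) := by
  have hle : ∀ t : ℝ, |t| ≤ ‖y‖ → ε ^ 2 - 1 - ‖y‖ ^ 2 + 2 * t ≤ 1 := fun t ht => by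
    have := (abs_le.1 ht).2
    nlinarith [sq_nonneg (‖y‖ - 1)]
  have hm : ∀ t : ℝ, |t| ≤ ‖y‖ → max (ε ^ 2 - 1 - ‖y‖ ^ 2 + 2 * t) 0 ≤ 1 := fun t ht =>
    max_le (hle t ht) zero_le_one
  have := Bd.zonal y (κ := fun s => max (ε ^ 2 - 1 - ‖y‖ ^ 2 + 2 * s) 0 ^ 3)
    (κ' := fun s => 6 * max (ε ^ 2 - 1 - ‖y‖ ^ 2 + 2 * s) 0 ^ 2) (S := 12)
    (fun t ht => by
      rw [abs_of_nonneg (by positivity)]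
      exact (pow_le_one₀ (le_max_right _ _) (hm t ht)).trans (by norm_num))
    (fun t ht => by
      rw [abs_of_nonneg (by positivity)]
      have := pow_le_one₀ (n := 2) (le_max_right _ _) (hm t ht)
      linarith)
    (fun s t hs ht => by
      have := posPart_cube_taylor (hle t ht) (hle s hs)
      convert this using 1
      · congr 1; ring
      · ring)
  refine this.mono ?_
  nlinarith [norm_nonneg y]

theorem cap_neg (ε : ℝ) (y : E) :
    cap ε (-y) = Zn y (fun s => max (ε ^ 2 - 1 - ‖y‖ ^ 2 - 2 * s) 0 ^ 3) := by
  have := Zn_smul_dir y (-1) (fun s => max (ε ^ 2 - 1 - ‖y‖ ^ 2 + 2 * s) 0 ^ 3)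
  rw [neg_one_smul] at this
  rw [cap, norm_neg, this]
  congr 1; ext s; congr 2; ring

theorem Nn.cap_add_neg [FiniteDimensional ℝ E] (ε : ℝ) (y : E) :
    Nn (cap ε y + cap ε (-y)) := by
  rcases eq_or_ne y 0 with rfl | hy
  · have : cap ε (0 : E) = (max (ε ^ 2 - 1) 0 ^ 3) • nrm := by
      ext x; simp [cap, Zn, nrm, mul_comm]
    rw [neg_zero, this]
    exact (Zonoid.norm.nn.const_smul _).add (Zonoid.norm.nn.const_smul _)
  have hr : ‖y‖ ≠ 0 := norm_ne_zero_iff.2 hy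
  set r := ‖y‖ with hrd
  set e := r⁻¹ • y with he
  have he1 : ‖e‖ = 1 := by rw [he, norm_smul, norm_inv, norm_norm, inv_mul_cancel₀ hr]
  have hye : y = r • e := by rw [he, smul_smul, mul_inv_cancel₀ hr, one_smul]
  set b := ε ^ 2 - 1 - r ^ 2
  have hk : cap ε y + cap ε (-y) = Zn e (fun s => max (b + 2 * (r * s)) 0 ^ 3
      + max (b - 2 * (r * s)) 0 ^ 3) := by
    rw [cap_neg, cap, Zn_add]
    conv_lhs => rw [← hrd]
    exact (congrArg (fun w => Zn w _) hye).trans (Zn_smul_dir e r _)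
  have l1 : ∀ s, HasDerivAt (fun s => b + 2 * (r * s)) (2 * r) s := fun s =>
    (((hasDerivAt_id s).const_mul r).const_mul 2 |>.const_add b).congr_deriv (by ring)
  have l2 : ∀ s, HasDerivAt (fun s => b - 2 * (r * s)) (-(2 * r)) s := fun s =>
    (((hasDerivAt_id s).const_mul r).const_mul 2 |>.const_sub b).congr_deriv (by ring)
  rw [hk]
  refine Nn.zn_of_deriv he1
    (κ1 := fun s => 3 * max (b + 2 * (r * s)) 0 ^ 2 * (2 * r)
      + 3 * max (b - 2 * (r * s)) 0 ^ 2 * (-(2 * r)))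
    (κ2 := fun s => 3 * (2 * max (b + 2 * (r * s)) 0 * (2 * r)) * (2 * r)
      + 3 * (2 * max (b - 2 * (r * s)) 0 * (-(2 * r))) * (-(2 * r)))
    (fun s => ?_) (fun s => ?_) (by fun_prop) (fun s => ?_) (by simp)
  · exact (((hasDerivAt_posPart_pow 1 _).comp s (l1 s)).add
      ((hasDerivAt_posPart_pow 1 _).comp s (l2 s))).congr_deriv (by norm_num)
  · exact (((((hasDerivAt_posPart_pow 0 _).comp s (l1 s)).const_mul 3).mul_const (2 * r)).add
      ((((hasDerivAt_posPart_pow 0 _).comp s (l2 s)).const_mul 3).mul_const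
        (-(2 * r)))).congr_deriv (by norm_num)
  · simp only [mul_neg, sub_neg_eq_add, ← sub_eq_add_neg]; ring

/-- Functions which become support functions after adding a large multiple of the norm. -/
def HasBd (q : E → ℝ) : Prop := ∃ R, Bd R q

theorem HasBd.add {q q' : E → ℝ} (h : HasBd q) (h' : HasBd q') : HasBd (q + q') := by
  obtain ⟨R, h⟩ := h; obtain ⟨R', h'⟩ := h'; exact ⟨_, h.sum2 h'⟩

theorem HasBd.const_smul {q : E → ℝ} (h : HasBd q) (c : ℝ) : HasBd (c • q) := by
  obtain ⟨R, h⟩ := h; exact ⟨_, h.const_smul c⟩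

theorem HasBd.zero : HasBd (0 : E → ℝ) := ⟨0, Bd.zero⟩

theorem HasBd.sum {ι : Type*} (s : Finset ι) (q : ι → E → ℝ) (h : ∀ i ∈ s, HasBd (q i)) :
    HasBd (∑ i ∈ s, q i) := by
  classical
  induction s using Finset.induction_on with
  | empty => simpa using HasBd.zero
  | insert a s ha ih =>
    rw [Finset.sum_insert ha]
    exact (h a (by simp)).add (ih fun i hi => h i (by simp [hi]))

open Classical in
/-- Extension of a functional on support functions to differences of support functions. -/
def Ext (m : (E → ℝ) → ℂ) (q : E → ℝ) : ℂ :=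
  if h : HasBd q then m (h.choose • nrm + q) else 0

theorem SegInv.ext_eq [FiniteDimensional ℝ E] {m : (E → ℝ) → ℂ} (hs : SegInv m) (hm : IsVal m)
    {R : ℝ} {q : E → ℝ} (h : Bd R q) : Ext m q = m (R • nrm + q) := by
  have key : ∀ R R', R ≤ R' → Bd R q → m (R' • nrm + q) = m (R • nrm + q) := fun R R' hR h => by
    have hz : Zonoid ((R' - R) • (nrm : E → ℝ)) := Zonoid.norm.const_smul (sub_nonneg.2 hR)
    rw [← hs.zonoid hm h.add hz]
    congr 1; rw [sub_smul]; abel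
  have hb : HasBd q := ⟨R, h⟩
  rw [Ext, dif_pos hb]
  rcases le_total hb.choose R with h' | h'
  · exact (key _ _ h' hb.choose_spec).symm
  · exact key _ _ h' h

theorem SegInv.ext_zero [FiniteDimensional ℝ E] {m : (E → ℝ) → ℂ} (hs : SegInv m) (hm : IsVal m) :
    Ext m 0 = m 0 := by rw [hs.ext_eq hm Bd.zero]; simp

theorem SegInv.ext_add_nn [FiniteDimensional ℝ E] {m : (E → ℝ) → ℂ} (hs : SegInv m)
    (hm : IsVal m) {q e : E → ℝ} (hq : HasBd q) (hqe : HasBd (q + e)) (he : Nn e) :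
    Ext m (q + e) = Ext m q := by
  obtain ⟨R, h⟩ := hq
  obtain ⟨R', h'⟩ := hqe
  have h := h.mono (le_max_left R R')
  have h' := h'.mono (le_max_right R R')
  rw [hs.ext_eq hm h, hs.ext_eq hm h', ← add_assoc]
  exact hs.nn hm h.add he (by rw [add_assoc]; exact h'.add)

theorem IsVal.local_add {m : (E → ℝ) → ℂ} (hm : IsVal m) {B e e' : E → ℝ} (h0 : Sublin B)
    (h1 : Sublin (B + e)) (h2 : Sublin (B + e')) (h3 : Sublin (B + (e + e')))
    (hd : ∀ x, e x = 0 ∨ e' x = 0) (hs : (∀ x, 0 ≤ e x) ∨ ∀ x, e x ≤ 0)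
    (hs' : (∀ x, 0 ≤ e' x) ∨ ∀ x, e' x ≤ 0) :
    m (B + (e + e')) + m B = m (B + e) + m (B + e') := by
  rcases hs with hs | hs <;> rcases hs' with hs' | hs'
  · have e1 : (B + e) ⊔ (B + e') = B + (e + e') := by
      ext x; simp only [Pi.sup_apply, Pi.add_apply]
      rcases hd x with h | h <;> simp [h, hs x, hs' x]
    have e2 : (B + e) ⊓ (B + e') = B := by
      ext x; simp only [Pi.inf_apply, Pi.add_apply]
      rcases hd x with h | h <;> simp [h, hs x, hs' x]
    have := hm.lat _ _ h1 h2 (by rwa [e2])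
    rwa [e1, e2] at this
  · have e1 : (B + (e + e')) ⊔ B = B + e := by
      ext x; simp only [Pi.sup_apply, Pi.add_apply]
      rcases hd x with h | h <;> simp [h, hs x, hs' x]
    have e2 : (B + (e + e')) ⊓ B = B + e' := by
      ext x; simp only [Pi.inf_apply, Pi.add_apply]
      rcases hd x with h | h <;> simp [h, hs x, hs' x]
    have := hm.lat _ _ h3 h0 (by rwa [e2])
    rw [e1, e2] at this
    exact this.symm
  · have e1 : (B + (e + e')) ⊔ B = B + e' := by
      ext x; simp only [Pi.sup_apply, Pi.add_apply]
      rcases hd x with h | h <;> simp [h, hs x, hs' x]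
    have e2 : (B + (e + e')) ⊓ B = B + e := by
      ext x; simp only [Pi.inf_apply, Pi.add_apply]
      rcases hd x with h | h <;> simp [h, hs x, hs' x]
    have := hm.lat _ _ h3 h0 (by rwa [e2])
    rw [e1, e2] at this
    rw [← this, add_comm]
  · have e1 : (B + e) ⊔ (B + e') = B := by
      ext x; simp only [Pi.sup_apply, Pi.add_apply]
      rcases hd x with h | h <;> simp [h, hs x, hs' x]
    have e2 : (B + e) ⊓ (B + e') = B + (e + e') := by
      ext x; simp only [Pi.inf_apply, Pi.add_apply]
      rcases hd x with h | h <;> simp [h, hs x, hs' x]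
    have := hm.lat _ _ h1 h2 (by rwa [e2])
    rw [e1, e2] at this
    rw [← this, add_comm]

theorem SegInv.ext_local [FiniteDimensional ℝ E] {m : (E → ℝ) → ℂ} (hs : SegInv m)
    (hm : IsVal m) {q e e' : E → ℝ} (hq : HasBd q) (he : HasBd e) (he' : HasBd e')
    (hd : ∀ x, e x = 0 ∨ e' x = 0) (hse : (∀ x, 0 ≤ e x) ∨ ∀ x, e x ≤ 0)
    (hse' : (∀ x, 0 ≤ e' x) ∨ ∀ x, e' x ≤ 0) :
    Ext m (q + (e + e')) + Ext m q = Ext m (q + e) + Ext m (q + e') := by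
  obtain ⟨R, h⟩ := hq
  obtain ⟨S, h'⟩ := he
  obtain ⟨T, h''⟩ := he'
  have b0 : Bd (|R| + (|S| + |T|)) q := h.mono (by
    have := le_abs_self R; have := abs_nonneg S; have := abs_nonneg T; linarith)
  have b1 : Bd (|R| + (|S| + |T|)) (q + e) := (h.sum2 h').mono (by
    have := le_abs_self R; have := le_abs_self S; have := abs_nonneg T; linarith)
  have b2 : Bd (|R| + (|S| + |T|)) (q + e') := (h.sum2 h'').mono (by
    have := le_abs_self R; have := abs_nonneg S; have := le_abs_self T; linarith)
  have b3 : Bd (|R| + (|S| + |T|)) (q + (e + e')) := (h.sum2 (h'.sum2 h'')).mono (by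
    have := le_abs_self R; have := le_abs_self S; have := le_abs_self T; linarith)
  rw [hs.ext_eq hm b0, hs.ext_eq hm b1, hs.ext_eq hm b2, hs.ext_eq hm b3]
  simp only [← add_assoc _ q]
  exact hm.local_add b0.add (by rw [add_assoc]; exact b1.add) (by rw [add_assoc]; exact b2.add)
    (by rw [add_assoc]; exact b3.add) hd hse hse'

theorem smul_cap_sign (ε : ℝ) (y : E) (a : ℝ) :
    (∀ x, 0 ≤ (a • cap ε y) x) ∨ ∀ x, (a • cap ε y) x ≤ 0 := by
  rcases le_total 0 a with h | h
  · exact Or.inl fun x => mul_nonneg h (cap_nonneg ε y x)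
  · exact Or.inr fun x => mul_nonpos_of_nonpos_of_nonneg h (cap_nonneg ε y x)

theorem SegInv.ext_cap [FiniteDimensional ℝ E] {m : (E → ℝ) → ℂ} (hs : SegInv m)
    (hm : IsVal m) {ε : ℝ} (hε : 0 < ε) (hε' : ε ≤ 1 / 4) {q : E → ℝ} (hq : HasBd q) {y z : E}
    (hy : ‖y‖ ≤ 2) (hz : ‖z‖ ≤ 2) (a b : ℝ) :
    Ext m (q + (a • cap ε y + b • cap ε z)) + Ext m q
      = Ext m (q + a • cap ε y) + Ext m (q + b • cap ε z) := by
  have hb : ∀ y : E, ‖y‖ ≤ 2 → ∀ a : ℝ, HasBd (a • cap ε y) := fun y hy a =>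
    HasBd.const_smul ⟨_, cap_bd hε hε' hy⟩ a
  rcases cap_disjoint hε hε' y z with h | h
  · exact hs.ext_local hm hq (hb y hy a) (hb z hz b)
      (fun x => (h x).imp (fun h => by simp [h]) (fun h => by simp [h]))
      (smul_cap_sign _ _ _) (smul_cap_sign _ _ _)
  · have hz' : ‖-z‖ ≤ 2 := by rwa [norm_neg]
    have := hs.ext_local hm hq (hb y hy a) (hb _ hz' (-b))
      (fun x => (h x).imp (fun h => by simp [h]) (fun h => by simp [h]))
      (smul_cap_sign _ _ _) (smul_cap_sign _ _ _)
    have hn := (Nn.cap_add_neg ε z).const_smul b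
    have key : ∀ q, HasBd q → Ext m (q + b • cap ε z) = Ext m (q + (-b) • cap ε (-z)) :=
      fun q hq => by
        have e : q + b • cap ε z = (q + (-b) • cap ε (-z)) + b • (cap ε z + cap ε (-z)) := by
          module
        rw [e]
        exact hs.ext_add_nn hm (hq.add (hb _ hz' _)) (by rw [← e]; exact hq.add (hb _ hz _)) hn
    rw [key q hq, ← add_assoc, key _ (hq.add (hb y hy a)), add_assoc]
    exact this

theorem SegInv.ext_smul_cap [FiniteDimensional ℝ E] {m : (E → ℝ) → ℂ} (hs : SegInv m)
    (hm : IsVal m) {ε : ℝ} (hε : 0 < ε) (hε' : ε ≤ 1 / 4) {y : E} (hy : ‖y‖ ≤ 2)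
    (h : Ext m (cap ε y) = m 0) (a : ℝ) : Ext m (a • cap ε y) = m 0 := by
  have hb := cap_bd hε hε' hy
  have h00 := hs.ext_zero hm
  have hadd : ∀ a b : ℝ, Ext m ((a + b) • cap ε y) + m 0
      = Ext m (a • cap ε y) + Ext m (b • cap ε y) := fun a b => by
    have := hs.ext_cap hm hε hε' HasBd.zero hy hy a b
    rwa [zero_add, zero_add, zero_add, h00, ← add_smul] at this
  have hpos : ∀ a : ℝ, 0 ≤ a → Ext m (a • cap ε y) = m 0 := fun a ha => by
    have := linear_of_additive (φ := fun t => Ext m (t • cap ε y) - m 0)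
      (fun s t _ _ => by have := hadd s t; linear_combination this) (fun η hη => by
        obtain ⟨δ, hδ, H⟩ := hm.cont 0 Sublin.zero η hη
        refine ⟨δ / 264, by positivity, fun t ht htδ => ?_⟩
        have hbt := hb.const_smul t
        rw [abs_of_nonneg ht] at hbt
        rw [hs.ext_eq hm hbt]
        refine H _ hbt.add fun x => ?_
        have := hbt.abs x
        simp only [Pi.zero_apply, sub_zero, Pi.add_apply]
        refine (abs_add_le _ _).trans ?_
        have e : |((t * 132) • (nrm : E → ℝ)) x| = t * 132 * ‖x‖ := by
          simp only [Pi.smul_apply, nrm, smul_eq_mul]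
          exact abs_of_nonneg (by positivity)
        rw [e]
        have := mul_le_mul_of_nonneg_right htδ (norm_nonneg x)
        linarith) ha
    simp only [one_smul, h, sub_self, mul_zero] at this
    exact sub_eq_zero.1 this
  rcases le_total 0 a with ha | ha
  · exact hpos a ha
  · have := hadd a (-a)
    rw [add_neg_cancel, zero_smul, h00, hpos (-a) (by linarith)] at this
    exact (add_right_cancel this).symm

theorem SegInv.ext_sum_cap [FiniteDimensional ℝ E] {m : (E → ℝ) → ℂ} (hs : SegInv m)
    (hm : IsVal m) {ε : ℝ} (hε : 0 < ε) (hε' : ε ≤ 1 / 4)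
    (h : ∀ y : E, ‖y‖ ≤ 2 → Ext m (cap ε y) = m 0) (s : Finset E) (hsn : ∀ y ∈ s, ‖y‖ ≤ 2)
    (c : E → ℝ) : Ext m (∑ y ∈ s, c y • cap ε y) = m 0 := by
  have hb : ∀ y : E, ‖y‖ ≤ 2 → ∀ a : ℝ, HasBd (a • cap ε y) := fun y hy a =>
    HasBd.const_smul ⟨_, cap_bd hε hε' hy⟩ a
  have key : ∀ s : Finset E, (∀ y ∈ s, ‖y‖ ≤ 2) → ∀ z : E, ‖z‖ ≤ 2 → ∀ a : ℝ,
      Ext m (∑ y ∈ s, c y • cap ε y + a • cap ε z) = Ext m (∑ y ∈ s, c y • cap ε y) := by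
    classical
    intro s
    induction s using Finset.induction_on with
    | empty =>
      intro _ z hz a
      simp only [Finset.sum_empty, zero_add]
      rw [hs.ext_smul_cap hm hε hε' hz (h z hz), hs.ext_zero hm]
    | insert y s hy ih =>
      intro hsn z hz a
      have hsn' : ∀ y ∈ s, ‖y‖ ≤ 2 := fun y hy => hsn y (by simp [hy])
      have := hs.ext_cap hm hε hε' (HasBd.sum s _ fun i hi => hb i (hsn' i hi) (c i))
        (hsn y (by simp)) hz (c y) a
      rw [ih hsn' z hz a, ← add_assoc] at this
      rw [Finset.sum_insert hy, add_comm (c y • cap ε y)]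
      exact add_right_cancel this
  classical
  induction s using Finset.induction_on with
  | empty => simpa using hs.ext_zero hm
  | insert y s hy ih =>
    have hsn' : ∀ y ∈ s, ‖y‖ ≤ 2 := fun y hy => hsn y (by simp [hy])
    rw [Finset.sum_insert hy, add_comm, key s hsn' y (hsn y (by simp)), ih hsn']

theorem Sublin.even_avg {f : E → ℝ} (hf : Sublin f) (u : E) :
    Sublin (fun x => f (x + ‖x‖ • u) + f (x - ‖x‖ • u)) := by
  have hmono : ∀ x : E, ∀ s t : ℝ, 0 ≤ s → s ≤ t →
      f (x + s • u) + f (x - s • u) ≤ f (x + t • u) + f (x - t • u) := fun x s t hs hst => by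
    rcases eq_or_lt_of_le (hs.trans hst) with ht | ht
    · have : s = t := by linarith
      rw [this]
    set p := (t + s) / (2 * t) with hp
    set q := (t - s) / (2 * t) with hq
    have hp0 : 0 ≤ p := by positivity
    have hq0 : 0 ≤ q := div_nonneg (by linarith) (by linarith)
    have hpq : p + q = 1 := by rw [hp, hq]; field_simp; ring
    have hpq' : p * t - q * t = s := by rw [hp, hq]; field_simp; ring
    have e1 : x + s • u = p • (x + t • u) + q • (x - t • u) := by
      rw [← hpq']; nth_rewrite 1 [← one_smul ℝ x]; rw [← hpq]; module
    have e2 : x - s • u = q • (x + t • u) + p • (x - t • u) := by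
      rw [← hpq']; nth_rewrite 1 [← one_smul ℝ x]; rw [← hpq]; module
    have h1 := hf.add_le (p • (x + t • u)) (q • (x - t • u))
    have h2 := hf.add_le (q • (x + t • u)) (p • (x - t • u))
    rw [hf.smul _ hp0, hf.smul _ hq0, ← e1] at h1
    rw [hf.smul _ hp0, hf.smul _ hq0, ← e2] at h2
    have e3 : p = 1 - q := by linarith
    rw [e3] at h1 h2
    linarith
  refine ⟨fun x y => ?_, fun t ht x => ?_, ?_⟩
  · refine (hmono (x + y) _ _ (norm_nonneg _) (norm_add_le x y)).trans ?_
    have h1 := hf.add_le (x + ‖x‖ • u) (y + ‖y‖ • u)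
    have h2 := hf.add_le (x - ‖x‖ • u) (y - ‖y‖ • u)
    have e1 : x + y + (‖x‖ + ‖y‖) • u = x + ‖x‖ • u + (y + ‖y‖ • u) := by module
    have e2 : x + y - (‖x‖ + ‖y‖) • u = x - ‖x‖ • u + (y - ‖y‖ • u) := by module
    rw [e1, e2]
    linarith
  · simp only [norm_smul, Real.norm_of_nonneg ht, mul_smul, ← smul_add, ← smul_sub, hf.smul t ht]
    ring
  · obtain ⟨C, hC0, hC⟩ := hf.abs_bdd
    refine ⟨C * (1 + ‖u‖) + C * (1 + ‖u‖), fun x => ?_⟩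
    have h1 := (le_abs_self _).trans (hC (x + ‖x‖ • u))
    have h2 := (le_abs_self _).trans (hC (x - ‖x‖ • u))
    have h3 := norm_add_le x (‖x‖ • u)
    have h4 := norm_sub_le x (‖x‖ • u)
    rw [norm_smul, norm_norm] at h3 h4
    have h5 := mul_le_mul_of_nonneg_left h3 hC0
    have h6 := mul_le_mul_of_nonneg_left h4 hC0
    linarith

section
/-- A compactly supported mollifier. -/
def moll (ε : ℝ) (u : E) : ℝ := max (ε ^ 2 - ‖u‖ ^ 2) 0 ^ 3

theorem moll_cont (ε : ℝ) : Continuous (moll ε : E → ℝ) := by unfold moll; fun_prop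

theorem moll_nonneg (ε : ℝ) (u : E) : 0 ≤ moll ε u := by unfold moll; positivity

theorem moll_neg (ε : ℝ) (u : E) : moll ε (-u) = moll ε u := by simp [moll]

theorem moll_eq_zero {ε : ℝ} (hε : 0 < ε) {u : E} (h : ε ≤ ‖u‖) : moll ε u = 0 := by
  rw [moll, max_eq_right (by nlinarith)]; simp

theorem moll_supp {ε : ℝ} (hε : 0 < ε) [FiniteDimensional ℝ E] :
    HasCompactSupport (moll ε : E → ℝ) := by
  have : ProperSpace E := FiniteDimensional.proper ℝ E
  refine HasCompactSupport.intro (isCompact_closedBall (0 : E) ε) fun u hu => ?_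
  rw [Metric.mem_closedBall, dist_zero_right, not_le] at hu
  exact moll_eq_zero hε hu.le

theorem sublin_integral {X : Type*} [MeasurableSpace X] (ν : Measure X) {G : X → E → ℝ}
    {w : X → ℝ} (hG : ∀ u, Sublin (G u)) (hw : ∀ u, 0 ≤ w u)
    (hi : ∀ x, Integrable (fun u => w u * G u x) ν)
    (hb : ∃ C, ∀ x, ∫ u, w u * G u x ∂ν ≤ C * ‖x‖) : Sublin (fun x => ∫ u, w u * G u x ∂ν) := by
  refine ⟨fun x y => ?_, fun t ht x => ?_, hb⟩
  · rw [← integral_add (hi x) (hi y)]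
    refine integral_mono (hi _) ((hi x).add (hi y)) fun u => ?_
    simp only [← mul_add]
    exact mul_le_mul_of_nonneg_left ((hG u).add_le x y) (hw u)
  · rw [← integral_const_mul]
    congr 1; ext u
    rw [(hG u).smul t ht]; ring

variable [FiniteDimensional ℝ E] [MeasurableSpace E] [BorelSpace E]

/-- The mass of the mollifier. -/
def mollMass (E : Type*) [NormedAddCommGroup E] [InnerProductSpace ℝ E] [FiniteDimensional ℝ E]
    [MeasurableSpace E] [BorelSpace E] (ε : ℝ) : ℝ := ∫ u : E, moll ε u

theorem mollMass_pos {ε : ℝ} (hε : 0 < ε) : 0 < mollMass E ε := by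
  refine (moll_cont ε).integral_pos_of_hasCompactSupport_nonneg_nonzero (moll_supp hε)
    (fun u => moll_nonneg ε u) (x := 0) ?_
  simp [moll, hε.ne']

/-- Smoothing of a support function. -/
def smo (ε : ℝ) (f : E → ℝ) (x : E) : ℝ := (mollMass E ε)⁻¹ * ∫ u : E, moll ε u * f (x + ‖x‖ • u)

theorem smo_integrable {ε : ℝ} (hε : 0 < ε) {f : E → ℝ} (hf : Continuous f) (x : E) (r : ℝ) :
    Integrable (fun u : E => moll ε u * f (x + r • u)) :=
  Continuous.integrable_of_hasCompactSupport ((moll_cont ε).mul (by fun_prop))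
    ((moll_supp hε).mul_right)

theorem smo_near {ε : ℝ} (hε : 0 < ε) {f : E → ℝ} (hf : Continuous f) {C : ℝ}
    (hC : ∀ x y, |f x - f y| ≤ C * ‖x - y‖) (hC0 : 0 ≤ C) (x : E) :
    |smo ε f x - f x| ≤ C * ε * ‖x‖ := by
  have hc := mollMass_pos (E := E) hε
  have e : smo ε f x - f x = (mollMass E ε)⁻¹ * ∫ u : E, moll ε u * (f (x + ‖x‖ • u) - f x) := by
    have i2 : Integrable (fun u : E => moll ε u * f x) :=
      ((moll_cont ε).integrable_of_hasCompactSupport (moll_supp hε)).mul_const _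
    simp_rw [mul_sub]
    rw [integral_sub (smo_integrable hε hf x ‖x‖) i2, integral_mul_const, mul_sub, smo]
    congr 1
    rw [← mollMass, ← mul_assoc, inv_mul_cancel₀ hc.ne', one_mul]
  rw [e, abs_mul, abs_of_pos (inv_pos.2 hc), inv_mul_le_iff₀ hc, ← Real.norm_eq_abs]
  refine (norm_integral_le_of_norm_le (g := fun u => moll ε u * (C * ε * ‖x‖))
    (((moll_cont ε).integrable_of_hasCompactSupport (moll_supp hε)).mul_const _)
    (Filter.Eventually.of_forall fun u => ?_)).trans (le_of_eq (by rw [integral_mul_const]; rfl))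
  rw [norm_mul, Real.norm_of_nonneg (moll_nonneg _ _), Real.norm_eq_abs]
  by_cases hu : ε ≤ ‖u‖
  · rw [moll_eq_zero hε hu]; simp
  · refine mul_le_mul_of_nonneg_left ((hC _ _).trans ?_) (moll_nonneg _ _)
    rw [add_sub_cancel_left, norm_smul, norm_norm, mul_assoc, mul_comm ε]
    exact mul_le_mul_of_nonneg_left (mul_le_mul_of_nonneg_left (le_of_not_ge hu) (norm_nonneg _)) hC0

theorem smo_sublin {ε : ℝ} (hε : 0 < ε) {f : E → ℝ} (hf : Sublin f) : Sublin (smo ε f) := by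
  have hc := mollMass_pos (E := E) hε
  obtain ⟨C, hC0, hC⟩ := hf.lip
  have i1 := fun x : E => smo_integrable hε hf.continuous x ‖x‖
  have i2 : ∀ x : E, Integrable (fun u : E => moll ε u * f (x - ‖x‖ • u)) := fun x => by
    simpa [sub_eq_add_neg] using smo_integrable hε hf.continuous x (-‖x‖)
  have e0 : ∀ x : E, ∫ u : E, moll ε u * f (x - ‖x‖ • u) = ∫ u : E, moll ε u * f (x + ‖x‖ • u) :=
    fun x => by
      rw [← integral_neg_eq_self]
      congr 1; ext u
      rw [moll_neg, smul_neg, sub_neg_eq_add]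
  have e1 : ∀ x : E, ∫ u : E, moll ε u * (f (x + ‖x‖ • u) + f (x - ‖x‖ • u))
      = 2 * ∫ u : E, moll ε u * f (x + ‖x‖ • u) := fun x => by
    simp_rw [mul_add]
    rw [integral_add (i1 x) (i2 x), e0]; ring
  have e : smo ε f = ((mollMass E ε)⁻¹ * (1 / 2)) • fun x => ∫ u : E,
      moll ε u * (f (x + ‖x‖ • u) + f (x - ‖x‖ • u)) := by
    ext x
    rw [Pi.smul_apply, e1, smo, smul_eq_mul]; ring
  rw [e]
  refine (sublin_integral volume (fun u => hf.even_avg u) (fun u => moll_nonneg ε u)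
    (fun x => by simp_rw [mul_add]; exact (i1 x).add (i2 x)) ?_).const_smul (by positivity)
  obtain ⟨C', hC0', hC'⟩ := hf.abs_bdd
  refine ⟨2 * mollMass E ε * (C' + C * ε), fun x => ?_⟩
  have h1 := (abs_le.1 (smo_near hε hf.continuous hC hC0 x)).2
  have h2 := (le_abs_self _).trans (hC' x)
  have h3 : ∫ u : E, moll ε u * f (x + ‖x‖ • u) = mollMass E ε * smo ε f x := by
    rw [smo, ← mul_assoc, mul_inv_cancel₀ hc.ne', one_mul]
  rw [e1, h3]
  have h4 : smo ε f x ≤ (C' + C * ε) * ‖x‖ := by linarith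
  have := mul_le_mul_of_nonneg_left h4 (mul_nonneg zero_le_two hc.le)
  linarith

theorem smo_eq_cap {ε : ℝ} (hε : 0 < ε) (hε' : ε ≤ 1 / 4) {f : E → ℝ} (hf : Sublin f) (x : E) :
    smo ε f x = (mollMass E ε)⁻¹ * ∫ y in Metric.closedBall (0 : E) 2, f y * cap ε y x := by
  rw [smo]
  congr 1
  by_cases hx : x = 0
  · subst hx; simp [hf.map_zero, cap_zero]
  set u := ‖x‖⁻¹ • x with hu
  have hxn : ‖x‖ ≠ 0 := norm_ne_zero_iff.2 hx
  have hu1 : ‖u‖ = 1 := by rw [hu, norm_smul, norm_inv, norm_norm, inv_mul_cancel₀ hxn]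
  have hxu : x = ‖x‖ • u := by rw [hu, smul_smul, mul_inv_cancel₀ hxn, one_smul]
  have hcap : ∀ y, cap ε y x = ‖x‖ * moll ε (-u + y) := fun y => by
    rw [cap_apply ε y hx, moll, ← norm_neg (-u + y), show -(-u + y) = ‖x‖⁻¹ • x - y by rw [hu]; abel]
  rw [setIntegral_eq_integral_of_forall_compl_eq_zero]
  · rw [← integral_add_left_eq_self (μ := volume) (fun y => f y * cap ε y x) u]
    congr 1; ext v
    rw [hcap, neg_add_cancel_left]
    nth_rewrite 1 [hxu]
    rw [← smul_add, hf.smul _ (norm_nonneg x)]; ring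
  · intro y hy
    rw [Metric.mem_closedBall, dist_zero_right, not_le] at hy
    rw [hcap, moll_eq_zero hε, mul_zero, mul_zero]
    have := norm_sub_norm_le y u
    rw [show -u + y = y - u by abel]
    linarith

end

/-- A segment invariant valuation is determined by its values on bump perturbations of balls. -/
theorem SegInv.eq_zero_of_cap [FiniteDimensional ℝ E] {m : (E → ℝ) → ℂ} (hs : SegInv m) (hm : IsVal m)
    (h : ∀ ε : ℝ, 0 < ε → ε ≤ 1 / 4 → ∀ y : E, ‖y‖ ≤ 2 → Ext m (cap ε y) = m 0) {f : E → ℝ}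
    (hf : Sublin f) : m f = m 0 := by
  let _ : MeasurableSpace E := borel E
  have : BorelSpace E := ⟨rfl⟩
  have : ProperSpace E := FiniteDimensional.proper ℝ E
  obtain ⟨C, hC0, hC⟩ := hf.lip
  refine hm.eq_of_approx hf fun η hη => ?_
  set ε : ℝ := min (1 / 4) (η / (C + 1)) with hεd
  have hε : 0 < ε := lt_min (by norm_num) (by positivity)
  have hε' : ε ≤ 1 / 4 := min_le_left _ _
  refine ⟨smo ε f, smo_sublin hε hf, fun x => (smo_near hε hf.continuous hC hC0 x).trans ?_, ?_⟩
  · refine mul_le_mul_of_nonneg_right ?_ (norm_nonneg x)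
    have := min_le_right (1 / 4) (η / (C + 1))
    rw [← hεd, le_div_iff₀ (by positivity)] at this
    nlinarith
  have hc := mollMass_pos (E := E) hε
  set c := mollMass E ε
  set K := Metric.closedBall (0 : E) 2 with hK
  have hKc : IsCompact K := isCompact_closedBall _ _
  obtain ⟨C', hC0', hC'⟩ := hf.abs_bdd
  set V := volume.real K with hV
  have hV0 : 0 ≤ V := measureReal_nonneg
  set R := c⁻¹ * (V * (C' * 2 * 132)) with hR
  have hR0 : 0 ≤ R := by positivity
  have hRn : Zonoid (R • (nrm : E → ℝ)) := Zonoid.norm.const_smul hR0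
  rw [← hs.zonoid hm (smo_sublin hε hf) hRn]
  refine hm.eq_of_approx ((smo_sublin hε hf).add hRn.sublin) fun η hη => ?_
  obtain ⟨δ, hδ, hδ'⟩ : ∃ δ > 0, ∀ y ∈ K, ∀ y' ∈ K, ∀ u : E, ‖u‖ = 1 → dist y y' < δ →
      |f y * moll ε (u - y) - f y' * moll ε (u - y')| ≤ η * c / (V + 1) := by
    have hcomp : IsCompact (K ×ˢ Metric.closedBall (0 : E) 1) := hKc.prod (isCompact_closedBall _ _)
    have hcont : Continuous fun p : E × E => f p.1 * moll ε (p.2 - p.1) :=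
      (hf.continuous.comp continuous_fst).mul
        ((moll_cont ε).comp (continuous_snd.sub continuous_fst))
    have := hcomp.uniformContinuousOn_of_continuous hcont.continuousOn
    rw [Metric.uniformContinuousOn_iff_le] at this
    obtain ⟨δ, hδ, H⟩ := this (η * c / (V + 1)) (by positivity)
    refine ⟨δ, hδ, fun y hy y' hy' u hu hd => ?_⟩
    have := H (y, u) ⟨hy, by simp [hu]⟩ (y', u) ⟨hy', by simp [hu]⟩ (by
      rw [Prod.dist_eq]; simpa using hd.le)
    simpa [Real.dist_eq] using this
  obtain ⟨s, w, hsK, hw0, hwV, hq⟩ := exists_quadrature (G := ℝ) volume hKc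
    hKc.measure_lt_top hδ
  have hsn : ∀ y ∈ s, ‖y‖ ≤ 2 := fun y hy => by simpa [hK] using hsK y hy
  set q : E → ℝ := ∑ y ∈ s, (c⁻¹ * (w y * f y)) • cap ε y with hqd
  have hqb : Bd R q := by
    refine (Bd.sum s _ _ fun y hy => (cap_bd hε hε' (hsn y hy)).const_smul
      (c⁻¹ * (w y * f y))).mono ?_
    rw [← hV] at hwV
    rw [hR, ← hwV, Finset.sum_mul, Finset.mul_sum]
    refine Finset.sum_le_sum fun y hy => ?_
    rw [abs_mul, abs_mul, abs_of_pos (inv_pos.2 hc), abs_of_nonneg (hw0 y), mul_assoc, mul_assoc]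
    refine mul_le_mul_of_nonneg_left (mul_le_mul_of_nonneg_left ?_ (hw0 y)) (inv_pos.2 hc).le
    refine mul_le_mul_of_nonneg_right ((hC' y).trans ?_) (by norm_num)
    exact mul_le_mul_of_nonneg_left (hsn y hy) hC0'
  refine ⟨R • nrm + q, hqb.add, fun x => ?_, ?_⟩
  · have e : (R • (nrm : E → ℝ) + q) x - (smo ε f + R • (nrm : E → ℝ)) x = -(smo ε f x - q x) := by
      simp only [Pi.add_apply]; ring
    rw [e, abs_neg]
    by_cases hx : x = 0
    · subst hx; simp [hqd, (smo_sublin hε hf).map_zero, cap_zero]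
    have hxn : 0 < ‖x‖ := norm_pos_iff.2 hx
    have hu1 : ‖‖x‖⁻¹ • x‖ = 1 := by
      rw [norm_smul, norm_inv, norm_norm, inv_mul_cancel₀ hxn.ne']
    have hcap : ∀ y, f y * cap ε y x = ‖x‖ * (f y * moll ε (‖x‖⁻¹ • x - y)) := fun y => by
      rw [cap_apply ε y hx, moll]; ring
    have hcont : Continuous fun y => f y * cap ε y x := by
      simp_rw [hcap]
      exact continuous_const.mul (hf.continuous.mul
        ((moll_cont ε).comp (continuous_const.sub continuous_id)))
    have := hq (fun y => f y * cap ε y x) (‖x‖ * (η * c / (V + 1)))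
      (hcont.continuousOn.integrableOn_compact hKc) (fun y hy y' hy' hd => by
        rw [hcap, hcap, ← mul_sub, norm_mul, norm_norm, Real.norm_eq_abs]
        exact mul_le_mul_of_nonneg_left (hδ' y hy y' hy' _ hu1 hd) hxn.le)
    have e2 : smo ε f x - q x = c⁻¹ * ((∫ y in K, f y * cap ε y x)
        - ∑ y ∈ s, w y • (f y * cap ε y x)) := by
      rw [smo_eq_cap hε hε' hf, mul_sub, hqd, Finset.sum_apply, Finset.mul_sum]
      congr 1
      refine Finset.sum_congr rfl fun y _ => ?_
      simp only [Pi.smul_apply, smul_eq_mul]; ring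
    rw [e2, abs_mul, abs_of_pos (inv_pos.2 hc), inv_mul_le_iff₀ hc, ← Real.norm_eq_abs]
    refine this.trans ?_
    have h1 : V / (V + 1) ≤ 1 := (div_le_one (by positivity)).2 (by linarith)
    have h2 : ‖x‖ * (η * c / (V + 1)) * V = (‖x‖ * η * c) * (V / (V + 1)) := by field_simp
    rw [h2]
    refine (mul_le_of_le_one_right (by positivity) h1).trans (le_of_eq (by ring))
  · rw [← hs.ext_eq hm hqb]
    exact hs.ext_sum_cap hm hε hε' (h ε hε hε') s hsn _


/-- An orthogonal complex structure on a real inner product space. -/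
structure IsCpx (J : E →L[ℝ] E) : Prop where
  sq : ∀ x, J (J x) = -x
  inner_map : ∀ x y, inner ℝ (J x) (J y) = inner ℝ x y

theorem IsCpx.inner_left {J : E →L[ℝ] E} (h : IsCpx J) (x y : E) :
    inner ℝ (J x) y = -inner ℝ x (J y) := by
  rw [← h.inner_map x (J y), h.sq, inner_neg_right, neg_neg]

theorem IsCpx.inner_self {J : E →L[ℝ] E} (h : IsCpx J) (x : E) : inner ℝ (J x) x = 0 := by
  have := h.inner_left x x
  rw [real_inner_comm (J x) x] at this
  linarith

theorem IsCpx.inner_self' {J : E →L[ℝ] E} (h : IsCpx J) (x : E) : inner ℝ x (J x) = 0 := by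
  rw [real_inner_comm]; exact h.inner_self x

theorem IsCpx.norm_map {J : E →L[ℝ] E} (h : IsCpx J) (x : E) : ‖J x‖ = ‖x‖ := by
  rw [← sq_eq_sq₀ (norm_nonneg _) (norm_nonneg _), ← real_inner_self_eq_norm_sq,
    ← real_inner_self_eq_norm_sq, h.inner_map]

/-- The unitary map multiplying the complex line through `u` by `e ^ (i θ)`. -/
def rot (J : E →L[ℝ] E) (u : E) (θ : ℝ) : E →L[ℝ] E :=
  ContinuousLinearMap.id ℝ E
    + ((Real.cos θ - 1) • innerSL ℝ u - Real.sin θ • innerSL ℝ (J u)).smulRight u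
    + ((Real.cos θ - 1) • innerSL ℝ (J u) + Real.sin θ • innerSL ℝ u).smulRight (J u)

theorem rot_apply (J : E →L[ℝ] E) (u : E) (θ : ℝ) (x : E) :
    rot J u θ x = x + ((Real.cos θ - 1) * inner ℝ u x - Real.sin θ * inner ℝ (J u) x) • u
      + ((Real.cos θ - 1) * inner ℝ (J u) x + Real.sin θ * inner ℝ u x) • J u := by
  simp [rot]

theorem rot_inner {J : E →L[ℝ] E} (h : IsCpx J) {u : E} (hu : ‖u‖ = 1) (θ : ℝ) (x y : E) :
    inner ℝ (rot J u θ x) (rot J u θ y) = inner ℝ x y := by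
  have h1 : inner ℝ u u = (1 : ℝ) := by rw [real_inner_self_eq_norm_sq, hu]; norm_num
  have h2 : inner ℝ (J u) (J u) = (1 : ℝ) := by rw [h.inner_map, h1]
  simp only [rot_apply, inner_add_left, inner_add_right, real_inner_smul_left,
    real_inner_smul_right, h1, h2, h.inner_self, h.inner_self', real_inner_comm u x,
    real_inner_comm (J u) x]
  rw [real_inner_comm x u, real_inner_comm x (J u)]
  have := Real.sin_sq_add_cos_sq θ
  generalize Real.sin θ = s at *
  generalize Real.cos θ = c at *
  generalize inner ℝ x u = p
  generalize inner ℝ u y = q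
  generalize inner ℝ x (J u) = p'
  generalize inner ℝ (J u) y = q'
  linear_combination (p * q + p' * q') * this

theorem rot_of_orth (J : E →L[ℝ] E) {u x : E} (θ : ℝ) (h1 : inner ℝ u x = 0)
    (h2 : inner ℝ (J u) x = 0) : rot J u θ x = x := by
  simp [rot_apply, h1, h2]

theorem rot_self {J : E →L[ℝ] E} (h : IsCpx J) {u : E} (hu : ‖u‖ = 1) (θ : ℝ) :
    rot J u θ u = Real.cos θ • u + Real.sin θ • J u := by
  rw [rot_apply, h.inner_self, real_inner_self_eq_norm_sq, hu]
  module

theorem rot_J_self {J : E →L[ℝ] E} (h : IsCpx J) {u : E} (hu : ‖u‖ = 1) (θ : ℝ) :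
    rot J u θ (J u) = -Real.sin θ • u + Real.cos θ • J u := by
  rw [rot_apply, h.inner_self', real_inner_self_eq_norm_sq, h.norm_map, hu]
  module

/-- `m` is multiplied by `χ` under composition with `A`. -/
def Cov (A : E →L[ℝ] E) (χ : ℂ) (m : (E → ℝ) → ℂ) : Prop :=
  ∀ f, Sublin f → m (f ∘ A) = χ * m f

theorem Cov.comp {A B : E →L[ℝ] E} {χ ψ : ℂ} {m : (E → ℝ) → ℂ} (hA : Cov A χ m)
    (hB : Cov B ψ m) : Cov (A.comp B) (ψ * χ) m := fun f hf => by
  have := hB _ (hf.comp A)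
  rw [hA f hf, ← mul_assoc] at this
  exact this

theorem seg_comp {A : E →L[ℝ] E} (hA : ∀ x y, inner ℝ (A x) (A y) = inner ℝ x y) (v : E) :
    seg (A v) ∘ A = seg v := by
  ext x; simp [seg, hA]

theorem Cov.D_apply {A : E →L[ℝ] E} {χ : ℂ} {m : (E → ℝ) → ℂ} (h : Cov A χ m)
    (hA : ∀ x y, inner ℝ (A x) (A y) = inner ℝ x y) (v : E) {f : E → ℝ} (hf : Sublin f) :
    D v m (f ∘ A) = χ * D (A v) m f := by
  rw [D, D, ← seg_comp hA v, mul_sub, ← h f hf, ← h _ (hf.add (Sublin.seg _))]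
  rfl

theorem Cov.D {A : E →L[ℝ] E} {χ : ℂ} {m : (E → ℝ) → ℂ} (h : Cov A χ m)
    (hA : ∀ x y, inner ℝ (A x) (A y) = inner ℝ x y) {v : E} (hv : A v = v) :
    Cov A χ (D v m) := fun f hf => by
  rw [h.D_apply hA v hf, hv]

theorem Cov.DL {A : E →L[ℝ] E} {χ : ℂ} {m : (E → ℝ) → ℂ} (h : Cov A χ m)
    (hA : ∀ x y, inner ℝ (A x) (A y) = inner ℝ x y) :
    ∀ {l : List E}, (∀ v ∈ l, A v = v) → Cov A χ (DL l m)
  | [], _ => h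
  | v :: l, hl => (h.DL hA fun w hw => hl w (List.mem_cons_of_mem _ hw)).D hA (hl v (by simp))

theorem Cov.D_D {A : E →L[ℝ] E} {χ : ℂ} {m : (E → ℝ) → ℂ} (hm : IsVal m) (h : Cov A χ m)
    (hA : ∀ x y, inner ℝ (A x) (A y) = inner ℝ x y) {a b : E} {c s : ℝ} (hcs : c ^ 2 + s ^ 2 = 1)
    (ha : A a = c • a + s • b) (hb : A b = -s • a + c • b) :
    Cov A χ (SUVal.D a (SUVal.D b m)) := fun f hf => by
  have e : SUVal.D a (SUVal.D b m) (f ∘ A)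
      = χ * SUVal.D (A a) (SUVal.D (A b) m) f := by
    show SUVal.D b m (f ∘ A + seg a) - SUVal.D b m (f ∘ A)
      = χ * (SUVal.D (A b) m (f + seg (A a)) - SUVal.D (A b) m f)
    rw [mul_sub, ← h.D_apply hA b hf, ← h.D_apply hA b (hf.add (Sublin.seg _)), ← seg_comp hA a]
    rfl
  rw [e, ha, hb, hm.D_D_rotate a b hcs f hf]

/-- `m` has weight `l` for the unitary group of `J`. -/
def IsWt (J : E →L[ℝ] E) (l : ℤ) (m : (E → ℝ) → ℂ) : Prop :=
  ∀ u, ‖u‖ = 1 → ∀ θ : ℝ, Cov (rot J u θ) (Complex.exp (l * θ * Complex.I)) m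

/-- Orthogonal projection along two orthonormal vectors. -/
def proj2 (a b : E) : E →L[ℝ] E :=
  ContinuousLinearMap.id ℝ E - (innerSL ℝ a).smulRight a - (innerSL ℝ b).smulRight b

theorem proj2_apply (a b x : E) : proj2 a b x = x - inner ℝ a x • a - inner ℝ b x • b := by
  simp [proj2]

theorem exp_pi_div {l : ℤ} (hl : l ≠ 0) :
    Complex.exp (l * ((Real.pi / l : ℝ) : ℂ) * Complex.I) = -1 := by
  rw [← Complex.exp_pi_mul_I]
  have : (l : ℂ) ≠ 0 := by exact_mod_cast hl
  push_cast
  congr 1; field_simp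

/-- Second differences along a complex line vanish for nontrivial weight. -/
theorem IsWt.D_D_J {J : E →L[ℝ] E} (hJ : IsCpx J) {l : ℤ} (hl : l ≠ 0) {m : (E → ℝ) → ℂ}
    (hw : IsWt J l m) (hm : IsVal m) {z : E} (hz : ‖z‖ = 1) : Eqv (D z (D (J z) m)) 0 := by
  intro f hf
  set A := rot J z (Real.pi / l)
  have hc := Cov.D_D (c := Real.cos (Real.pi / l)) (s := Real.sin (Real.pi / l)) hm
    (hw z hz (Real.pi / l)) (rot_inner hJ hz _) (Real.cos_sq_add_sin_sq _)
    (rot_self hJ hz _) (rot_J_self hJ hz _)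
  rw [exp_pi_div hl] at hc
  set P := proj2 z (J z)
  have h1 : inner ℝ z z = (1 : ℝ) := by rw [real_inner_self_eq_norm_sq, hz]; norm_num
  have h2 : inner ℝ (J z) (J z) = (1 : ℝ) := by rw [hJ.inner_map, h1]
  have e1 := hm.D_D_congr hf (hf.comp P) (hJ.inner_self' z) (fun x hx hx' => by
    simp [P, proj2_apply, hx, hx'])
  have e2 := hc _ (hf.comp P)
  have e3 : (f ∘ P) ∘ A = f ∘ P := by
    ext x
    simp only [Function.comp_apply]
    congr 1
    simp only [P, proj2_apply, A, rot_apply, inner_add_right, real_inner_smul_right, h1, h2,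
      hJ.inner_self, hJ.inner_self']
    module
  rw [show ((rot J z (Real.pi / l) : E →L[ℝ] E)) = A from rfl, e3] at e2
  rw [e1]
  show _ = (0 : ℂ)
  linear_combination e2 / 2

/-- Special unitary rotations in a real plane which is not a complex line. -/
theorem exists_rot2 {J : E →L[ℝ] E} (hJ : IsCpx J) {a b : E} (ha : ‖a‖ = 1) (hb : ‖b‖ = 1)
    (hab : inner ℝ a b = 0) (h1 : b ≠ J a) (h2 : b ≠ -J a) (θ : ℝ) :
    ∃ A : E →L[ℝ] E, (∀ x y, inner ℝ (A x) (A y) = inner ℝ x y)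
      ∧ A a = Real.cos θ • a + Real.sin θ • b ∧ A b = -Real.sin θ • a + Real.cos θ • b
      ∧ (∀ x, inner ℝ a x = 0 → inner ℝ b x = 0 → inner ℝ (J a) x = 0 → inner ℝ (J b) x = 0 →
          A x = x)
      ∧ ∀ (l : ℤ) (m : (E → ℝ) → ℂ), IsWt J l m → Cov A 1 m := by
  have hu0 : a - J b ≠ 0 := fun h => h2 (by
    rw [sub_eq_zero.1 h, hJ.sq, neg_neg])
  have hu0' : a + J b ≠ 0 := fun h => h1 (by
    rw [eq_neg_of_add_eq_zero_left h, map_neg, hJ.sq, neg_neg])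
  set r := ‖a - J b‖
  set r' := ‖a + J b‖
  have hr : r ≠ 0 := norm_ne_zero_iff.2 hu0
  have hr' : r' ≠ 0 := norm_ne_zero_iff.2 hu0'
  set u := r⁻¹ • (a - J b) with hu
  set u' := r'⁻¹ • (a + J b) with hu'
  have hun : ‖u‖ = 1 := by rw [hu, norm_smul, norm_inv, Real.norm_eq_abs, abs_norm, inv_mul_cancel₀ hr]
  have hun' : ‖u'‖ = 1 := by
    rw [hu', norm_smul, norm_inv, Real.norm_eq_abs, abs_norm, inv_mul_cancel₀ hr']
  have hJu : J u = r⁻¹ • (J a + b) := by rw [hu, map_smul, map_sub, hJ.sq, sub_neg_eq_add]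
  have hJu' : J u' = r'⁻¹ • (J a - b) := by rw [hu', map_smul, map_add, hJ.sq, sub_eq_add_neg]
  have haa : inner ℝ a a = (1 : ℝ) := by rw [real_inner_self_eq_norm_sq, ha]; norm_num
  have hbb : inner ℝ b b = (1 : ℝ) := by rw [real_inner_self_eq_norm_sq, hb]; norm_num
  have hba : inner ℝ b a = (0 : ℝ) := by rw [real_inner_comm, hab]
  have o1 : inner ℝ u u' = (0 : ℝ) := by
    simp only [hu, hu', real_inner_smul_left, real_inner_smul_right, inner_sub_left,
      inner_add_right, hJ.inner_map, haa, hbb, hJ.inner_left]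
    rw [real_inner_comm (J a) b, hJ.inner_left]
    ring
  have o2 : inner ℝ (J u) u' = (0 : ℝ) := by
    simp only [hJu, hu', real_inner_smul_left, real_inner_smul_right, inner_add_left,
      inner_add_right, hJ.inner_map, hJ.inner_self, hJ.inner_self', hab, hba]
    ring
  have o3 : inner ℝ u (J u') = (0 : ℝ) := by
    rw [← neg_eq_zero, ← hJ.inner_left, o2]
  have o4 : inner ℝ (J u) (J u') = (0 : ℝ) := by rw [hJ.inner_map, o1]
  have ea : a = (r / 2) • u + (r' / 2) • u' := by
    rw [hu, hu', smul_smul, smul_smul, show r / 2 * r⁻¹ = 1 / 2 by field_simp,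
      show r' / 2 * r'⁻¹ = 1 / 2 by field_simp]
    module
  have eb : b = (r / 2) • J u - (r' / 2) • J u' := by
    rw [hJu, hJu', smul_smul, smul_smul, show r / 2 * r⁻¹ = 1 / 2 by field_simp,
      show r' / 2 * r'⁻¹ = 1 / 2 by field_simp]
    module
  have q1 : rot J u θ u' = u' := rot_of_orth J _ o1 o2
  have q2 : rot J u θ (J u') = J u' := rot_of_orth J _ o3 o4
  have q3 : rot J u' (-θ) u = u := rot_of_orth J _ (by rw [real_inner_comm, o1])
    (by rw [real_inner_comm, o3])
  have q4 : rot J u' (-θ) (J u) = J u := rot_of_orth J _ (by rw [real_inner_comm, o2])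
    (by rw [real_inner_comm, o4])
  refine ⟨(rot J u θ).comp (rot J u' (-θ)), fun x y => ?_, ?_, ?_, fun x x1 x2 x3 x4 => ?_,
    fun l m hw => ?_⟩
  · simp only [ContinuousLinearMap.comp_apply, rot_inner hJ hun, rot_inner hJ hun']
  · conv_lhs => rw [ea]
    conv_rhs => rw [ea, eb]
    simp only [ContinuousLinearMap.comp_apply, map_add, map_smul, q3, rot_self hJ hun',
      rot_self hJ hun, q1, q2, Real.cos_neg, Real.sin_neg]
    module
  · conv_lhs => rw [eb]
    conv_rhs => rw [ea, eb]
    simp only [ContinuousLinearMap.comp_apply, map_add, map_sub, map_smul, q4, rot_J_self hJ hun',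
      rot_J_self hJ hun, q1, q2, Real.cos_neg, Real.sin_neg]
    module
  · have g1 : inner ℝ u x = 0 := by
      rw [hu, real_inner_smul_left, inner_sub_left, x1, x4]; simp
    have g2 : inner ℝ (J u) x = 0 := by
      rw [hJu, real_inner_smul_left, inner_add_left, x3, x2]; simp
    have g3 : inner ℝ u' x = 0 := by
      rw [hu', real_inner_smul_left, inner_add_left, x1, x4]; simp
    have g4 : inner ℝ (J u') x = 0 := by
      rw [hJu', real_inner_smul_left, inner_sub_left, x3, x2]; simp
    rw [ContinuousLinearMap.comp_apply, rot_of_orth J _ g3 g4, rot_of_orth J _ g1 g2]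
  · have := (hw u hun θ).comp (hw u' hun' (-θ))
    rwa [← Complex.exp_add, show (l * ((-θ : ℝ) : ℂ) * Complex.I + l * θ * Complex.I) = 0 by
      push_cast; ring, Complex.exp_zero] at this

theorem eq_zero_of_max {φ : E →L[ℝ] ℝ} {W : Submodule ℝ E} {b : E} (hb : ‖b‖ = 1) (hbW : b ∈ W)
    (h : ∀ x ∈ W, φ x ≤ φ b * ‖x‖) {w : E} (hw : w ∈ W) (hbw : inner ℝ b w = 0) : φ w = 0 := by
  by_contra h0
  set M := φ b
  have hM : 0 ≤ M := by
    have := h _ (W.neg_mem hbW); rw [map_neg, norm_neg, hb] at this; linarith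
  set s := (M * ‖w‖ ^ 2 + 1)⁻¹
  have hD : 0 < M * ‖w‖ ^ 2 + 1 := by positivity
  have hs : 0 < s := inv_pos.2 hD
  set t := φ w * s
  have h1 := h _ (W.add_mem hbW (W.smul_mem t hw))
  have h2 : ‖b + t • w‖ ≤ 1 + t ^ 2 * ‖w‖ ^ 2 / 2 := by
    have : ‖b + t • w‖ ^ 2 = 1 + t ^ 2 * ‖w‖ ^ 2 := by
      rw [norm_add_sq_real, hb, real_inner_smul_right, hbw, norm_smul, mul_pow,
        Real.norm_eq_abs, sq_abs]; ring
    nlinarith [norm_nonneg (b + t • w), sq_nonneg (t ^ 2 * ‖w‖ ^ 2), sq_nonneg (t * ‖w‖)]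
  rw [map_add, map_smul, smul_eq_mul] at h1
  have h3 : t * φ w ≤ M * (t ^ 2 * ‖w‖ ^ 2 / 2) := by nlinarith
  have h4 : 0 < φ w ^ 2 * s := by positivity
  have h5 : s * (M * ‖w‖ ^ 2 + 1) = 1 := inv_mul_cancel₀ hD.ne'
  have h6 : M * (t ^ 2 * ‖w‖ ^ 2 / 2) = (φ w ^ 2 * s) * (s * (M * ‖w‖ ^ 2) / 2) := by
    simp only [t]; ring
  rw [h6, show t * φ w = φ w ^ 2 * s by simp only [t]; ring] at h3
  nlinarith

/-- Canonical pairs in a real subspace of a complex space. -/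
theorem exists_canonical_pair [FiniteDimensional ℝ E] {J : E →L[ℝ] E} (hJ : IsCpx J)
    {W : Submodule ℝ E} (hW : 2 ≤ Module.finrank ℝ W) :
    ∃ a ∈ W, ∃ b ∈ W, ‖a‖ = 1 ∧ ‖b‖ = 1 ∧ inner ℝ a b = 0 ∧
      ∀ w ∈ W, inner ℝ a w = 0 → inner ℝ b w = 0 → inner ℝ (J a) w = 0 ∧ inner ℝ (J b) w = 0 := by
  set B := stdOrthonormalBasis ℝ W
  set a₀ := B ⟨0, by omega⟩
  set b₀ := B ⟨1, by omega⟩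
  have hab₀ : inner ℝ a₀ b₀ = 0 := B.orthonormal.2 (by simp)
  have hK : IsCompact (Metric.sphere (0 : W) 1 ×ˢ Metric.sphere (0 : W) 1) :=
    (isCompact_sphere _ _).prod (isCompact_sphere _ _)
  obtain ⟨⟨a, b⟩, hmem, hmax⟩ := hK.exists_isMaxOn ⟨(a₀, b₀), by simp [a₀, b₀]⟩
    (f := fun p : W × W => inner ℝ (J p.1) (p.2 : E)) (by fun_prop)
  simp only [Set.mem_prod, mem_sphere_iff_norm, sub_zero] at hmem
  set M := inner ℝ (J a) (b : E) with hMd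
  have hmx : ∀ x y : W, inner ℝ (J x) (y : E) ≤ M * ‖x‖ * ‖y‖ := fun x y => by
    by_cases hx : x = 0
    · simp [hx]
    by_cases hy : y = 0
    · simp [hy]
    have hx' : 0 < ‖x‖ := norm_pos_iff.2 hx
    have hy' : 0 < ‖y‖ := norm_pos_iff.2 hy
    have := hmax (a := (‖x‖⁻¹ • x, ‖y‖⁻¹ • y)) (by
      rw [Set.mem_prod, mem_sphere_iff_norm, mem_sphere_iff_norm, sub_zero, sub_zero, norm_smul,
        norm_smul, norm_inv, norm_inv, norm_norm, norm_norm, inv_mul_cancel₀ hx'.ne',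
        inv_mul_cancel₀ hy'.ne']
      exact ⟨rfl, rfl⟩)
    simp only [Set.mem_ofPred_eq, Submodule.coe_smul, map_smul, real_inner_smul_left,
      real_inner_smul_right] at this
    rw [← mul_assoc, ← mul_inv, inv_mul_le_iff₀ (by positivity)] at this
    linarith
  by_cases hM : M = 0
  · refine ⟨a₀, a₀.2, b₀, b₀.2, B.orthonormal.1 ⟨0, by omega⟩,
      B.orthonormal.1 ⟨1, by omega⟩, hab₀, fun w hw _ _ => ?_⟩
    have key : ∀ x y : W, inner ℝ (J x) (y : E) = 0 := fun x y => by
      have h1 := hmx x y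
      have h2 := hmx x (-y)
      simp only [hM, Submodule.coe_neg, inner_neg_right, zero_mul] at h1 h2
      linarith
    exact ⟨key a₀ ⟨w, hw⟩, key b₀ ⟨w, hw⟩⟩
  have k1 : ∀ w ∈ W, inner ℝ (b : E) w = 0 → inner ℝ (J a) w = 0 := fun w hw hbw => by
    refine eq_zero_of_max (φ := innerSL ℝ (J a)) (b := b) hmem.2 b.2 (fun x hx => ?_) hw hbw
    have := hmx a ⟨x, hx⟩
    rw [hmem.1, mul_one] at this
    simpa using this
  have k2 : ∀ w ∈ W, inner ℝ (a : E) w = 0 → inner ℝ (J b) w = 0 := fun w hw hbw => by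
    have := eq_zero_of_max (φ := -innerSL ℝ (J b)) (b := a) hmem.1 a.2 (fun x hx => ?_) hw hbw
    · simpa using this
    · have := hmx ⟨x, hx⟩ b
      rw [hmem.2, mul_one] at this
      have e1 := hJ.inner_left x b
      have e2 := hJ.inner_left a b
      rw [← hMd] at e2
      simp only [_root_.neg_apply, innerSL_apply_apply]
      rw [real_inner_comm x, real_inner_comm (a : E)]
      rw [e1] at this
      rw [← e2]; simpa using this
  have hab : inner ℝ (a : E) b = 0 := by
    have bb : inner ℝ (b : E) b = (1 : ℝ) := by
      rw [real_inner_self_eq_norm_sq, Submodule.norm_coe, hmem.2]; norm_num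
    have := k1 (a - inner ℝ (b : E) a • b) (W.sub_mem a.2 (W.smul_mem _ b.2)) (by
      rw [inner_sub_right, real_inner_smul_right, bb]; ring)
    rw [inner_sub_right, hJ.inner_self, real_inner_smul_right, ← hMd] at this
    rw [real_inner_comm]
    have h3 : inner ℝ (b : E) a * M = 0 := by linarith
    exact (mul_eq_zero.1 h3).resolve_right hM
  exact ⟨a, a.2, b, b.2, hmem.1, hmem.2, hab, fun w hw h1 h2 => ⟨k1 w hw h2, k2 w hw h1⟩⟩

theorem exists_unit_orth [FiniteDimensional ℝ E] (l : List E)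
    (hl : l.length < Module.finrank ℝ E) : ∃ u : E, ‖u‖ = 1 ∧ ∀ v ∈ l, inner ℝ v u = 0 := by
  classical
  set W := Submodule.span ℝ {v | v ∈ l}
  have hW : Module.finrank ℝ W < Module.finrank ℝ E := by
    refine lt_of_le_of_lt ?_ hl
    have h1 := finrank_span_finset_le_card (R := ℝ) (l.toFinset)
    have h2 : ((l.toFinset : Finset E) : Set E) = {v | v ∈ l} := by ext; simp
    rw [h2] at h1
    exact h1.trans (List.toFinset_card_le l)
  have hne : Wᗮ ≠ ⊥ := fun h => by
    rw [Submodule.orthogonal_eq_bot_iff] at h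
    rw [h, finrank_top] at hW
    exact lt_irrefl _ hW
  obtain ⟨u, hu, hu0⟩ := Submodule.exists_mem_ne_zero_of_ne_bot hne
  have hn : ‖u‖ ≠ 0 := norm_ne_zero_iff.2 hu0
  refine ⟨‖u‖⁻¹ • u, by rw [norm_smul, norm_inv, norm_norm, inv_mul_cancel₀ hn], fun v hv => ?_⟩
  rw [real_inner_smul_right, (Submodule.mem_orthogonal W u).1 hu v (Submodule.subset_span hv),
    mul_zero]

theorem eq_zero_of_orth_four [FiniteDimensional ℝ E] (hE : Module.finrank ℝ E = 4)
    {a b c d r : E} (ha : a ≠ 0) (hb : b ≠ 0) (hc : c ≠ 0) (hd : d ≠ 0)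
    (hab : inner ℝ a b = 0) (hac : inner ℝ a c = 0) (had : inner ℝ a d = 0)
    (hbc : inner ℝ b c = 0) (hbd : inner ℝ b d = 0) (hcd : inner ℝ c d = 0)
    (har : inner ℝ a r = 0) (hbr : inner ℝ b r = 0) (hcr : inner ℝ c r = 0)
    (hdr : inner ℝ d r = 0) : r = 0 := by
  by_contra hr
  have hli : LinearIndependent ℝ ![a, b, c, d, r] := by
    refine linearIndependent_of_ne_zero_of_inner_eq_zero (𝕜 := ℝ) (fun i => ?_) fun i j hij => ?_
    · fin_cases i <;> simpa
    · fin_cases i <;> fin_cases j <;>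
        first
          | exact absurd rfl hij
          | (simp; first | assumption | (rw [real_inner_comm]; assumption))
  have := hli.fintype_card_le_finrank
  rw [hE, Fintype.card_fin] at this
  omega

theorem eq_zero_of_orth4 [FiniteDimensional ℝ E] (hE : Module.finrank ℝ E = 4) {J : E →L[ℝ] E}
    (hJ : IsCpx J) {a b r : E} (ha : ‖a‖ = 1) (hb : ‖b‖ = 1) (hab : inner ℝ a b = 0)
    (h1 : b ≠ J a) (h2 : b ≠ -J a) (r1 : inner ℝ a r = 0) (r2 : inner ℝ b r = 0)
    (r3 : inner ℝ (J a) r = 0) (r4 : inner ℝ (J b) r = 0) : r = 0 := by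
  set t : ℝ := inner ℝ a (J b) with ht
  have haa : inner ℝ a a = (1 : ℝ) := by rw [real_inner_self_eq_norm_sq, ha]; norm_num
  have hbb : inner ℝ b b = (1 : ℝ) := by rw [real_inner_self_eq_norm_sq, hb]; norm_num
  have ha0 : a ≠ 0 := fun h => by simp [h] at ha
  have hb0 : b ≠ 0 := fun h => by simp [h] at hb
  have hbJ : inner ℝ b (J a) = -t := by
    rw [real_inner_comm, hJ.inner_left]
  have hJJ : inner ℝ (J b) (J a) = 0 := by rw [hJ.inner_map, real_inner_comm, hab]
  have key : ∀ s : ℝ, b = s • J a → False := fun s hs => by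
    have h := hb
    rw [hs, norm_smul, hJ.norm_map, ha, mul_one, Real.norm_eq_abs] at h
    rcases eq_or_eq_neg_of_abs_eq h with h | h
    · rw [h, one_smul] at hs; exact h1 hs
    · rw [h, neg_one_smul] at hs; exact h2 hs
  refine eq_zero_of_orth_four hE (a := a) (b := b) (c := J b - t • a) (d := J a + t • b) ha0 hb0
    (fun h => key (-t) ?_) (fun h => ?_) hab ?_ ?_ ?_ ?_ ?_ r1 r2 ?_ ?_
  · have := congrArg J (sub_eq_zero.1 h)
    rw [hJ.sq, map_smul] at this
    rw [neg_smul, ← this, neg_neg]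
  · have h' : J a = -(t • b) := eq_neg_of_add_eq_zero_left h
    have h3 : t * t = 1 := by
      have : inner ℝ (J a) (J a) = (1 : ℝ) := by rw [hJ.inner_map, haa]
      rw [h', inner_neg_neg, real_inner_smul_left, real_inner_smul_right, hbb] at this
      linarith
    refine key (-t) ?_
    rw [h', smul_neg, neg_smul, neg_neg, smul_smul, h3, one_smul]
  · rw [inner_sub_right, real_inner_smul_right, haa, ← ht]; ring
  · rw [inner_add_right, real_inner_smul_right, hab, hJ.inner_self']; ring
  · rw [inner_sub_right, real_inner_smul_right, hJ.inner_self', real_inner_comm, hab]; ring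
  · rw [inner_add_right, real_inner_smul_right, hbJ, hbb]; ring
  · rw [inner_sub_left, inner_add_right, inner_add_right, real_inner_smul_right,
      real_inner_smul_right, real_inner_smul_left, real_inner_smul_left, hJJ, hJ.inner_self,
      hJ.inner_self', hab]
    ring
  · rw [inner_sub_left, real_inner_smul_left, r1, r4]; ring
  · rw [inner_add_left, real_inner_smul_left, r2, r3]; ring

theorem IsVal.DL_map_proj2 {m : (E → ℝ) → ℂ} (hm : IsVal m) (a b : E) : ∀ l : List E,
    Eqv (SUVal.DL l (SUVal.D a (SUVal.D b m)))
      (SUVal.DL (l.map (proj2 a b)) (SUVal.D a (SUVal.D b m)))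
  | [] => Eqv.refl _
  | w :: l => by
    refine ((hm.DL_map_proj2 a b l).D w).trans ?_
    rw [List.map_cons, SUVal.DL]
    have e : SUVal.DL (l.map (proj2 a b)) (SUVal.D a (SUVal.D b m))
        = SUVal.DL (l.map (proj2 a b) ++ [a, b]) m := by rw [DL_append]; rfl
    rw [e]
    have hs : inner ℝ a w • a + inner ℝ b w • b
        ∈ Submodule.span ℝ {v | v ∈ l.map (proj2 a b) ++ [a, b]} :=
      Submodule.add_mem _ (Submodule.smul_mem _ _ (Submodule.subset_span (by simp)))
        (Submodule.smul_mem _ _ (Submodule.subset_span (by simp)))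
    have := hm.D_add_span _ hs (proj2 a b w)
    rwa [show proj2 a b w + (inner ℝ a w • a + inner ℝ b w • b) = w by
      rw [proj2_apply]; abel] at this

/-- Iterated differences reduce to a canonical pair and directions orthogonal to its
complex span. -/
theorem IsVal.DL_canonical [FiniteDimensional ℝ E] {J : E →L[ℝ] E} (hJ : IsCpx J)
    {m : (E → ℝ) → ℂ} (hm : IsVal m) {l : List E} (hl : 2 ≤ l.length) :
    Eqv (SUVal.DL l m) 0 ∨ ∃ (a b : E) (rs : List E) (c : ℂ), ‖a‖ = 1 ∧ ‖b‖ = 1 ∧ inner ℝ a b = 0 ∧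
      rs.length + 2 = l.length ∧
      (∀ r ∈ rs, inner ℝ a r = 0 ∧ inner ℝ b r = 0 ∧ inner ℝ (J a) r = 0 ∧ inner ℝ (J b) r = 0) ∧
      Eqv (SUVal.DL l m) (c • SUVal.DL rs (SUVal.D a (SUVal.D b m))) := by
  refine (hm.DL_eqv_zero_or l).imp_right fun hf => ?_
  obtain ⟨a, ha, b, hb, na, nb, hab, hc⟩ := exists_canonical_pair hJ
    (W := Submodule.span ℝ {v | v ∈ l}) (by rw [hf]; exact hl)
  have ha0 : a ≠ 0 := fun h => by simp [h] at na
  have hb0 : b ≠ 0 := fun h => by simp [h] at nb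
  obtain ⟨l', c, e1, e2, e3, e4⟩ := hm.DL_exchange ha0 l ha
  have hb' := e3 hb
  rw [setOf_mem_cons, Submodule.mem_span_insert] at hb'
  obtain ⟨β, s, hs, hbs⟩ := hb'
  have hs0 : s ≠ 0 := fun h => by
    rw [h, add_zero] at hbs
    rw [hbs, real_inner_smul_right, real_inner_self_eq_norm_sq, na] at hab
    simp at hab
    rw [hab, zero_smul] at hbs
    exact hb0 hbs
  obtain ⟨l'', c', f1, f2, f3, f4⟩ := hm.DL_exchange hs0 l' hs
  refine ⟨a, b, l''.map (proj2 a b), c * c', na, nb, hab, by simp; omega, fun r hr => ?_, ?_⟩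
  · obtain ⟨w, hw, rfl⟩ := List.mem_map.1 hr
    have haa : inner ℝ a a = (1 : ℝ) := by rw [real_inner_self_eq_norm_sq, na]; norm_num
    have hbb : inner ℝ b b = (1 : ℝ) := by rw [real_inner_self_eq_norm_sq, nb]; norm_num
    have hw1 : proj2 a b w ∈ Submodule.span ℝ {v | v ∈ l} := by
      rw [proj2_apply]
      exact Submodule.sub_mem _ (Submodule.sub_mem _
        (Submodule.subset_span (e2 w (f2 w hw))) (Submodule.smul_mem _ _ ha))
        (Submodule.smul_mem _ _ hb)
    have hw2 : inner ℝ a (proj2 a b w) = 0 := by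
      rw [proj2_apply]
      simp only [inner_sub_right, real_inner_smul_right, haa, hab]; ring
    have hw3 : inner ℝ b (proj2 a b w) = 0 := by
      rw [proj2_apply]
      simp only [inner_sub_right, real_inner_smul_right, hbb, real_inner_comm a b, hab]; ring
    exact ⟨hw2, hw3, hc _ hw1 hw2 hw3⟩
  · refine e4.trans ?_
    rw [mul_smul]
    refine Eqv.smul ?_ c
    have g1 : Eqv (SUVal.DL (a :: l') m) (c' • SUVal.DL (s :: a :: l'') m) := by
      have := f4.D a
      rw [D_smul] at this
      refine this.trans (Eqv.smul ?_ c')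
      simp only [SUVal.DL]
      rw [D_comm]; exact Eqv.refl _
    refine g1.trans (Eqv.smul ?_ c')
    have g2 : Eqv (SUVal.DL (s :: a :: l'') m) (SUVal.DL (b :: a :: l'') m) := by
      have := hm.D_add_span (a :: l'') (s := β • a)
        (Submodule.smul_mem _ _ (Submodule.subset_span (by simp))) s
      rw [add_comm, ← hbs] at this
      exact this.symm
    refine g2.trans ?_
    have g3 : SUVal.DL (b :: a :: l'') m = SUVal.DL l'' (SUVal.D a (SUVal.D b m)) := by
      rw [SUVal.DL, SUVal.DL, D_comm, D_DL, D_DL]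
    rw [g3]
    exact hm.DL_map_proj2 a b l''

theorem cap_neg_apply (ε : ℝ) (y x : E) : cap ε (-y) x = cap ε y (-x) := by
  by_cases hx : x = 0
  · subst hx; rw [neg_zero, cap_zero, cap_zero]
  rw [cap_apply _ _ hx, cap_apply _ _ (neg_ne_zero.2 hx), norm_neg, ← norm_neg (_ - -y)]
  congr 6
  module

theorem SegInv.eq_zero_of_even [FiniteDimensional ℝ E] {m : (E → ℝ) → ℂ} (hs : SegInv m)
    (hm : IsVal m) (he : Cov (-ContinuousLinearMap.id ℝ E) 1 m) {f : E → ℝ} (hf : Sublin f) :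
    m f = m 0 := by
  refine hs.eq_zero_of_cap hm (fun ε hε hε' y hy => ?_) hf
  have hy' : ‖-y‖ ≤ 2 := by rwa [norm_neg]
  have h1 := hs.ext_cap hm hε hε' HasBd.zero hy hy' 1 1
  simp only [one_smul, zero_add] at h1
  have h2 : Ext m (cap ε y + cap ε (-y)) = Ext m 0 := by
    have := hs.ext_add_nn hm HasBd.zero (e := cap ε y + cap ε (-y)) (by
      rw [zero_add]
      exact HasBd.add ⟨_, cap_bd hε hε' hy⟩ ⟨_, cap_bd hε hε' hy'⟩) (Nn.cap_add_neg ε y)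
    rwa [zero_add] at this
  have h3 : Ext m (cap ε (-y)) = Ext m (cap ε y) := by
    rw [hs.ext_eq hm (cap_bd hε hε' hy), hs.ext_eq hm (cap_bd hε hε' hy')]
    rw [← one_mul (m ((132 : ℝ) • nrm + cap ε y)), ← he _ (cap_bd hε hε' hy).add]
    congr 1; ext x
    simp [nrm, cap_neg_apply]
  rw [h2, h3, hs.ext_zero hm] at h1
  linear_combination -h1 / 2

theorem Cov.neg_D {m : (E → ℝ) → ℂ} (he : Cov (-ContinuousLinearMap.id ℝ E) 1 m) (v : E) :
    Cov (-ContinuousLinearMap.id ℝ E) 1 (SUVal.D v m) := fun f hf => by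
  rw [he.D_apply (by simp) v hf]
  simp [D_neg]

/-- All second differences vanish. -/
def SegInv2 (m : (E → ℝ) → ℂ) : Prop := ∀ v, SegInv (D v m)

theorem SegInv2.incr_nn [FiniteDimensional ℝ E] {m : (E → ℝ) → ℂ} (h : SegInv2 m) (hm : IsVal m)
    {f c e : E → ℝ} (hf : Sublin f) (hc : Sublin c) (hc' : Nn c) (he : Nn e)
    (hfe : Sublin (f + e)) : m (f + e + c) - m (f + e) = m (f + c) - m f := by
  have hi : IsVal (fun f => m (f + c) - m f) := (hm.shift hc).sub hm
  have hs : SegInv (fun f => m (f + c) - m f) := fun v g hg => by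
    have := (h v).nn (hm.D v) hg hc' (hg.add hc)
    simp only [D, Pi.zero_apply] at this ⊢
    rw [add_right_comm] at this
    linear_combination this
  exact hs.nn hi hf he hfe

theorem SegInv2.add [FiniteDimensional ℝ E] {m : (E → ℝ) → ℂ} (h : SegInv2 m) (hm : IsVal m)
    {p q : E → ℝ} (hp : Sublin p) (hp' : Nn p) (hq : Sublin q) (hq' : Nn q) :
    m (p + q) - m 0 = (m p - m 0) + (m q - m 0) := by
  have := h.incr_nn hm Sublin.zero hq hq' hp' (by rwa [zero_add])
  rw [zero_add, zero_add] at this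
  linear_combination this

theorem SegInv2.smul [FiniteDimensional ℝ E] {m : (E → ℝ) → ℂ} (h : SegInv2 m) (hm : IsVal m)
    {p : E → ℝ} (hp : Sublin p) (hp' : Nn p) {t : ℝ} (ht : 0 ≤ t) :
    m (t • p) - m 0 = t * (m p - m 0) := by
  have := linear_of_additive (φ := fun t => m (t • p) - m 0) (fun s t hs ht => by
    show m ((s + t) • p) - m 0 = _
    rw [add_smul, h.add hm (hp.const_smul hs) (hp'.const_smul s) (hp.const_smul ht)
      (hp'.const_smul t)]) (fun ε hε => ?_) ht
  · simpa using this
  · obtain ⟨δ, hδ, H⟩ := hm.cont 0 Sublin.zero ε hε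
    obtain ⟨C, hC0, hC⟩ := hp.abs_bdd
    refine ⟨δ / (C + 1), by positivity, fun t ht htd => H _ (hp.const_smul ht) fun x => ?_⟩
    simp only [Pi.smul_apply, smul_eq_mul, Pi.zero_apply, sub_zero, abs_mul, abs_of_nonneg ht]
    rw [le_div_iff₀ (by positivity)] at htd
    have := hC x
    have := norm_nonneg x
    have := mul_le_mul_of_nonneg_left (hC x) ht
    nlinarith

theorem SegInv2.sum [FiniteDimensional ℝ E] {m : (E → ℝ) → ℂ} (h : SegInv2 m) (hm : IsVal m)
    {ι : Type*} (s : Finset ι) (w : ι → ℝ) (p : ι → E → ℝ) (hw : ∀ i ∈ s, 0 ≤ w i)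
    (hp : ∀ i ∈ s, Zonoid (p i)) :
    m (∑ i ∈ s, w i • p i) - m 0 = ∑ i ∈ s, w i * (m (p i) - m 0) := by
  classical
  induction s using Finset.induction_on with
  | empty => simp
  | insert a s ha ih =>
    have z1 : Zonoid (w a • p a) := (hp a (by simp)).const_smul (hw a (by simp))
    have z2 : Zonoid (∑ i ∈ s, w i • p i) := Zonoid.sum s _ fun i hi =>
      (hp i (by simp [hi])).const_smul (hw i (by simp [hi]))
    rw [Finset.sum_insert ha, Finset.sum_insert ha, h.add hm z1.sublin z1.nn z2.sublin z2.nn,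
      h.smul hm (hp a (by simp)).sublin (hp a (by simp)).nn (hw a (by simp)),
      ih (fun i hi => hw i (by simp [hi])) (fun i hi => hp i (by simp [hi]))]

open Classical in
/-- Linear extension of `m - m 0` to differences of support functions. -/
def Inc (m : (E → ℝ) → ℂ) (e : E → ℝ) : ℂ :=
  if h : ∃ pq : (E → ℝ) × (E → ℝ), (Sublin pq.1 ∧ Nn pq.1) ∧ (Sublin pq.2 ∧ Nn pq.2)
    ∧ e = pq.1 - pq.2 then m h.choose.1 - m h.choose.2 else 0

theorem SegInv2.inc_eq [FiniteDimensional ℝ E] {m : (E → ℝ) → ℂ} (h : SegInv2 m) (hm : IsVal m)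
    {e p q : E → ℝ} (hp : Sublin p) (hp' : Nn p) (hq : Sublin q) (hq' : Nn q) (he : e = p - q) :
    Inc m e = m p - m q := by
  have hex : ∃ pq : (E → ℝ) × (E → ℝ), (Sublin pq.1 ∧ Nn pq.1) ∧ (Sublin pq.2 ∧ Nn pq.2)
    ∧ e = pq.1 - pq.2 := ⟨(p, q), ⟨hp, hp'⟩, ⟨hq, hq'⟩, he⟩
  rw [Inc, dif_pos hex]
  obtain ⟨⟨s1, s2⟩, ⟨s3, s4⟩, s5⟩ := hex.choose_spec
  have k1 := h.add hm s1 s2 hq hq'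
  have k2 := h.add hm hp hp' s3 s4
  have s6 : hex.choose.1 - hex.choose.2 = p - q := s5.symm.trans he
  have : hex.choose.1 + q = p + hex.choose.2 := sub_eq_sub_iff_add_eq_add.1 s6
  rw [this] at k1
  linear_combination k2 - k1

/-- Functions with small perturbation bound that are limits of zonoid differences. -/
def Pert (e : E → ℝ) : Prop := HasBd e ∧ Nn e

theorem Pert.bd {e : E → ℝ} (h : Pert e) : ∃ R, 0 ≤ R ∧ Bd R e := by
  obtain ⟨⟨R, hR⟩, _⟩ := h
  exact ⟨|R|, abs_nonneg R, hR.mono (le_abs_self R)⟩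

theorem nrm_nn [FiniteDimensional ℝ E] {R : ℝ} (hR : 0 ≤ R) : Zonoid (R • (nrm : E → ℝ)) :=
  Zonoid.norm.const_smul hR

theorem SegInv2.inc_bd [FiniteDimensional ℝ E] {m : (E → ℝ) → ℂ} (h : SegInv2 m) (hm : IsVal m)
    {e : E → ℝ} {R : ℝ} (hR : 0 ≤ R) (hb : Bd R e) (he : Nn e) :
    Inc m e = m (R • nrm + e) - m (R • nrm) :=
  h.inc_eq hm hb.add ((nrm_nn hR).nn.add he) (nrm_nn hR).sublin (nrm_nn hR).nn (by abel)

theorem SegInv2.inc_add [FiniteDimensional ℝ E] {m : (E → ℝ) → ℂ} (h : SegInv2 m) (hm : IsVal m)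
    {e e' : E → ℝ} (he : Pert e) (he' : Pert e') : Inc m (e + e') = Inc m e + Inc m e' := by
  obtain ⟨R, hR, hb⟩ := he.bd
  obtain ⟨R', hR', hb'⟩ := he'.bd
  rw [h.inc_bd hm hR hb he.2, h.inc_bd hm hR' hb' he'.2,
    h.inc_bd hm (add_nonneg hR hR') (hb.sum2 hb') (he.2.add he'.2)]
  have z := (nrm_nn (E := E) hR).nn
  have z' := (nrm_nn (E := E) hR').nn
  have k1 := h.add hm hb.add (z.add he.2) hb'.add (z'.add he'.2)
  have k2 := h.add hm (nrm_nn hR).sublin z (nrm_nn hR').sublin z'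
  rw [show R • nrm + e + (R' • nrm + e') = (R + R') • nrm + (e + e') by rw [add_smul]; abel] at k1
  rw [← add_smul] at k2
  linear_combination k1 - k2

theorem SegInv2.inc_smul [FiniteDimensional ℝ E] {m : (E → ℝ) → ℂ} (h : SegInv2 m) (hm : IsVal m)
    {e : E → ℝ} (he : Pert e) (t : ℝ) : Inc m (t • e) = t * Inc m e := by
  obtain ⟨R, hR, hb⟩ := he.bd
  have z := (nrm_nn (E := E) hR)
  rw [h.inc_bd hm hR hb he.2]
  have hp : Nn (R • nrm + e) := z.nn.add he.2
  rcases le_total 0 t with ht | ht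
  · rw [h.inc_eq hm (p := t • (R • nrm + e)) (q := t • (R • nrm)) (hb.add.const_smul ht)
      (hp.const_smul t) (z.sublin.const_smul ht) (z.nn.const_smul t) (by module)]
    linear_combination h.smul hm hb.add hp ht - h.smul hm z.sublin z.nn ht
  · have ht' : 0 ≤ -t := by linarith
    rw [h.inc_eq hm (q := (-t) • (R • nrm + e)) (p := (-t) • (R • nrm)) (z.sublin.const_smul ht')
      (z.nn.const_smul _) (hb.add.const_smul ht') (hp.const_smul _) (by module)]
    have k := h.smul hm hb.add hp ht'
    have k' := h.smul hm z.sublin z.nn ht'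
    push_cast at k k'
    linear_combination k' - k

theorem Pert.smul {e : E → ℝ} (he : Pert e) (t : ℝ) : Pert (t • e) :=
  ⟨he.1.const_smul t, he.2.const_smul t⟩

theorem Pert.sum {ι : Type*} (s : Finset ι) (e : ι → E → ℝ) (h : ∀ i ∈ s, Pert (e i)) :
    Pert (∑ i ∈ s, e i) := ⟨HasBd.sum s e fun i hi => (h i hi).1, Nn.sum s e fun i hi => (h i hi).2⟩

theorem SegInv2.inc_zero [FiniteDimensional ℝ E] {m : (E → ℝ) → ℂ} (h : SegInv2 m)
    (hm : IsVal m) : Inc m 0 = 0 := by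
  rw [h.inc_bd hm le_rfl Bd.zero Nn.zero]; simp

theorem SegInv2.inc_sum [FiniteDimensional ℝ E] {m : (E → ℝ) → ℂ} (h : SegInv2 m) (hm : IsVal m)
    {ι : Type*} (s : Finset ι) (c : ι → ℝ) (e : ι → E → ℝ) (he : ∀ i ∈ s, Pert (e i)) :
    Inc m (∑ i ∈ s, c i • e i) = ∑ i ∈ s, c i * Inc m (e i) := by
  classical
  induction s using Finset.induction_on with
  | empty => simp [h.inc_zero hm]
  | insert a s ha ih =>
    rw [Finset.sum_insert ha, Finset.sum_insert ha, h.inc_add hm ((he a (by simp)).smul _)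
      (Pert.sum s _ fun i hi => (he i (by simp [hi])).smul _), h.inc_smul hm (he a (by simp)),
      ih fun i hi => he i (by simp [hi])]

/-- The increment is bounded by the size of the perturbation. -/
theorem SegInv2.inc_le [FiniteDimensional ℝ E] {m : (E → ℝ) → ℂ} (h : SegInv2 m) (hm : IsVal m) :
    ∃ C : ℝ, 0 ≤ C ∧ ∀ (e : E → ℝ) (R : ℝ), 0 < R → Bd R e → Nn e → ‖Inc m e‖ ≤ C * R := by
  obtain ⟨δ, hδ, H⟩ := hm.cont nrm Sublin.nrm 1 one_pos
  set d := min δ 1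
  have hd : 0 < d := lt_min hδ one_pos
  refine ⟨d⁻¹, (inv_pos.2 hd).le, fun e R hR hb he => ?_⟩
  have hb' : Bd d ((d / R) • e) := (hb.const_smul (d / R)).mono (by
    rw [abs_of_pos (by positivity)]; exact le_of_eq (by field_simp))
  have hb1 := hb'.mono (min_le_right δ 1)
  have k1 := h.inc_bd hm zero_le_one hb1 (he.const_smul _)
  rw [h.inc_smul hm ⟨⟨R, hb⟩, he⟩, one_smul] at k1
  have k2 : ‖((d / R : ℝ) : ℂ) * Inc m e‖ ≤ 1 := by
    rw [k1]
    refine H _ (by simpa using hb1.add) fun x => ?_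
    have := hb'.abs x
    simp only [Pi.add_apply, add_sub_cancel_left]
    exact this.trans (mul_le_mul_of_nonneg_right (min_le_left _ _) (norm_nonneg x))
  rw [norm_mul, Complex.norm_real, Real.norm_of_nonneg (by positivity), div_mul_eq_mul_div,
    div_le_iff₀ hR, one_mul] at k2
  rw [inv_mul_eq_div, le_div_iff₀ hd]
  linarith

theorem Pert.comp [FiniteDimensional ℝ E] {e : E → ℝ} (he : Pert e) (A : E →L[ℝ] E)
    (hA : ∀ x y, inner ℝ (A x) (A y) = inner ℝ x y) : Pert (e ∘ A) ∧
      ∀ R, Bd R e → Bd R (e ∘ A) := by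
  have hn : ∀ x, ‖A x‖ = ‖x‖ := fun x => by
    rw [← sq_eq_sq₀ (norm_nonneg _) (norm_nonneg _), ← real_inner_self_eq_norm_sq,
      ← real_inner_self_eq_norm_sq, hA]
  have hnn : (nrm : E → ℝ) ∘ A = nrm := by ext x; simp [nrm, hn]
  have hbd : ∀ (e : E → ℝ) (R : ℝ), Bd R e → Bd R (e ∘ A) := fun e R hb => by
    refine ⟨?_, ?_, fun x => ?_⟩
    · have := hb.add.comp A
      rwa [show (R • nrm + e) ∘ A = R • (nrm ∘ A) + e ∘ A from rfl, hnn] at this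
    · have := hb.sub.comp A
      rwa [show (R • nrm - e) ∘ A = R • (nrm ∘ A) - e ∘ A from rfl, hnn] at this
    · have := hb.abs (A x); rwa [hn] at this
  have hcs : CompleteSpace E := FiniteDimensional.complete ℝ E
  refine ⟨⟨?_, fun ε hε => ?_⟩, hbd e⟩
  · obtain ⟨R, hR⟩ := he.1; exact ⟨R, hbd e R hR⟩
  · obtain ⟨p, q, hp, hq, hb⟩ := he.2 ε hε
    exact ⟨p ∘ A, q ∘ A, hp.comp A, hq.comp A, hbd _ _ hb⟩

theorem SegInv2.inc_comp [FiniteDimensional ℝ E] {m : (E → ℝ) → ℂ} (h : SegInv2 m) (hm : IsVal m)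
    {A : E →L[ℝ] E} (hA : ∀ x y, inner ℝ (A x) (A y) = inner ℝ x y) {χ : ℂ} (hc : Cov A χ m)
    {e : E → ℝ} (he : Pert e) : Inc m (e ∘ A) = χ * Inc m e := by
  obtain ⟨R, hR, hb⟩ := he.bd
  have hA' := he.comp A hA
  rw [h.inc_bd hm hR hb he.2, h.inc_bd hm hR (hA'.2 R hb) hA'.1.2, mul_sub,
    ← hc _ hb.add, ← hc _ (nrm_nn hR).sublin]
  have hn : ∀ x, ‖A x‖ = ‖x‖ := fun x => by
    rw [← sq_eq_sq₀ (norm_nonneg _) (norm_nonneg _), ← real_inner_self_eq_norm_sq,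
      ← real_inner_self_eq_norm_sq, hA]
  have hnn : (nrm : E → ℝ) ∘ A = nrm := by ext x; simp [nrm, hn]
  rw [show (R • nrm + e) ∘ A = R • (nrm ∘ A) + e ∘ A from rfl,
    show (R • nrm) ∘ A = R • (nrm ∘ A) from rfl, hnn]

theorem sum_cos_sin {N : ℕ} (hN : N ≠ 0) {j : ℤ} (hj : ¬ (N : ℤ) ∣ j) :
    ∑ k ∈ Finset.range N, Real.cos (j * (2 * Real.pi * k / N)) = 0 ∧
    ∑ k ∈ Finset.range N, Real.sin (j * (2 * Real.pi * k / N)) = 0 := by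
  have hN' : (N : ℂ) ≠ 0 := by exact_mod_cast hN
  set ζ : ℂ := Complex.exp (2 * Real.pi * Complex.I * j / N) with hζ
  have h1 : ζ ≠ 1 := fun h => by
    rw [hζ, Complex.exp_eq_one_iff] at h
    obtain ⟨p, hp⟩ := h
    have hpi : (2 * Real.pi * Complex.I : ℂ) ≠ 0 := Complex.two_pi_I_ne_zero
    field_simp at hp
    exact hj ⟨p, by exact_mod_cast hp⟩
  have h2 : ζ ^ N = 1 := by
    rw [hζ, ← Complex.exp_nat_mul, Complex.exp_eq_one_iff]
    exact ⟨j, by field_simp⟩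
  have h3 : ∑ k ∈ Finset.range N, ζ ^ k = 0 := by
    rw [geom_sum_eq h1, h2, sub_self, zero_div]
  have h4 : ∀ k : ℕ, ζ ^ k = Complex.exp ((j * (2 * Real.pi * k / N) : ℝ) * Complex.I) := by
    intro k
    rw [hζ, ← Complex.exp_nat_mul]
    congr 1
    push_cast
    field_simp
  simp_rw [h4] at h3
  constructor
  · have := congrArg Complex.re h3
    simpa only [Complex.re_sum, Complex.exp_ofReal_mul_I_re, Complex.zero_re] using this
  · have := congrArg Complex.im h3
    simpa only [Complex.im_sum, Complex.exp_ofReal_mul_I_im, Complex.zero_im] using this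

theorem sum_cos_mul_sq {l : ℤ} (hl : 3 ≤ |l|) {N : ℕ} (hN : (N : ℤ) = |l| + 3) (α β η : ℝ) :
    ∑ k ∈ Finset.range N, Real.cos (l * (2 * Real.pi * k / N)) *
      (α + β * Real.cos (2 * Real.pi * k / N) + η * Real.sin (2 * Real.pi * k / N)) ^ 2 = 0 := by
  have hN0 : N ≠ 0 := by rintro rfl; simp at hN; omega
  have hd : ∀ i : ℤ, |i| ≤ 2 → ¬ (N : ℤ) ∣ l + i := fun i hi hdv => by
    have h0 : l + i ≠ 0 := fun h => by
      have : l = -i := by omega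
      rw [this, abs_neg] at hl; omega
    have := Int.le_of_dvd (abs_pos.2 h0) ((dvd_abs _ _).2 hdv)
    have := abs_add_le l i
    omega
  have key : ∀ k : ℕ, Real.cos (l * (2 * Real.pi * k / N)) *
      (α + β * Real.cos (2 * Real.pi * k / N) + η * Real.sin (2 * Real.pi * k / N)) ^ 2
      = (α ^ 2 + (β ^ 2 + η ^ 2) / 2) * Real.cos ((l + 0 : ℤ) * (2 * Real.pi * k / N))
      + (α * β) * (Real.cos ((l + 1 : ℤ) * (2 * Real.pi * k / N))
        + Real.cos ((l + (-1) : ℤ) * (2 * Real.pi * k / N)))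
      + (α * η) * (Real.sin ((l + 1 : ℤ) * (2 * Real.pi * k / N))
        - Real.sin ((l + (-1) : ℤ) * (2 * Real.pi * k / N)))
      + ((β ^ 2 - η ^ 2) / 4) * (Real.cos ((l + 2 : ℤ) * (2 * Real.pi * k / N))
        + Real.cos ((l + (-2) : ℤ) * (2 * Real.pi * k / N)))
      + (β * η / 2) * (Real.sin ((l + 2 : ℤ) * (2 * Real.pi * k / N))
        - Real.sin ((l + (-2) : ℤ) * (2 * Real.pi * k / N))) := by
    intro k
    set t := 2 * Real.pi * k / N
    push_cast
    rw [show ((l : ℝ) + 0) * t = l * t by ring, show ((l : ℝ) + 1) * t = l * t + t by ring,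
      show ((l : ℝ) + -1) * t = l * t - t by ring, show ((l : ℝ) + 2) * t = l * t + 2 * t by ring,
      show ((l : ℝ) + -2) * t = l * t - 2 * t by ring]
    simp only [Real.cos_add, Real.cos_sub, Real.sin_add, Real.sin_sub, Real.cos_two_mul,
      Real.sin_two_mul]
    have := Real.sin_sq_add_cos_sq t
    linear_combination Real.cos (l * t) * η ^ 2 * this
  simp_rw [key, Finset.sum_add_distrib, ← Finset.mul_sum, Finset.sum_add_distrib,
    Finset.sum_sub_distrib]
  rw [(sum_cos_sin hN0 (hd 0 (by simp))).1, (sum_cos_sin hN0 (hd 1 (by simp))).1,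
    (sum_cos_sin hN0 (hd (-1) (by simp))).1, (sum_cos_sin hN0 (hd 2 (by simp))).1,
    (sum_cos_sin hN0 (hd (-2) (by simp))).1, (sum_cos_sin hN0 (hd 1 (by simp))).2,
    (sum_cos_sin hN0 (hd (-1) (by simp))).2, (sum_cos_sin hN0 (hd 2 (by simp))).2,
    (sum_cos_sin hN0 (hd (-2) (by simp))).2]
  ring

theorem sum_cos_mul_exp_ne {l : ℤ} {N : ℕ} (hN : N ≠ 0) :
    ∑ k ∈ Finset.range N, (Real.cos (l * (2 * Real.pi * k / N)) : ℂ)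
      * Complex.exp (l * ((2 * Real.pi * k / N : ℝ) : ℂ) * Complex.I) ≠ 0 := fun h => by
  have := congrArg Complex.re h
  rw [Complex.re_sum, Complex.zero_re] at this
  have hk : ∀ k : ℕ, ((Real.cos (l * (2 * Real.pi * k / N)) : ℂ)
      * Complex.exp (l * ((2 * Real.pi * k / N : ℝ) : ℂ) * Complex.I)).re
      = Real.cos (l * (2 * Real.pi * k / N)) ^ 2 := fun k => by
    rw [Complex.re_ofReal_mul, show (l : ℂ) * ((2 * Real.pi * k / N : ℝ) : ℂ)
      = ((l * (2 * Real.pi * k / N) : ℝ) : ℂ) by push_cast; ring, Complex.exp_ofReal_mul_I_re, sq]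
  simp_rw [hk] at this
  rw [Finset.sum_eq_zero_iff_of_nonneg fun _ _ => sq_nonneg _] at this
  have := this 0 (Finset.mem_range.2 (Nat.pos_of_ne_zero hN))
  simp at this

theorem integral_abs_sub_symm {T c : ℝ} (hc : |c| ≤ T) :
    ∫ p in (-T)..T, |c - p| = T ^ 2 + c ^ 2 := by
  obtain ⟨h1, h2⟩ := abs_le.1 hc
  have hi : ∀ a b : ℝ, IntervalIntegrable (fun p => |c - p|) volume a b := fun a b =>
    (by fun_prop : Continuous fun p : ℝ => |c - p|).intervalIntegrable a b
  rw [← intervalIntegral.integral_add_adjacent_intervals (hi (-T) c) (hi c T)]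
  have e1 : ∫ p in (-T)..c, |c - p| = ∫ p in (-T)..c, (c - p) :=
    intervalIntegral.integral_congr fun p hp => by
      rw [Set.uIcc_of_le h1] at hp
      exact abs_of_nonneg (by linarith [hp.2])
  have e2 : ∫ p in c..T, |c - p| = ∫ p in c..T, (p - c) :=
    intervalIntegral.integral_congr fun p hp => by
      rw [Set.uIcc_of_le h2] at hp
      show |c - p| = p - c
      rw [abs_of_nonpos (by linarith [hp.1])]; ring
  rw [e1, e2, intervalIntegral.integral_sub (by simp) (by simp),
    intervalIntegral.integral_sub (by simp) (by simp), integral_id, integral_id]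
  simp
  ring

/-- The support function of a planar lens in directions `a`, `w`. -/
def lens (a w : E) (T : ℝ) : E → ℝ :=
  fun x => ∫ p in Set.Icc (-T) T, |inner ℝ (w - p • a) x|

theorem lens_zonoid (a w : E) (T : ℝ) : Zonoid (lens a w T) :=
  zonoid_integral volume isCompact_Icc (by simp) (V := fun p : ℝ => w - p • a)
    (by fun_prop)

theorem lens_eq {a w : E} {T : ℝ} {x : E} (hx : inner ℝ a x ≠ 0)
    (hw : |inner ℝ w x| ≤ T * |inner ℝ a x|) :
    lens a w T x = T ^ 2 * |inner ℝ a x| + |inner ℝ a x|⁻¹ * inner ℝ w x ^ 2 := by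
  set α : ℝ := inner ℝ a x
  set β : ℝ := inner ℝ w x
  have hα : 0 < |α| := abs_pos.2 hx
  have hc : |β / α| ≤ T := by rwa [abs_div, div_le_iff₀ hα]
  have hT : -T ≤ T := by linarith [(abs_nonneg _).trans hc]
  have e : ∀ p : ℝ, |inner ℝ (w - p • a) x| = |α| * |β / α - p| := fun p => by
    rw [inner_sub_left, real_inner_smul_left, ← abs_mul]
    congr 1
    show β - p * α = _
    field_simp
  simp only [lens, e]
  rw [integral_Icc_eq_integral_Ioc, ← intervalIntegral.integral_of_le hT,
    intervalIntegral.integral_const_mul, integral_abs_sub_symm hc, div_pow, ← sq_abs α]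
  field_simp

theorem prim2_mul (γ : ℝ → ℝ) (r s : ℝ) :
    prim2 γ (r * s) = prim2 (fun z => r ^ 2 * γ (r ^ 2 * z)) s := by
  rcases eq_or_ne r 0 with rfl | hr
  · simp [prim2]
  have := intervalIntegral.smul_integral_comp_mul_left
    (f := fun t => (r * s - t) * γ (t ^ 2)) (a := 0) (b := s) r
  rw [mul_zero] at this
  rw [prim2, ← this, prim2, smul_eq_mul, ← intervalIntegral.integral_const_mul]
  congr 1; ext t
  rw [mul_pow]; ring

theorem prim2_abs (γ : ℝ → ℝ) (s : ℝ) : prim2 γ |s| = prim2 γ s := by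
  rcases abs_choice s with h | h
  · rw [h]
  · rw [h, ← neg_one_mul, prim2_mul]; simp

theorem prim2_nonneg {γ : ℝ → ℝ} {s : ℝ} (h : ∀ z, 0 ≤ z → 0 ≤ γ z) : 0 ≤ prim2 γ s := by
  rw [← prim2_abs]
  refine intervalIntegral.integral_nonneg (abs_nonneg s) fun t ht => ?_
  exact mul_nonneg (by linarith [ht.2]) (h _ (sq_nonneg t))

theorem prim2_eq_zero {γ : ℝ → ℝ} {s τ : ℝ} (h : ∀ z, z ≤ τ ^ 2 → γ z = 0) (hs : |s| ≤ τ) :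
    prim2 γ s = 0 := by
  rw [← prim2_abs, prim2, intervalIntegral.integral_congr (g := fun _ => 0)]
  · simp
  · intro t ht
    rw [Set.uIcc_of_le (abs_nonneg s)] at ht
    have : γ (t ^ 2) = 0 := h _ (pow_le_pow_left₀ ht.1 (ht.2.trans hs) 2)
    simp [this]

theorem prim2_one (s : ℝ) : prim2 (fun _ => 1) s = s ^ 2 / 2 := by
  simp only [prim2, mul_one]
  rw [intervalIntegral.integral_sub (by simp) (by simp), integral_id]
  simp; ring

theorem inner_isometry_norm {A : E →L[ℝ] E} (hA : ∀ x y, inner ℝ (A x) (A y) = inner ℝ x y)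
    (x : E) : ‖A x‖ = ‖x‖ := by
  rw [← sq_eq_sq₀ (norm_nonneg _) (norm_nonneg _), ← real_inner_self_eq_norm_sq,
    ← real_inner_self_eq_norm_sq, hA]

/-- The increment of `m` by `f` over the base `B`. -/
def Psi (m : (E → ℝ) → ℂ) (B f : E → ℝ) : (E → ℝ) → ℂ :=
  fun A => m (A + (B + f)) - m (A + B)

theorem IsVal.psi {m : (E → ℝ) → ℂ} (hm : IsVal m) {B f : E → ℝ} (hB : Sublin B)
    (hf : Sublin (B + f)) : IsVal (Psi m B f) := (hm.shift hf).sub (hm.shift hB)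

theorem D_psi (m : (E → ℝ) → ℂ) (B f : E → ℝ) (v : E) :
    D v (Psi m B f) = Psi (D v m) B f := by
  ext g
  simp only [D, Psi, add_right_comm g (seg v)]
  ring

theorem SegInv2.psi [FiniteDimensional ℝ E] {m : (E → ℝ) → ℂ} (hm : IsVal m)
    (h3 : ∀ u v w, Eqv (D u (D v (D w m))) 0) {B f : E → ℝ} (hB : Sublin B)
    (hf : Sublin (B + f)) (hf' : Nn f) : SegInv2 (Psi m B f) := fun v u g hg => by
  rw [D_psi, D_psi, Psi, ← add_assoc]
  have hs : SegInv (D u (D v m)) := fun w => h3 w u v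
  rw [hs.nn ((hm.D v).D u) (hg.add hB) hf' (by rw [add_assoc]; exact hg.add hf), sub_self]
  rfl

theorem SegInv2.eq_zero_of_avg [FiniteDimensional ℝ E] {Φ : (E → ℝ) → ℂ} (h : SegInv2 Φ)
    (hm : IsVal Φ) {N : ℕ} {A : ℕ → E →L[ℝ] E} {χ : ℕ → ℂ} {c : ℕ → ℝ}
    (hc : ∀ k, Cov (A k) (χ k) Φ) {p : E → ℝ} (hp : Zonoid p)
    (heq : Φ (∑ k ∈ Finset.range N, max (c k) 0 • (p ∘ A k))
      = Φ (∑ k ∈ Finset.range N, max (-c k) 0 • (p ∘ A k)))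
    (hne : ∑ k ∈ Finset.range N, (c k : ℂ) * χ k ≠ 0) : Φ p = Φ 0 := by
  have hcs : CompleteSpace E := FiniteDimensional.complete ℝ E
  have h1 := h.sum hm (Finset.range N) (fun k => max (c k) 0) (fun k => p ∘ A k)
    (fun k _ => le_max_right _ _) fun k _ => hp.comp (A k)
  have h2 := h.sum hm (Finset.range N) (fun k => max (-c k) 0) (fun k => p ∘ A k)
    (fun k _ => le_max_right _ _) fun k _ => hp.comp (A k)
  rw [heq, h2, ← sub_eq_zero, ← Finset.sum_sub_distrib] at h1
  have h0 : ∀ k, Φ 0 = χ k * Φ 0 := fun k => by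
    rw [← hc k 0 Sublin.zero]; rfl
  have e : ∀ k, ((max (-c k) 0 : ℝ) : ℂ) * (Φ (p ∘ A k) - Φ 0)
      - ((max (c k) 0 : ℝ) : ℂ) * (Φ (p ∘ A k) - Φ 0) = -((c k * χ k) * (Φ p - Φ 0)) := fun k => by
    rw [hc k p hp.sublin]
    have : ((max (c k) 0 : ℝ) : ℂ) - ((max (-c k) 0 : ℝ) : ℂ) = c k := by
      rw [← Complex.ofReal_sub]
      congr 1
      rcases le_total (c k) 0 with hk | hk
      · rw [max_eq_right hk, max_eq_left (by linarith)]; ring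
      · rw [max_eq_left hk, max_eq_right (by linarith)]; ring
    linear_combination (-(χ k * Φ p) + Φ 0) * this + (c k : ℂ) * h0 k
  simp_rw [e] at h1
  rw [Finset.sum_neg_distrib, neg_eq_zero, ← Finset.sum_mul] at h1
  exact sub_eq_zero.1 ((mul_eq_zero.1 h1).resolve_left hne)

theorem max_sum_sub {N : ℕ} (c q : ℕ → ℝ) (h : ∑ k ∈ Finset.range N, c k * q k = 0) :
    ∑ k ∈ Finset.range N, max (c k) 0 * q k = ∑ k ∈ Finset.range N, max (-c k) 0 * q k := by
  rw [← sub_eq_zero, ← Finset.sum_sub_distrib]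
  refine Eq.trans ?_ h
  refine Finset.sum_congr rfl fun k _ => ?_
  rcases le_total (c k) 0 with hk | hk
  · rw [max_eq_right hk, max_eq_left (by linarith)]; ring
  · rw [max_eq_left hk, max_eq_right (by linarith)]; ring

/-- The increment by `f` is the same over two bases agreeing on the support of `f`. -/
theorem IsVal.psi_eq {m : (E → ℝ) → ℂ} (hm : IsVal m) {B f p q : E → ℝ} (hB : Sublin B)
    (hf : Sublin (B + f)) (h0 : ∀ x, 0 ≤ f x) (hp : Sublin p) (hq : Sublin q)
    (hpq : ∀ x, f x ≠ 0 → p x = q x) : Psi m B f p = Psi m B f q := by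
  have key : ∀ p q : E → ℝ, Sublin p → Sublin q → (∀ x, f x ≠ 0 → p x = q x) →
      Psi m B f (p ⊔ q) = Psi m B f p := fun p q hp hq hpq => by
    have e1 : p + B + (p ⊔ q - p) = p ⊔ q + B := by abel
    have e2 : p + B + (f + (p ⊔ q - p)) = p ⊔ q + (B + f) := by abel
    have := hm.local_add (B := p + B) (e := f) (e' := p ⊔ q - p) (hp.add hB)
      (by rw [add_assoc]; exact hp.add hf) (by rw [e1]; exact (hp.sup hq).add hB)
      (by rw [e2]; exact (hp.sup hq).add hf)
      (fun x => by
        by_cases hx : f x = 0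
        · exact Or.inl hx
        · right; simp [hpq x hx])
      (Or.inl h0) (Or.inl fun x => by simp)
    rw [e1, e2, add_assoc] at this
    simp only [Psi]
    linear_combination this
  rw [← key p q hp hq hpq, sup_comm, key q p hq hp fun x hx => (hpq x hx).symm]

theorem lens_comp_eq {a w : E} {T : ℝ} {A : E →L[ℝ] E} {x : E}
    (ha : inner ℝ a (A x) = inner ℝ a x) (hx : inner ℝ a x ≠ 0)
    (hw : |inner ℝ w (A x)| ≤ T * |inner ℝ a x|) :
    lens a w T (A x) = T ^ 2 * |inner ℝ a x| + |inner ℝ a x|⁻¹ * inner ℝ w (A x) ^ 2 := by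
  rw [lens_eq (by rwa [ha]) (by rwa [ha]), ha]

theorem psi_lens [FiniteDimensional ℝ E] {J : E →L[ℝ] E} (hJ : IsCpx J) {l : ℤ} (hl : 3 ≤ |l|)
    {m : (E → ℝ) → ℂ} (hm : IsVal m) (hw : IsWt J l m)
    (h3 : ∀ u v w, Eqv (D u (D v (D w m))) 0) {a a' w : E} {ω ρ : ℝ} (na' : ‖a'‖ = 1)
    (nw : ‖w‖ = 1)
    (hwd : w = ω • J a + ρ • a') (o1 : inner ℝ a' a = 0) (o2 : inner ℝ a' (J a) = 0)
    {R : ℝ} (hR : 0 ≤ R) {γ : ℝ → ℝ} {τ T : ℝ} (hτ : 0 < τ) (hT : T * τ = 1)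
    (hγ : ∀ z, 0 ≤ z → 0 ≤ γ z) (hγ' : ∀ z, z ≤ τ ^ 2 → γ z = 0) (hb : Bd R (zon a γ))
    (hn : Nn (zon a γ)) :
    Psi m (R • nrm) (zon a γ) (lens a w T) = Psi m (R • nrm) (zon a γ) 0 := by
  obtain ⟨N, hN⟩ : ∃ N : ℕ, (N : ℤ) = |l| + 3 := ⟨l.natAbs + 3, by simp⟩
  have hN0 : N ≠ 0 := by rintro rfl; simp at hN; omega
  set A : ℕ → E →L[ℝ] E := fun k => rot J a' (2 * Real.pi * k / N) with hA
  have hAi : ∀ k x y, inner ℝ (A k x) (A k y) = inner ℝ x y := fun k => rot_inner hJ na' _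
  have o3 : inner ℝ (J a') a = 0 := by rw [hJ.inner_left, o2, neg_zero]
  have hAa : ∀ k, A k a = a := fun k => rot_of_orth J _ o1 o3
  have hax : ∀ k x, inner ℝ a (A k x) = inner ℝ a x := fun k x => by
    conv_lhs => rw [← hAa k]
    exact hAi k a x
  have hnrm : ∀ k, (nrm : E → ℝ) ∘ A k = nrm := fun k => by
    ext x; exact inner_isometry_norm (hAi k) x
  have hzon : ∀ k, zon a γ ∘ A k = zon a γ := fun k => by
    ext x; simp only [zon, Zn, Function.comp, hax, inner_isometry_norm (hAi k)]
  have hBs := (nrm_nn (E := E) hR).sublin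
  have hcov : ∀ k : ℕ, Cov (A k) (Complex.exp (l * ((2 * Real.pi * k / N : ℝ) : ℂ) * Complex.I))
      (Psi m (R • nrm) (zon a γ)) := fun k g hg => by
    have e1 : g ∘ A k + (R • nrm + zon a γ) = (g + (R • nrm + zon a γ)) ∘ A k := by
      conv_lhs => rw [← hzon k, ← hnrm k]
      rfl
    have e2 : g ∘ A k + R • nrm = (g + R • nrm) ∘ A k := by
      conv_lhs => rw [← hnrm k]
      rfl
    rw [Psi, e1, e2, hw a' na' _ _ (hg.add hb.add), hw a' na' _ _ (hg.add hBs), Psi]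
    ring
  have hcs : CompleteSpace E := FiniteDimensional.complete ℝ E
  have hz : ∀ c : ℕ → ℝ, Sublin (∑ k ∈ Finset.range N, max (c k) 0 • (lens a w T ∘ A k)) :=
    fun c => (Zonoid.sum _ _ fun k _ => ((lens_zonoid a w T).comp (A k)).const_smul
      (le_max_right _ _)).sublin
  refine (SegInv2.psi hm h3 hBs hb.add hn).eq_zero_of_avg (hm.psi hBs hb.add) hcov
    (lens_zonoid a w T) (c := fun k => Real.cos (l * (2 * Real.pi * k / N))) ?_
    (sum_cos_mul_exp_ne hN0)
  refine hm.psi_eq hBs hb.add (fun x => ?_) (hz _) (hz _) fun x hx => ?_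
  · exact mul_nonneg (norm_nonneg x) (prim2_nonneg hγ)
  · have hx' : τ * ‖x‖ < |inner ℝ a x| := by
      by_contra hc
      push Not at hc
      apply hx
      rw [zon, Zn]
      rcases eq_or_ne ‖x‖ 0 with h0 | h0
      · rw [h0, zero_mul]
      rw [prim2_eq_zero hγ', mul_zero]
      rw [abs_div, abs_norm, div_le_iff₀ (lt_of_le_of_ne (norm_nonneg x) h0.symm)]
      exact hc
    have hT0 : 0 < T := pos_of_mul_pos_left (by rw [hT]; exact one_pos) hτ.le
    have ha0 : inner ℝ a x ≠ 0 := abs_pos.1 (lt_of_le_of_lt (by positivity) hx')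
    have hwx : ∀ k, |inner ℝ w (A k x)| ≤ T * |inner ℝ a x| := fun k => by
      have h1 := abs_real_inner_le_norm w (A k x)
      rw [nw, one_mul, inner_isometry_norm (hAi k)] at h1
      have h2 := mul_lt_mul_of_pos_left hx' hT0
      rw [← mul_assoc, hT, one_mul] at h2
      linarith
    simp only [Finset.sum_apply, Pi.smul_apply, Function.comp, smul_eq_mul]
    have hwA : ∀ k : ℕ, inner ℝ w (A k x) = (inner ℝ w x - ρ * inner ℝ a' x)
        + (ρ * inner ℝ a' x) * Real.cos (2 * Real.pi * k / N)
        + (-(ρ * inner ℝ (J a') x)) * Real.sin (2 * Real.pi * k / N) := fun k => by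
      have i1 : inner ℝ w a' = ρ := by
        rw [hwd, inner_add_left, real_inner_smul_left, real_inner_smul_left, real_inner_comm, o2,
          real_inner_self_eq_norm_sq, na']
        ring
      have i2 : inner ℝ w (J a') = 0 := by
        rw [hwd, inner_add_left, real_inner_smul_left, real_inner_smul_left, hJ.inner_map,
          hJ.inner_self', real_inner_comm, o1]
        ring
      simp only [hA, rot_apply, inner_add_right, real_inner_smul_right, i1, i2]
      ring
    apply max_sum_sub
    simp_rw [lens_comp_eq (hax _ x) ha0 (hwx _), mul_add, Finset.sum_add_distrib]
    have s1 := sum_cos_mul_sq hl hN 1 0 0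
    have s2 := sum_cos_mul_sq hl hN (inner ℝ w x - ρ * inner ℝ a' x) (ρ * inner ℝ a' x)
      (-(ρ * inner ℝ (J a') x))
    simp_rw [← hwA] at s2
    simp only [zero_mul, add_zero, one_pow, mul_one] at s1
    rw [← Finset.sum_mul, s1]
    simp_rw [mul_left_comm _ (|inner ℝ a x|⁻¹)]
    rw [← Finset.mul_sum, s2]
    ring

theorem D_psi_rot [FiniteDimensional ℝ E] {J : E →L[ℝ] E} (hJ : IsCpx J) {l : ℤ}
    {m : (E → ℝ) → ℂ} (hm : IsVal m) (hw : IsWt J l m) {a w : E} (h2 : SegInv2 (D a m))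
    (na : ‖a‖ = 1) (nw : ‖w‖ = 1) (haw : inner ℝ a w = 0) (hw1 : w ≠ J a) (hw2 : w ≠ -J a)
    {γ : ℝ → ℝ} (hγ : Continuous γ) {S : ℝ} (hS : ∀ z ∈ Set.Icc (0 : ℝ) 1, |γ z| ≤ S) (p : ℝ)
    {r : ℝ} (hr : r = (Real.sqrt (1 + p ^ 2))⁻¹) :
    D (w - p • a) (Psi m ((4 * S) • nrm) (zon a γ)) 0
      = (r⁻¹ : ℝ) * Inc (D a m) (zon w fun z => r ^ 2 * γ (r ^ 2 * z)) := by
  have hq : 0 < Real.sqrt (1 + p ^ 2) := Real.sqrt_pos.2 (by positivity)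
  have hq2 : Real.sqrt (1 + p ^ 2) ^ 2 = 1 + p ^ 2 := Real.sq_sqrt (by positivity)
  set q := Real.sqrt (1 + p ^ 2)
  have hr0 : 0 < r := hr ▸ inv_pos.2 hq
  have hrq : r * q = 1 := by rw [hr, inv_mul_cancel₀ hq.ne']
  have hr1 : r ^ 2 ≤ 1 := by
    have : r ^ 2 * q ^ 2 = 1 := by rw [← mul_pow, hrq, one_pow]
    rw [hq2] at this
    nlinarith [mul_nonneg (sq_nonneg r) (sq_nonneg p)]
  have hS0 : 0 ≤ S := (abs_nonneg _).trans (hS 0 ⟨le_rfl, zero_le_one⟩)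
  obtain ⟨θ, hc, hs⟩ : ∃ θ : ℝ, Real.cos θ = -(p * r) ∧ Real.sin θ = r := by
    have hn : ‖(⟨-(p * r), r⟩ : ℂ)‖ = 1 := by
      rw [Complex.norm_def, Complex.normSq_mk, Real.sqrt_eq_one]
      have : r ^ 2 * q ^ 2 = 1 := by rw [← mul_pow, hrq, one_pow]
      rw [hq2] at this
      linarith
    have hne : (⟨-(p * r), r⟩ : ℂ) ≠ 0 := fun h => by rw [h] at hn; simp at hn
    exact ⟨Complex.arg ⟨-(p * r), r⟩, by rw [Complex.cos_arg hne, hn]; simp,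
      by rw [Complex.sin_arg, hn]; simp⟩
  obtain ⟨A, hA, Aa, Aw, -, hcov⟩ := exists_rot2 hJ na nw haw hw1 hw2 θ
  have hinv : ∀ x, inner ℝ a (A x) = -(p * r) * inner ℝ a x - r * inner ℝ w x := fun x => by
    have : a = Real.cos θ • A a - Real.sin θ • A w := by
      rw [Aa, Aw]
      have h1 : Real.cos θ • (Real.cos θ • a + Real.sin θ • w)
          - Real.sin θ • (-Real.sin θ • a + Real.cos θ • w)
          = (Real.sin θ ^ 2 + Real.cos θ ^ 2) • a := by module
      rw [h1, Real.sin_sq_add_cos_sq, one_smul]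
    conv_lhs => rw [this]
    rw [inner_sub_left, real_inner_smul_left, real_inner_smul_left, hA, hA, hc, hs]
  have hb := zon_bd na hγ hS
  have hb' : Bd (4 * S) (zon w fun z => r ^ 2 * γ (r ^ 2 * z)) := by
    refine zon_bd nw (by fun_prop) fun z hz => ?_
    rw [abs_mul, abs_of_nonneg (sq_nonneg r)]
    have h := hS (r ^ 2 * z) ⟨mul_nonneg (sq_nonneg r) hz.1,
      mul_le_one₀ hr1 hz.1 hz.2⟩
    exact (mul_le_of_le_one_left (abs_nonneg _) hr1).trans h
  have hR : 0 ≤ 4 * S := by positivity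
  have hBs := (nrm_nn (E := E) hR).sublin
  have hnrm : (nrm : E → ℝ) ∘ A = nrm := by
    ext x; exact inner_isometry_norm hA x
  have hD : ∀ g, Sublin g → D (w - p • a) m g = (r⁻¹ : ℝ) * D a m (g ∘ A) := fun g hg => by
    have e : w - p • a = r⁻¹ • A a := by
      rw [Aa, hc, hs, smul_add, smul_smul, smul_smul, inv_mul_cancel₀ hr0.ne', one_smul,
        show r⁻¹ * -(p * r) = -p by field_simp]
      module
    rw [e, hm.D_smul_dir r⁻¹ (A a) g hg, abs_of_pos (inv_pos.2 hr0),
      (hcov l m hw).D_apply hA a hg]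
    simp
  rw [D_psi, Psi, zero_add, zero_add, hD _ hb.add, hD _ hBs, ← mul_sub]
  congr 1
  have e1 : (4 * S) • nrm ∘ A = (4 * S) • (nrm : E → ℝ) := by rw [hnrm]
  rw [show ((4 * S) • nrm) ∘ A = (4 * S) • nrm ∘ A from rfl, e1,
    h2.inc_bd (hm.D a) hR hb' (Nn.zon nw (by fun_prop))]
  congr 1
  refine hm.D_congr (hb.add.comp A) hb'.add fun x hx => ?_
  simp only [Function.comp, Pi.add_apply, Pi.smul_apply, nrm, inner_isometry_norm hA, zon, Zn,
    hinv, hx, ← prim2_mul]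
  rw [← prim2_abs, ← prim2_abs γ (r * _)]
  congr 3
  rw [mul_zero, zero_sub, neg_div, abs_neg, mul_div_assoc]

theorem inc_zon_pow [FiniteDimensional ℝ E] {J : E →L[ℝ] E} (hJ : IsCpx J) {l : ℤ}
    (hl : 3 ≤ |l|) {m : (E → ℝ) → ℂ} (hm : IsVal m) (hw : IsWt J l m)
    (h3 : ∀ u v w, Eqv (D u (D v (D w m))) 0) {a a' w : E} {ω ρ : ℝ} (na : ‖a‖ = 1)
    (na' : ‖a'‖ = 1) (nw : ‖w‖ = 1) (haw : inner ℝ a w = 0) (hw1 : w ≠ J a) (hw2 : w ≠ -J a)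
    (hwd : w = ω • J a + ρ • a') (o1 : inner ℝ a' a = 0) (o2 : inner ℝ a' (J a) = 0) (j : ℕ) :
    Inc (D a m) (zon w fun z => z ^ (j + 1)) = 0 := by
  have hdm := hm.D a
  have h2 : SegInv2 (D a m) := fun v u => h3 u v a
  obtain ⟨C, hC0, hC⟩ := h2.inc_le hdm
  set I := Inc (D a m) (zon w fun z => z ^ (j + 1)) with hI
  set c : ℝ := (1 / 2) ^ (2 * j + 3) with hc
  have hcpos : 0 < c := by positivity
  set r : ℝ → ℝ := fun p => (Real.sqrt (1 + p ^ 2))⁻¹ with hrdef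
  have hq : ∀ p : ℝ, 0 < Real.sqrt (1 + p ^ 2) := fun p => Real.sqrt_pos.2 (by positivity)
  have hr0 : ∀ p, 0 < r p := fun p => inv_pos.2 (hq p)
  have hr1 : ∀ p, r p ≤ 1 := fun p => inv_le_one_of_one_le₀
    (Real.one_le_sqrt.2 (by nlinarith [sq_nonneg p]))
  have hrc : Continuous r := by
    refine Continuous.inv₀ (by fun_prop) fun p => (hq p).ne'
  have main : ∀ τ : ℝ, 0 < τ → τ ≤ 1 → ∀ ε : ℝ, 0 < ε → ‖I‖ * c ≤ ε + 8 * C * τ := by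
    intro τ hτ hτ1 ε hε
    set T : ℝ := τ⁻¹ with hTdef
    have hTτ : T * τ = 1 := inv_mul_cancel₀ hτ.ne'
    have hT1 : 1 ≤ T := one_le_inv_iff₀.2 ⟨hτ, hτ1⟩
    set γ : ℝ → ℝ := fun z => z ^ j * max (z - τ ^ 2) 0 with hγdef
    have hγ : Continuous γ := by fun_prop
    have hS : ∀ z ∈ Set.Icc (0 : ℝ) 1, |γ z| ≤ 1 := fun z hz => by
      rw [hγdef, abs_mul, abs_of_nonneg (pow_nonneg hz.1 j),
        abs_of_nonneg (le_max_right _ _)]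
      exact mul_le_one₀ (pow_le_one₀ hz.1 hz.2) (le_max_right _ _)
        (max_le (by nlinarith [hz.2, sq_nonneg τ]) zero_le_one)
    have hb := zon_bd na hγ hS
    have hR : (0 : ℝ) ≤ 4 * 1 := by norm_num
    have hBs := (nrm_nn (E := E) hR).sublin
    have hn := Nn.zon na hγ
    have hΨ := hm.psi hBs hb.add
    have hΨ2 := SegInv2.psi hm h3 hBs hb.add hn
    have hlens := psi_lens hJ hl hm hw h3 na' nw hwd o1 o2 hR hτ hTτ
      (γ := γ) (fun z hz => mul_nonneg (pow_nonneg hz j) (le_max_right _ _))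
      (fun z hz => by rw [hγdef]; simp [max_eq_right (sub_nonpos.2 hz)]) hb hn
    obtain ⟨δ', hδ', H⟩ := hΨ.cont _ (lens_zonoid a w T).sublin ε hε
    have huc := isCompact_Icc.uniformContinuousOn_of_continuous (s := Set.Icc (-T) T)
      (f := fun p => r p ^ (2 * j + 3)) (by fun_prop)
    rw [Metric.uniformContinuousOn_iff] at huc
    obtain ⟨δ₂, hδ₂, H₂⟩ := huc (c / (2 * T)) (by positivity)
    have hδ : 0 < min δ₂ (δ' / (2 * T)) := lt_min hδ₂ (by positivity)
    obtain ⟨s, ww, hs, hww, hsum, hquad⟩ := exists_quadrature (G := ℝ) volume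
      (isCompact_Icc (a := -T) (b := T)) (by simp) hδ
    have hvol : volume.real (Set.Icc (-T) T) = 2 * T := by
      rw [Measure.real, Real.volume_Icc, ENNReal.toReal_ofReal (by linarith)]; ring
    rw [hvol] at hquad hsum
    have hz : ∀ p ∈ s, Zonoid (seg (w - p • a)) := fun p _ => (Zon0.seg _).zonoid
    have e1 := hΨ2.sum hΨ s ww (fun p => seg (w - p • a)) (fun p _ => hww p) hz
    have hG : ∀ p, Psi m ((4 * 1 : ℝ) • nrm) (zon a γ) (seg (w - p • a))
        - Psi m ((4 * 1 : ℝ) • nrm) (zon a γ) 0 =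
        ((r p)⁻¹ : ℝ) * Inc (D a m) (zon w fun z => r p ^ 2 * γ (r p ^ 2 * z)) := fun p => by
      rw [← D_psi_rot hJ hm hw h2 na nw haw hw1 hw2 hγ hS p rfl, D, zero_add]
    have hG' : ∀ p, ‖((r p)⁻¹ : ℝ) * Inc (D a m) (zon w fun z => r p ^ 2 * γ (r p ^ 2 * z))
        - ((r p ^ (2 * j + 3) : ℝ) : ℂ) * I‖ ≤ 4 * C * τ ^ 2 := fun p => by
      set ρ' := r p with hρ'
      have p0 : 0 < ρ' := hr0 p
      have p1 : ρ' ≤ 1 := hr1 p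
      set g : ℝ → ℝ := fun z => ρ' ^ 2 * γ (ρ' ^ 2 * z) with hg
      set g' : ℝ → ℝ := fun z => z ^ (j + 1) with hg'
      have cg : Continuous g := by fun_prop
      have cg' : Continuous g' := by fun_prop
      have hd : ∀ z ∈ Set.Icc (0 : ℝ) 1, |(g + (-ρ' ^ (2 * j + 4)) • g') z| ≤ ρ' ^ 2 * τ ^ 2 := by
        intro z hz
        set y := ρ' ^ 2 * z with hy
        have y0 : 0 ≤ y := mul_nonneg (sq_nonneg _) hz.1
        have y1 : y ≤ 1 := mul_le_one₀ (pow_le_one₀ p0.le p1) hz.1 hz.2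
        have : (g + (-ρ' ^ (2 * j + 4)) • g') z = ρ' ^ 2 * (y ^ j * (max (y - τ ^ 2) 0 - y)) := by
          simp only [hg, hg', hγdef, Pi.add_apply, Pi.smul_apply, smul_eq_mul, ← hy]
          have : ρ' ^ (2 * j + 4) * z ^ (j + 1) = ρ' ^ 2 * (y ^ j * y) := by
            rw [hy]; ring
          linear_combination -this
        rw [this, abs_mul, abs_mul, abs_of_nonneg (sq_nonneg ρ'), abs_of_nonneg (pow_nonneg y0 j)]
        refine mul_le_mul_of_nonneg_left ?_ (sq_nonneg _)
        refine (mul_le_of_le_one_left (abs_nonneg _) (pow_le_one₀ y0 y1)).trans ?_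
        rw [abs_le]
        constructor
        · linarith [le_max_left (y - τ ^ 2) 0]
        · rcases le_total (y - τ ^ 2) 0 with h | h
          · rw [max_eq_right h]; nlinarith
          · rw [max_eq_left h]; nlinarith
      have cgg : Continuous (g + (-ρ' ^ (2 * j + 4)) • g') := cg.add (cg'.const_smul _)
      have hbd := zon_bd nw cgg hd
      have hle := hC _ _ (by positivity) hbd (Nn.zon nw cgg)
      have P1 : Pert (zon w g) := ⟨⟨_, zon_bd nw cg (S := 1) fun z hz => by
        rw [hg, abs_mul, abs_of_nonneg (sq_nonneg ρ')]
        exact mul_le_one₀ (pow_le_one₀ p0.le p1) (abs_nonneg _)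
          (hS _ ⟨mul_nonneg (sq_nonneg _) hz.1,
            mul_le_one₀ (pow_le_one₀ p0.le p1) hz.1 hz.2⟩)⟩, Nn.zon nw cg⟩
      have P2 : Pert (zon w g') := ⟨⟨_, zon_bd nw cg' (S := 1) fun z hz => by
        rw [hg', abs_of_nonneg (pow_nonneg hz.1 _)]
        exact pow_le_one₀ hz.1 hz.2⟩, Nn.zon nw cg'⟩
      rw [zon_add w cg (cg'.const_smul _), zon_smul, h2.inc_add hdm P1 (P2.smul _),
        h2.inc_smul hdm P2, ← hI] at hle
      have : ((ρ'⁻¹ : ℝ) : ℂ) * Inc (D a m) (zon w g) - ((ρ' ^ (2 * j + 3) : ℝ) : ℂ) * I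
          = ((ρ'⁻¹ : ℝ) : ℂ) * (Inc (D a m) (zon w g) + ((-ρ' ^ (2 * j + 4) : ℝ) : ℂ) * I) := by
        have h : ((ρ'⁻¹ : ℝ) : ℂ) * ((ρ' ^ (2 * j + 4) : ℝ) : ℂ) = ((ρ' ^ (2 * j + 3) : ℝ) : ℂ) := by
          rw [← Complex.ofReal_mul]; congr 1; field_simp; ring
        rw [Complex.ofReal_neg]
        linear_combination I * h
      rw [this, norm_mul, Complex.norm_real, Real.norm_of_nonneg (inv_pos.2 p0).le]
      calc ρ'⁻¹ * _ ≤ ρ'⁻¹ * (C * (4 * (ρ' ^ 2 * τ ^ 2))) :=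
            mul_le_mul_of_nonneg_left hle (inv_pos.2 p0).le
        _ = ρ' * (4 * C * τ ^ 2) := by field_simp
        _ ≤ 4 * C * τ ^ 2 := mul_le_of_le_one_left (by positivity) p1
    simp_rw [hG] at e1
    have e2 : ‖∑ p ∈ s, (ww p : ℂ) *
        (((r p)⁻¹ : ℝ) * Inc (D a m) (zon w fun z => r p ^ 2 * γ (r p ^ 2 * z)))‖ ≤ ε := by
      rw [← e1, ← hlens]
      refine H _ (Zonoid.sum s _ fun p hp => (hz p hp).const_smul (hww p)).sublin fun x => ?_
      have := hquad (fun p => |inner ℝ (w - p • a) x|) (min δ₂ (δ' / (2 * T)) * ‖x‖)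
        (Continuous.integrableOn_Icc (by fun_prop)) fun p _ p' _ hpp => by
          rw [Real.norm_eq_abs]
          refine (abs_abs_sub_abs_le _ _).trans ?_
          rw [← inner_sub_left]
          refine (abs_real_inner_le_norm _ _).trans
            (mul_le_mul_of_nonneg_right ?_ (norm_nonneg x))
          rw [show w - p • a - (w - p' • a) = (p' - p) • a by module, norm_smul, na, mul_one,
            Real.norm_eq_abs, abs_sub_comm, ← Real.dist_eq]
          exact hpp.le
      rw [abs_sub_comm]
      simp only [Finset.sum_apply, Pi.smul_apply]
      refine (this.trans (le_of_eq_of_le (mul_assoc _ _ _) ?_))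
      rw [mul_comm ‖x‖, ← mul_assoc]
      refine mul_le_mul_of_nonneg_right ?_ (norm_nonneg x)
      calc _ ≤ δ' / (2 * T) * (2 * T) :=
            mul_le_mul_of_nonneg_right (min_le_right _ _) (by linarith)
        _ = δ' := by field_simp
    have e3 : ‖∑ p ∈ s, (ww p : ℂ) *
        (((r p)⁻¹ : ℝ) * Inc (D a m) (zon w fun z => r p ^ 2 * γ (r p ^ 2 * z)))
        - ((∑ p ∈ s, ww p * r p ^ (2 * j + 3) : ℝ) : ℂ) * I‖ ≤ 8 * C * τ := by
      rw [Complex.ofReal_sum, Finset.sum_mul, ← Finset.sum_sub_distrib]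
      refine (norm_sum_le _ _).trans ?_
      calc _ ≤ ∑ p ∈ s, ww p * (4 * C * τ ^ 2) := Finset.sum_le_sum fun p _ => by
            rw [Complex.ofReal_mul, mul_assoc, ← mul_sub, norm_mul, Complex.norm_real,
              Real.norm_of_nonneg (hww p)]
            exact mul_le_mul_of_nonneg_left (hG' p) (hww p)
        _ = 8 * C * τ := by
            rw [← Finset.sum_mul, hsum]
            linear_combination 8 * C * τ * hTτ
    have e4 : c ≤ ∑ p ∈ s, ww p * r p ^ (2 * j + 3) := by
      have hi : IntegrableOn (fun p => r p ^ (2 * j + 3)) (Set.Icc (-T) T) :=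
        Continuous.integrableOn_Icc (by fun_prop)
      have q1 := hquad (fun p => r p ^ (2 * j + 3)) (c / (2 * T)) hi
        fun p hp p' hp' hpp => by
          rw [← dist_eq_norm]
          exact (H₂ p hp p' hp' (hpp.trans_le (min_le_left _ _))).le
      rw [div_mul_cancel₀ _ (by positivity), Real.norm_eq_abs] at q1
      have q2 : ∫ p in Set.Icc (-1 : ℝ) 1, r p ^ (2 * j + 3) ≤
          ∫ p in Set.Icc (-T) T, r p ^ (2 * j + 3) :=
        setIntegral_mono_set hi (Filter.Eventually.of_forall fun p => (pow_pos (hr0 p) _).le)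
          (Set.Icc_subset_Icc (by linarith) hT1).eventuallyLE
      have q3 : 2 * c ≤ ∫ p in Set.Icc (-1 : ℝ) 1, r p ^ (2 * j + 3) := by
        have : ∫ p in Set.Icc (-1 : ℝ) 1, c = 2 * c := by
          simp [Measure.real, Real.volume_Icc]; norm_num
        rw [← this]
        refine setIntegral_mono_on (by simp) (Continuous.integrableOn_Icc (by fun_prop))
          measurableSet_Icc fun p hp => ?_
        refine pow_le_pow_left₀ (by norm_num) ?_ _
        rw [hrdef, one_div]
        refine inv_anti₀ (hq p) ?_
        rw [Real.sqrt_le_left (by norm_num)]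
        have : p ^ 2 ≤ 1 := by
          rw [sq_le_one_iff_abs_le_one]; exact abs_le.2 hp
        linarith
      have := (abs_le.1 q1).2
      simp only [smul_eq_mul] at this
      linarith
    have e5 : ‖((∑ p ∈ s, ww p * r p ^ (2 * j + 3) : ℝ) : ℂ) * I‖ ≤ ε + 8 * C * τ := by
      refine le_trans ?_ (add_le_add e2 e3)
      exact norm_le_norm_add_norm_sub _ _
    rw [norm_mul, Complex.norm_real, Real.norm_of_nonneg (hcpos.le.trans e4)] at e5
    rw [mul_comm]
    exact (mul_le_mul_of_nonneg_right e4 (norm_nonneg I)).trans e5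
  have hle : ‖I‖ * c ≤ 0 := by
    refine le_of_forall_pos_le_add fun ε hε => ?_
    set τ := min 1 (ε / 2 / (8 * C + 1)) with hτ
    have hτ0 : 0 < τ := lt_min one_pos (by positivity)
    refine (main τ hτ0 (min_le_left _ _) (ε / 2) (by positivity)).trans ?_
    have : τ * (8 * C + 1) ≤ ε / 2 := (le_div_iff₀ (by positivity)).1 (min_le_right _ _)
    nlinarith
  have : ‖I‖ ≤ 0 := by
    by_contra h
    push Not at h
    nlinarith [mul_pos h hcpos]
  exact norm_le_zero_iff.1 this

theorem pert_zon [FiniteDimensional ℝ E] {e : E} (he : ‖e‖ = 1) {γ : ℝ → ℝ}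
    (hγ : Continuous γ) : Pert (zon e γ) := by
  obtain ⟨S, hS⟩ := isCompact_Icc.exists_bound_of_continuousOn (s := Set.Icc (0 : ℝ) 1)
    hγ.continuousOn
  exact ⟨⟨_, zon_bd he hγ hS⟩, Nn.zon he hγ⟩

theorem zon_one (e : E) (x : E) : zon e (fun _ => 1) x = ‖x‖⁻¹ * inner ℝ e x ^ 2 / 2 := by
  rw [zon, Zn, prim2_one]
  rcases eq_or_ne ‖x‖ 0 with h | h
  · simp [h]
  · field_simp

theorem Cov.eq_zero {A : E →L[ℝ] E} {m : (E → ℝ) → ℂ} (h : Cov A (-1) m) {f : E → ℝ}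
    (hf : Sublin f) (hfA : f ∘ A = f) : m f = 0 := by
  have := h f hf
  rw [hfA] at this
  linear_combination this / 2

theorem IsWt.cov_neg_one {J : E →L[ℝ] E} {l : ℤ} (hl : l ≠ 0) {m : (E → ℝ) → ℂ}
    (hw : IsWt J l m) {u : E} (hu : ‖u‖ = 1) : Cov (rot J u (Real.pi / l)) (-1) m := by
  have := hw u hu (Real.pi / l)
  rwa [exp_pi_div hl] at this

theorem inc_zon_one [FiniteDimensional ℝ E] {J : E →L[ℝ] E} (hJ : IsCpx J) {l : ℤ}
    (hl : 3 ≤ |l|) {m : (E → ℝ) → ℂ} (hm : IsVal m) (hw : IsWt J l m)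
    (h3 : ∀ u v w, Eqv (D u (D v (D w m))) 0) {a a' w : E}
    (na' : ‖a'‖ = 1) (nw : ‖w‖ = 1)
    (o1 : inner ℝ a' a = 0) (o2 : inner ℝ a' (J a) = 0) :
    Inc (D a m) (zon w fun _ => 1) = 0 := by
  have hdm := hm.D a
  have h2 : SegInv2 (D a m) := fun v u => h3 u v a
  obtain ⟨N, hN⟩ : ∃ N : ℕ, (N : ℤ) = |l| + 3 := ⟨l.natAbs + 3, by simp⟩
  have hN0 : N ≠ 0 := by rintro rfl; simp at hN; omega
  set A : ℕ → E →L[ℝ] E := fun k => rot J a' (2 * Real.pi * k / N) with hA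
  have hAi : ∀ k x y, inner ℝ (A k x) (A k y) = inner ℝ x y := fun k => rot_inner hJ na' _
  have o3 : inner ℝ (J a') a = 0 := by rw [hJ.inner_left, o2, neg_zero]
  have hAa : ∀ k, A k a = a := fun k => rot_of_orth J _ o1 o3
  have hp : Pert (zon w fun _ => 1) := pert_zon nw continuous_const
  have h1 := h2.inc_sum hdm (Finset.range N) (fun k => Real.cos (l * (2 * Real.pi * k / N)))
    (fun k => zon w (fun _ => 1) ∘ A k) fun k _ => (hp.comp _ (hAi k)).1
  have h0 : ∑ k ∈ Finset.range N, Real.cos (l * (2 * Real.pi * k / N)) •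
      (zon w (fun _ => 1) ∘ A k) = 0 := by
    ext x
    simp only [Finset.sum_apply, Pi.smul_apply, Function.comp, zon_one, smul_eq_mul,
      inner_isometry_norm (hAi _), Pi.zero_apply]
    have hwA : ∀ k : ℕ, inner ℝ w (A k x)
        = (inner ℝ w x - inner ℝ w a' * inner ℝ a' x - inner ℝ w (J a') * inner ℝ (J a') x)
        + (inner ℝ w a' * inner ℝ a' x + inner ℝ w (J a') * inner ℝ (J a') x)
          * Real.cos (2 * Real.pi * k / N)
        + (inner ℝ w (J a') * inner ℝ a' x - inner ℝ w a' * inner ℝ (J a') x)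
          * Real.sin (2 * Real.pi * k / N) := fun k => by
      simp only [hA, rot_apply, inner_add_right, real_inner_smul_right]
      ring
    have s2 := sum_cos_mul_sq hl hN
      (inner ℝ w x - inner ℝ w a' * inner ℝ a' x - inner ℝ w (J a') * inner ℝ (J a') x)
      (inner ℝ w a' * inner ℝ a' x + inner ℝ w (J a') * inner ℝ (J a') x)
      (inner ℝ w (J a') * inner ℝ a' x - inner ℝ w a' * inner ℝ (J a') x)
    simp_rw [← hwA] at s2
    have : ∀ k : ℕ, Real.cos (l * (2 * Real.pi * k / N)) *
        (‖x‖⁻¹ * inner ℝ w (A k x) ^ 2 / 2) = ‖x‖⁻¹ / 2 *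
        (Real.cos (l * (2 * Real.pi * k / N)) * inner ℝ w (A k x) ^ 2) := fun k => by ring
    simp_rw [this]
    rw [← Finset.mul_sum, s2, mul_zero]
  rw [h0, h2.inc_zero hdm] at h1
  have hcov : ∀ k : ℕ, Cov (A k) (Complex.exp (l * ((2 * Real.pi * k / N : ℝ) : ℂ) * Complex.I))
      (D a m) := fun k => (hw a' na' _).D (hAi k) (hAa k)
  simp_rw [fun k => h2.inc_comp hdm (hAi k) (hcov k) hp, ← mul_assoc] at h1
  rw [← Finset.sum_mul] at h1
  exact (mul_eq_zero.1 h1.symm).resolve_left (sum_cos_mul_exp_ne hN0)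

theorem D_D_zero_of_decomp [FiniteDimensional ℝ E] {J : E →L[ℝ] E} (hJ : IsCpx J) {l : ℤ}
    (hl : 3 ≤ |l|) {m : (E → ℝ) → ℂ} (hm : IsVal m) (hw : IsWt J l m)
    (h3 : ∀ u v w, Eqv (D u (D v (D w m))) 0) {a a' w : E} {ω ρ : ℝ} (na : ‖a‖ = 1)
    (na' : ‖a'‖ = 1) (nw : ‖w‖ = 1) (haw : inner ℝ a w = 0) (hw1 : w ≠ J a) (hw2 : w ≠ -J a)
    (hwd : w = ω • J a + ρ • a') (o1 : inner ℝ a' a = 0) (o2 : inner ℝ a' (J a) = 0) :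
    D w (D a m) 0 = 0 := by
  have hdm := hm.D a
  have h2 : SegInv2 (D a m) := fun v u => h3 u v a
  have hl0 : l ≠ 0 := by rintro rfl; simp at hl
  have hpow : ∀ k : ℕ, Inc (D a m) (zon w fun z => z ^ k) = 0 := fun k => by
    cases k with
    | zero => simpa using inc_zon_one hJ hl hm hw h3 na' nw o1 o2
    | succ j => exact inc_zon_pow hJ hl hm hw h3 na na' nw haw hw1 hw2 hwd o1 o2 j
  have hpoly : ∀ q : Polynomial ℝ, Inc (D a m) (zon w fun z => q.eval z) = 0 := fun q => by
    induction q using Polynomial.induction_on' with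
    | add p q hp hq =>
      have : (fun z => (p + q).eval z) = (fun z => p.eval z) + fun z => q.eval z := by
        ext z; simp
      rw [this, zon_add w p.continuous q.continuous, h2.inc_add hdm (pert_zon nw p.continuous)
        (pert_zon nw q.continuous), hp, hq, add_zero]
    | monomial k c =>
      have : (fun z => (Polynomial.monomial k c).eval z) = c • fun z : ℝ => z ^ k := by
        ext z; simp
      rw [this, zon_smul, h2.inc_smul hdm (pert_zon nw (continuous_pow k)), hpow, mul_zero]
  obtain ⟨C, hC0, hC⟩ := h2.inc_le hdm
  have hcont : ∀ γ : ℝ → ℝ, Continuous γ → Inc (D a m) (zon w γ) = 0 := fun γ hγ => by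
    have : ‖Inc (D a m) (zon w γ)‖ ≤ 0 := by
      refine le_of_forall_pos_le_add fun ε hε => ?_
      obtain ⟨q, hq⟩ := exists_polynomial_near_of_continuousOn 0 1 γ hγ.continuousOn
        (ε / (4 * C + 1)) (by positivity)
      have hc' : Continuous (γ - fun z => q.eval z) := hγ.sub q.continuous
      have hbd := zon_bd nw hc' (S := ε / (4 * C + 1)) fun z hz => by
        have := (hq z hz).le
        rw [abs_sub_comm] at this
        exact this
      have h5 := hC _ _ (by positivity) hbd (Nn.zon nw hc')
      have h6 : zon w γ = zon w (γ - fun z => q.eval z) + zon w fun z => q.eval z := by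
        rw [← zon_add w hc' q.continuous, sub_add_cancel]
      rw [h6, h2.inc_add hdm (pert_zon nw hc') (pert_zon nw q.continuous), hpoly, add_zero,
        zero_add]
      refine h5.trans ?_
      rw [show C * (4 * (ε / (4 * C + 1))) = ε * (4 * C / (4 * C + 1)) by ring]
      exact mul_le_of_le_one_right hε.le ((div_le_one (by positivity)).2 (by linarith))
    exact norm_le_zero_iff.1 this
  have hAi := rot_inner hJ na' (Real.pi / l)
  have o3 : inner ℝ (J a') a = 0 := by rw [hJ.inner_left, o2, neg_zero]
  have hcov : Cov (rot J a' (Real.pi / l)) (-1) (D a m) :=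
    (hw.cov_neg_one hl0 na').D hAi (rot_of_orth J _ o1 o3)
  have z0 : D a m 0 = 0 := hcov.eq_zero Sublin.zero rfl
  have z1 : D a m nrm = 0 := hcov.eq_zero Sublin.nrm (by
    ext x; exact inner_isometry_norm hAi x)
  rw [D, zero_add, z0, sub_zero]
  refine hdm.eq_of_approx (Sublin.seg w) fun ε hε => ?_
  set t : ℝ := (ε ^ 2)⁻¹ with ht
  have ht0 : 0 ≤ t := by positivity
  have hz := sqrt_ellipsoid nw ht0
  refine ⟨ε • Zn w (fun s => Real.sqrt (1 + t * s ^ 2)), hz.sublin.const_smul hε.le,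
    fun x => ?_, ?_⟩
  · simp only [Pi.smul_apply, smul_eq_mul, Zn, seg]
    rcases eq_or_ne x 0 with rfl | hx
    · simp
    have hx0 : 0 < ‖x‖ := norm_pos_iff.2 hx
    set u : ℝ := inner ℝ w x
    have e1 : ε * (‖x‖ * Real.sqrt (1 + t * (u / ‖x‖) ^ 2))
        = Real.sqrt ((ε * ‖x‖) ^ 2 + u ^ 2) := by
      rw [← mul_assoc, ← Real.sqrt_sq (show 0 ≤ ε * ‖x‖ by positivity),
        ← Real.sqrt_mul (by positivity), Real.sqrt_sq (by positivity)]
      congr 1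
      rw [ht]; field_simp
    have e2 : |u| = Real.sqrt (u ^ 2) := (Real.sqrt_sq_eq_abs u).symm
    rw [e1, abs_of_nonneg]
    · rw [sub_le_iff_le_add]
      refine Real.sqrt_le_iff.2 ⟨by positivity, ?_⟩
      rw [add_sq, sq_abs]
      have : 0 ≤ 2 * (ε * ‖x‖) * |u| := by positivity
      linarith
    · rw [e2, sub_nonneg]
      exact Real.sqrt_le_sqrt (by nlinarith [sq_nonneg (ε * ‖x‖)])
  · have hk : Continuous (t • prof 0 (3 / 2) t) := (prof_cont 0 (3 / 2) ht0).const_smul t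
    have k1 : D a m (Zn w (fun s => Real.sqrt (1 + t * s ^ 2))) = 0 := by
      have := h2.inc_eq hdm hz.sublin hz.nn Sublin.nrm Zonoid.norm.nn
        (e := zon w (t • prof 0 (3 / 2) t)) (by rw [ellipsoid_eq w ht0]; abel)
      rw [hcont _ hk, z1, sub_zero] at this
      exact this.symm
    have := h2.smul hdm hz.sublin hz.nn hε.le
    rw [z0, k1] at this
    simpa using this

theorem D_D_zero_of_orth [FiniteDimensional ℝ E] {J : E →L[ℝ] E} (hJ : IsCpx J) {l : ℤ}
    (hl : 3 ≤ |l|) {m : (E → ℝ) → ℂ} (hm : IsVal m) (hw : IsWt J l m)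
    (h3 : ∀ u v w, Eqv (D u (D v (D w m))) 0) {a w : E} (na : ‖a‖ = 1)
    (nw : ‖w‖ = 1) (haw : inner ℝ a w = 0) : D w (D a m) 0 = 0 := by
  have hl0 : l ≠ 0 := by rintro rfl; simp at hl
  have hJa := hw.D_D_J hJ hl0 hm na
  by_cases hw1 : w = J a
  · rw [hw1, D_comm]; exact hJa _ Sublin.zero
  by_cases hw2 : w = -J a
  · rw [hw2, D_neg, D_comm]; exact hJa _ Sublin.zero
  set ω : ℝ := inner ℝ (J a) w
  set b := w - ω • J a with hb
  have nJ : ‖J a‖ = 1 := by rw [hJ.norm_map, na]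
  have hb0 : b ≠ 0 := fun h => by
    have h' : w = ω • J a := sub_eq_zero.1 h
    have h1 := nw
    rw [h', norm_smul, nJ, mul_one, Real.norm_eq_abs] at h1
    rcases eq_or_eq_neg_of_abs_eq h1 with h1 | h1
    · rw [h1, one_smul] at h'; exact hw1 h'
    · rw [h1, neg_one_smul] at h'; exact hw2 h'
  have nb : ‖b‖ ≠ 0 := norm_ne_zero_iff.2 hb0
  refine D_D_zero_of_decomp hJ hl hm hw h3 (a' := ‖b‖⁻¹ • b) (ω := ω) (ρ := ‖b‖) na
    (by rw [norm_smul, norm_inv, norm_norm, inv_mul_cancel₀ nb]) nw haw hw1 hw2 ?_ ?_ ?_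
  · rw [smul_smul, mul_inv_cancel₀ nb, one_smul, hb]; abel
  · rw [real_inner_smul_left, hb, inner_sub_left, real_inner_smul_left, real_inner_comm, haw,
      hJ.inner_self]
    ring
  · rw [real_inner_smul_left, hb, inner_sub_left, real_inner_smul_left, real_inner_comm,
      real_inner_self_eq_norm_sq, nJ]
    ring

theorem D_D_zero [FiniteDimensional ℝ E] {J : E →L[ℝ] E} (hJ : IsCpx J) {l : ℤ}
    (hl : 3 ≤ |l|) {m : (E → ℝ) → ℂ} (hm : IsVal m) (hw : IsWt J l m)
    (h3 : ∀ u v w, Eqv (D u (D v (D w m))) 0) (u v : E) : D u (D v m) 0 = 0 := by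
  rcases eq_or_ne v 0 with rfl | hv
  · rw [D_zero_dir, D_zero]; rfl
  have nv : ‖v‖ ≠ 0 := norm_ne_zero_iff.2 hv
  set a := ‖v‖⁻¹ • v with ha
  have na : ‖a‖ = 1 := by rw [ha, norm_smul, norm_inv, norm_norm, inv_mul_cancel₀ nv]
  have hva : v = ‖v‖ • a := by rw [ha, smul_smul, mul_inv_cancel₀ nv, one_smul]
  set s := u - inner ℝ a u • a with hs
  have has : inner ℝ a s = 0 := by
    rw [hs, inner_sub_right, real_inner_smul_right, real_inner_self_eq_norm_sq, na]; ring
  have h1 : D u (D v m) 0 = D s (D v m) 0 := by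
    have := hm.D_add_span [v] (s := inner ℝ a u • a) (by
      rw [ha]
      exact Submodule.smul_mem _ _ (Submodule.smul_mem _ _ (Submodule.subset_span (by simp)))) s
    rw [hs, sub_add_cancel] at this
    exact this 0 Sublin.zero
  have h2 : Eqv (D v m) (((|‖v‖| : ℝ) : ℂ) • D a m) := by
    conv_lhs => rw [hva]
    exact hm.D_smul_dir _ _
  rw [h1, h2.D s 0 Sublin.zero, D_smul]
  have h4 : D s (D a m) 0 = 0 := by
    rcases eq_or_ne s 0 with h0 | h0
    · rw [h0, D_zero_dir]; rfl
    have ns : ‖s‖ ≠ 0 := norm_ne_zero_iff.2 h0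
    have e : s = ‖s‖ • (‖s‖⁻¹ • s) := by rw [smul_smul, mul_inv_cancel₀ ns, one_smul]
    rw [e, (hm.D a).D_smul_dir _ _ 0 Sublin.zero, Pi.smul_apply,
      D_D_zero_of_orth hJ hl hm hw h3 na
        (by rw [norm_smul, norm_inv, norm_norm, inv_mul_cancel₀ ns])
        (by rw [real_inner_smul_right, has, mul_zero]), smul_zero]
  rw [Pi.smul_apply, h4, smul_zero]

theorem IsWt.D_D_J' {J : E →L[ℝ] E} (hJ : IsCpx J) {l : ℤ} (hl : l ≠ 0) {m : (E → ℝ) → ℂ}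
    (hw : IsWt J l m) (hm : IsVal m) {a b : E} (ha : ‖a‖ = 1) (h : b = J a ∨ b = -J a) :
    Eqv (SUVal.D a (SUVal.D b m)) 0 := by
  have := hw.D_D_J hJ hl hm ha
  rcases h with rfl | rfl
  · exact this
  · rwa [D_neg]

theorem DL_zero_eqv {m : (E → ℝ) → ℂ} (h : Eqv m 0) (l : List E) : Eqv (DL l m) 0 := by
  have := h.DL l
  rwa [DL_zero] at this

theorem smul_eqv_zero {m : (E → ℝ) → ℂ} (h : Eqv m 0) (c : ℂ) : Eqv (c • m) 0 := by
  have := h.smul c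
  rwa [smul_zero] at this

theorem D_D_D_zero [FiniteDimensional ℝ E] (hE : Module.finrank ℝ E = 4) {J : E →L[ℝ] E}
    (hJ : IsCpx J) {l : ℤ} (hl : l ≠ 0) {m : (E → ℝ) → ℂ} (hm : IsVal m) (hw : IsWt J l m)
    (u v w : E) : Eqv (D u (D v (D w m))) 0 := by
  rcases hm.DL_canonical hJ (l := [u, v, w]) (by simp) with h | ⟨a, b, rs, c, na, nb, hab, hr, ho, h⟩
  · exact h
  refine Eqv.trans h (smul_eqv_zero ?_ c)
  by_cases hb : b = J a ∨ b = -J a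
  · exact DL_zero_eqv (hw.D_D_J' hJ hl hm na hb) rs
  push Not at hb
  obtain ⟨r, rfl⟩ : ∃ r, rs = [r] := List.length_eq_one_iff.1 (by simpa using hr)
  obtain ⟨r1, r2, r3, r4⟩ := ho r (by simp)
  have : r = 0 := eq_zero_of_orth4 hE hJ na nb hab hb.1 hb.2 r1 r2 r3 r4
  rw [this, DL, D_zero_dir]
  exact Eqv.refl _

theorem exp_two_pi (l : ℤ) :
    Complex.exp (l * (Real.pi : ℝ) * Complex.I) * Complex.exp (l * (Real.pi : ℝ) * Complex.I) = 1 := by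
  rw [← Complex.exp_add]
  have := Complex.exp_int_mul_two_pi_mul_I l
  rw [← this]; congr 1; ring

theorem exists_unit_orth_cpx [FiniteDimensional ℝ E] (hE : 2 < Module.finrank ℝ E) (J : E →L[ℝ] E)
    (v : E) : ∃ u : E, ‖u‖ = 1 ∧ inner ℝ v u = 0 ∧ inner ℝ (J v) u = 0 := by
  obtain ⟨u, hu, h⟩ := exists_unit_orth [v, J v] (by simpa using hE)
  exact ⟨u, hu, h v (by simp), h (J v) (by simp)⟩

theorem IsWt.cov_neg_id [FiniteDimensional ℝ E] (hE : Module.finrank ℝ E = 4) {J : E →L[ℝ] E}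
    (hJ : IsCpx J) {l : ℤ} {m : (E → ℝ) → ℂ} (hw : IsWt J l m) :
    Cov (-ContinuousLinearMap.id ℝ E) 1 m := by
  obtain ⟨u, hu, -⟩ := exists_unit_orth_cpx (E := E) (by omega) J 0
  obtain ⟨v, hv, h1, h2⟩ := exists_unit_orth_cpx (E := E) (by omega) J u
  have h := (hw u hu Real.pi).comp (hw v hv Real.pi)
  rw [exp_two_pi] at h
  have h3 : inner ℝ u (J v) = 0 := by
    have := hJ.inner_left u v; rw [h2] at this; linarith
  have h4 : inner ℝ (J u) (J v) = 0 := by rw [hJ.inner_map, h1]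
  have huu : inner ℝ u u = (1 : ℝ) := by rw [real_inner_self_eq_norm_sq, hu]; norm_num
  have hvv : inner ℝ v v = (1 : ℝ) := by rw [real_inner_self_eq_norm_sq, hv]; norm_num
  have hJuu : inner ℝ (J u) (J u) = (1 : ℝ) := by rw [hJ.inner_map, huu]
  have hJvv : inner ℝ (J v) (J v) = (1 : ℝ) := by rw [hJ.inner_map, hvv]
  have nz : ∀ {x : E}, inner ℝ x x = (1 : ℝ) → x ≠ 0 := fun h h0 => by simp [h0] at h
  have e : (rot J u Real.pi).comp (rot J v Real.pi) = -ContinuousLinearMap.id ℝ E := by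
    ext x
    rw [← sub_eq_zero]
    have c1 := real_inner_comm u v
    have c2 := real_inner_comm (J u) v
    have c3 := real_inner_comm u (J v)
    have c4 := real_inner_comm (J u) (J v)
    rw [h1] at c1; rw [h2] at c2; rw [h3] at c3; rw [h4] at c4
    refine eq_zero_of_orth_four hE (nz huu) (nz hJuu) (nz hvv) (nz hJvv) (hJ.inner_self' u) h1 h3
      h2 h4 (hJ.inner_self' v) ?_ ?_ ?_ ?_ <;>
    · simp only [ContinuousLinearMap.comp_apply, rot_apply, Real.cos_pi, Real.sin_pi,
        inner_sub_right, inner_add_right, real_inner_smul_right, huu, hvv, hJuu, hJvv, h1, h2, h3,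
        h4, hJ.inner_self, hJ.inner_self', c1, c2, c3, c4, _root_.neg_apply,
        ContinuousLinearMap.id_apply, inner_neg_right]
      ring
  rwa [e] at h

/-- There is no nonzero valuation of weight `l`, `3 ≤ |l|`, in complex dimension two. -/
theorem IsWt.eq_zero_of_finrank_four [FiniteDimensional ℝ E] (hE : Module.finrank ℝ E = 4)
    {J : E →L[ℝ] E} (hJ : IsCpx J) {l : ℤ} (hl : 3 ≤ |l|) {m : (E → ℝ) → ℂ} (hm : IsVal m)
    (hw : IsWt J l m) : Eqv m 0 := by
  have hl0 : l ≠ 0 := by rintro rfl; simp at hl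
  have he := hw.cov_neg_id hE hJ
  have h3 := D_D_D_zero hE hJ hl0 hm hw
  have k2 : ∀ u v, Eqv (SUVal.D u (SUVal.D v m)) 0 := fun u v f hf => by
    rw [SegInv.eq_zero_of_even (fun w => h3 w u v) ((hm.D v).D u) ((he.neg_D v).neg_D u) hf,
      D_D_zero hJ hl hm hw h3]
    rfl
  have k1 : ∀ v, Eqv (SUVal.D v m) 0 := fun v f hf => by
    rw [SegInv.eq_zero_of_even (fun w => k2 w v) (hm.D v) (he.neg_D v) hf]
    obtain ⟨u, hu, h1, h2⟩ := exists_unit_orth_cpx (E := E) (by omega) J v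
    have hvu : inner ℝ u v = 0 := by rw [real_inner_comm, h1]
    have hJuv : inner ℝ (J u) v = 0 := by
      rw [hJ.inner_left, real_inner_comm, h2, neg_zero]
    exact ((hw.cov_neg_one hl0 hu).D (rot_inner hJ hu _)
      (rot_of_orth J _ hvu hJuv)).eq_zero Sublin.zero (by ext; simp)
  intro f hf
  rw [SegInv.eq_zero_of_even k1 hm he hf]
  obtain ⟨u, hu, -⟩ := exists_unit_orth_cpx (E := E) (by omega) J 0
  exact (hw.cov_neg_one hl0 hu).eq_zero Sublin.zero (by ext; simp)

theorem rot_adjoint (J : E →L[ℝ] E) (u : E) (θ : ℝ) (x y : E) :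
    inner ℝ (rot J u (-θ) y) x = inner ℝ y (rot J u θ x) := by
  simp only [rot_apply, inner_add_left, inner_add_right, real_inner_smul_left,
    real_inner_smul_right, Real.cos_neg, Real.sin_neg, real_inner_comm u y,
    real_inner_comm (J u) y]
  ring

/-- Two orthonormal vectors that are not complex multiples of each other, completed to an
orthonormal frame of their complex span, together with the isoclinic rotations rotating both
pairs. -/
theorem exists_frame {J : E →L[ℝ] E} (hJ : IsCpx J) {a b : E} (ha : ‖a‖ = 1) (hb : ‖b‖ = 1)
    (hab : inner ℝ a b = 0) (h1 : b ≠ J a) (h2 : b ≠ -J a) :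
    ∃ (e e' : E) (A : ℝ → E →L[ℝ] E), Orthonormal ℝ ![a, b, e, e'] ∧
      (∃ c s : ℝ, s ≠ 0 ∧ J a = c • b + s • e' ∧ J b = -c • a - s • e ∧ J e = s • b - c • e' ∧
        J e' = -s • a + c • e) ∧
      (∀ θ x y, inner ℝ (A θ x) (A θ y) = inner ℝ x y) ∧
      (∀ θ x y, inner ℝ (A (-θ) y) x = inner ℝ y (A θ x)) ∧
      (∀ θ, A θ a = Real.cos θ • a + Real.sin θ • b) ∧
      (∀ θ, A θ b = -Real.sin θ • a + Real.cos θ • b) ∧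
      (∀ θ, A θ e = Real.cos θ • e + Real.sin θ • e') ∧
      (∀ θ, A θ e' = -Real.sin θ • e + Real.cos θ • e') ∧
      (∀ θ x, inner ℝ a x = 0 → inner ℝ b x = 0 → inner ℝ e x = 0 → inner ℝ e' x = 0 →
          A θ x = x) ∧
      ∀ θ (l : ℤ) (m : (E → ℝ) → ℂ), IsWt J l m → Cov (A θ) 1 m := by
  have hu0 : a - J b ≠ 0 := fun h => h2 (by
    rw [sub_eq_zero.1 h, hJ.sq, neg_neg])
  have hu0' : a + J b ≠ 0 := fun h => h1 (by
    rw [eq_neg_of_add_eq_zero_left h, map_neg, hJ.sq, neg_neg])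
  set r := ‖a - J b‖ with hrd
  set r' := ‖a + J b‖ with hrd'
  have hr : r ≠ 0 := norm_ne_zero_iff.2 hu0
  have hr' : r' ≠ 0 := norm_ne_zero_iff.2 hu0'
  set u := r⁻¹ • (a - J b) with hu
  set u' := r'⁻¹ • (a + J b) with hu'
  have hun : ‖u‖ = 1 := by rw [hu, norm_smul, norm_inv, Real.norm_eq_abs, abs_norm, inv_mul_cancel₀ hr]
  have hun' : ‖u'‖ = 1 := by
    rw [hu', norm_smul, norm_inv, Real.norm_eq_abs, abs_norm, inv_mul_cancel₀ hr']
  have hJu : J u = r⁻¹ • (J a + b) := by rw [hu, map_smul, map_sub, hJ.sq, sub_neg_eq_add]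
  have hJu' : J u' = r'⁻¹ • (J a - b) := by rw [hu', map_smul, map_add, hJ.sq, sub_eq_add_neg]
  have haa : inner ℝ a a = (1 : ℝ) := by rw [real_inner_self_eq_norm_sq, ha]; norm_num
  have hbb : inner ℝ b b = (1 : ℝ) := by rw [real_inner_self_eq_norm_sq, hb]; norm_num
  have hba : inner ℝ b a = (0 : ℝ) := by rw [real_inner_comm, hab]
  have o1 : inner ℝ u u' = (0 : ℝ) := by
    simp only [hu, hu', real_inner_smul_left, real_inner_smul_right, inner_sub_left,
      inner_add_right, hJ.inner_map, haa, hbb, hJ.inner_left]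
    rw [real_inner_comm (J a) b, hJ.inner_left]
    ring
  have o2 : inner ℝ (J u) u' = (0 : ℝ) := by
    simp only [hJu, hu', real_inner_smul_left, real_inner_smul_right, inner_add_left,
      inner_add_right, hJ.inner_map, hJ.inner_self, hJ.inner_self', hab, hba]
    ring
  have o3 : inner ℝ u (J u') = (0 : ℝ) := by
    rw [← neg_eq_zero, ← hJ.inner_left, o2]
  have o4 : inner ℝ (J u) (J u') = (0 : ℝ) := by rw [hJ.inner_map, o1]
  have ea : a = (r / 2) • u + (r' / 2) • u' := by
    rw [hu, hu', smul_smul, smul_smul, show r / 2 * r⁻¹ = 1 / 2 by field_simp,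
      show r' / 2 * r'⁻¹ = 1 / 2 by field_simp]
    module
  have eb : b = (r / 2) • J u - (r' / 2) • J u' := by
    rw [hJu, hJu', smul_smul, smul_smul, show r / 2 * r⁻¹ = 1 / 2 by field_simp,
      show r' / 2 * r'⁻¹ = 1 / 2 by field_simp]
    module
  have hrr : (r / 2) ^ 2 + (r' / 2) ^ 2 = 1 := by
    have h1 := norm_sub_sq_real a (J b)
    have h2 := norm_add_sq_real a (J b)
    rw [← hrd, hJ.norm_map, ha, hb] at h1
    rw [← hrd', hJ.norm_map, ha, hb] at h2
    nlinarith
  clear_value u u' r r'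
  set α := r / 2
  set β := r' / 2
  have q1 : ∀ θ, rot J u θ u' = u' := fun θ => rot_of_orth J _ o1 o2
  have q2 : ∀ θ, rot J u θ (J u') = J u' := fun θ => rot_of_orth J _ o3 o4
  have o1' : inner ℝ u' u = (0 : ℝ) := by rw [real_inner_comm, o1]
  have o2' : inner ℝ u' (J u) = (0 : ℝ) := by rw [real_inner_comm, o2]
  have o3' : inner ℝ (J u') u = (0 : ℝ) := by rw [real_inner_comm, o3]
  have o4' : inner ℝ (J u') (J u) = (0 : ℝ) := by rw [real_inner_comm, o4]
  have q3 : ∀ θ, rot J u' θ u = u := fun θ => rot_of_orth J _ o1' o3'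
  have q4 : ∀ θ, rot J u' θ (J u) = J u := fun θ => rot_of_orth J _ o2' o4'
  have huu : inner ℝ u u = (1 : ℝ) := by rw [real_inner_self_eq_norm_sq, hun]; norm_num
  have huu' : inner ℝ u' u' = (1 : ℝ) := by rw [real_inner_self_eq_norm_sq, hun']; norm_num
  have hjj : inner ℝ (J u) (J u) = (1 : ℝ) := by rw [hJ.inner_map, huu]
  have hjj' : inner ℝ (J u') (J u') = (1 : ℝ) := by rw [hJ.inner_map, huu']
  refine ⟨β • u - α • u', β • J u + α • J u', fun θ => (rot J u θ).comp (rot J u' (-θ)), ?_,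
    ⟨α ^ 2 - β ^ 2, 2 * α * β, by simp [α, β, hr, hr'], ?_, ?_, ?_, ?_⟩, fun θ x y => ?_, fun θ x y => ?_, fun θ => ?_,
    fun θ => ?_, fun θ => ?_, fun θ => ?_, fun θ x x1 x2 x3 x4 => ?_, fun θ l m hw => ?_⟩
  · have z1 : inner ℝ a (β • u - α • u') = 0 := by
      rw [ea]
      simp only [inner_add_left, inner_sub_right, real_inner_smul_left, real_inner_smul_right,
        o1, o1', huu, huu']
      ring
    have z2 : inner ℝ a (β • J u + α • J u') = 0 := by
      rw [ea]
      simp only [inner_add_left, inner_add_right, real_inner_smul_left, real_inner_smul_right,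
        o3, o2', hJ.inner_self']
      ring
    have z3 : inner ℝ b (β • u - α • u') = 0 := by
      rw [eb]
      simp only [inner_sub_left, inner_sub_right, real_inner_smul_left, real_inner_smul_right,
        o2, o3', hJ.inner_self]
      ring
    have z4 : inner ℝ b (β • J u + α • J u') = 0 := by
      rw [eb]
      simp only [inner_sub_left, inner_add_right, real_inner_smul_left, real_inner_smul_right,
        o4, o4', hjj, hjj']
      ring
    have z5 : inner ℝ (β • u - α • u') (β • J u + α • J u') = 0 := by
      simp only [inner_sub_left, inner_add_right, real_inner_smul_left, real_inner_smul_right,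
        o3, o2', hJ.inner_self']
      ring
    have z6 : inner ℝ (β • u - α • u') (β • u - α • u') = (1 : ℝ) := by
      simp only [inner_sub_left, inner_sub_right, real_inner_smul_left, real_inner_smul_right,
        o1, o1', huu, huu']
      linear_combination hrr
    have z7 : inner ℝ (β • J u + α • J u') (β • J u + α • J u') = (1 : ℝ) := by
      simp only [inner_add_left, inner_add_right, real_inner_smul_left, real_inner_smul_right,
        o4, o4', hjj, hjj']
      linear_combination hrr
    set e := β • u - α • u'
    set e' := β • J u + α • J u'
    rw [orthonormal_iff_ite]
    intro i j
    fin_cases i <;> fin_cases j <;> simp [hab, hba, z1, z2, z3, z4, z5,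
      real_inner_comm a e, real_inner_comm a e', real_inner_comm b e, real_inner_comm b e',
      real_inner_comm e e', ha, hb]
    all_goals
      first
        | (rw [← sq_eq_sq₀ (norm_nonneg _) zero_le_one, ← real_inner_self_eq_norm_sq]
           first | rw [z6] | rw [z7]
           norm_num)
  · conv_lhs => rw [ea]
    rw [eb, map_add, map_smul, map_smul]
    match_scalars
    · linear_combination (-α) * hrr
    · linear_combination (-β) * hrr
  · conv_lhs => rw [eb]
    rw [ea, map_sub, map_smul, map_smul, hJ.sq, hJ.sq]
    match_scalars
    · linear_combination α * hrr
    · linear_combination (-β) * hrr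
  · rw [eb, map_sub, map_smul, map_smul]
    match_scalars
    · linear_combination (-β) * hrr
    · linear_combination α * hrr
  · rw [ea, map_add, map_smul, map_smul, hJ.sq, hJ.sq]
    match_scalars
    · linear_combination β * hrr
    · linear_combination α * hrr
  · simp only [ContinuousLinearMap.comp_apply, rot_inner hJ hun, rot_inner hJ hun']
  · simp only [ContinuousLinearMap.comp_apply]
    have hcomm : ∀ z, rot J u θ (rot J u' (-θ) z) = rot J u' (-θ) (rot J u θ z) := fun z => by
      simp only [rot_apply J u θ, rot_apply J u' (-θ), inner_add_right, real_inner_smul_right,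
        o1, o2, o3, o4, o1', o2', o3', o4']
      module
    rw [rot_adjoint, rot_adjoint, hcomm]
  · conv_lhs => rw [ea]
    conv_rhs => rw [ea, eb]
    simp only [ContinuousLinearMap.comp_apply, map_add, map_smul, q3, rot_self hJ hun',
      rot_self hJ hun, q1, q2, Real.cos_neg, Real.sin_neg]
    module
  · conv_lhs => rw [eb]
    conv_rhs => rw [ea, eb]
    simp only [ContinuousLinearMap.comp_apply, map_add, map_sub, map_smul, q4, rot_J_self hJ hun',
      rot_J_self hJ hun, q1, q2, Real.cos_neg, Real.sin_neg]
    module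
  · simp only [ContinuousLinearMap.comp_apply, map_add, map_sub, map_smul, q3, rot_self hJ hun',
      rot_self hJ hun, q1, q2, Real.cos_neg, Real.sin_neg]
    module
  · simp only [ContinuousLinearMap.comp_apply, map_add, map_smul, q4, rot_J_self hJ hun',
      rot_J_self hJ hun, q1, q2, Real.cos_neg, Real.sin_neg]
    module
  · rw [inner_sub_left, real_inner_smul_left, real_inner_smul_left] at x3
    rw [inner_add_left, real_inner_smul_left, real_inner_smul_left] at x4
    rw [ea, inner_add_left, real_inner_smul_left, real_inner_smul_left] at x1
    rw [eb, inner_sub_left, real_inner_smul_left, real_inner_smul_left] at x2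
    have g1 : inner ℝ u x = 0 := by linear_combination α * x1 + β * x3 - inner ℝ u x * hrr
    have g2 : inner ℝ (J u) x = 0 := by linear_combination α * x2 + β * x4 - inner ℝ (J u) x * hrr
    have g3 : inner ℝ u' x = 0 := by linear_combination β * x1 - α * x3 - inner ℝ u' x * hrr
    have g4 : inner ℝ (J u') x = 0 := by
      linear_combination α * x4 - β * x2 - inner ℝ (J u') x * hrr
    rw [ContinuousLinearMap.comp_apply, rot_of_orth J _ g3 g4, rot_of_orth J _ g1 g2]
  · have := (hw u hun θ).comp (hw u' hun' (-θ))
    rwa [← Complex.exp_add, show (l * ((-θ : ℝ) : ℂ) * Complex.I + l * θ * Complex.I) = 0 by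
      push_cast; ring, Complex.exp_zero] at this

theorem cap_rot {ε : ℝ} {A B : E →L[ℝ] E} (hA : ∀ x y, inner ℝ (A x) (A y) = inner ℝ x y)
    (hB : ∀ x y, inner ℝ (B x) (B y) = inner ℝ x y)
    (h : ∀ x y, inner ℝ (B y) x = inner ℝ y (A x)) (y : E) : cap ε (B y) = cap ε y ∘ A := by
  ext x
  simp only [cap, Zn, Function.comp_apply, h, inner_isometry_norm hA, inner_isometry_norm hB]

theorem cap_comp_self {ε : ℝ} {A : E →L[ℝ] E} (hA : ∀ x y, inner ℝ (A x) (A y) = inner ℝ x y)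
    (y : E) : cap ε (A y) ∘ A = cap ε y := by
  ext x
  simp only [cap, Zn, Function.comp_apply, hA, inner_isometry_norm hA]

theorem SegInv.ext_sum_caps [FiniteDimensional ℝ E] {m : (E → ℝ) → ℂ} (hs : SegInv m)
    (hm : IsVal m) {ε : ℝ} (hε : 0 < ε) (hε' : ε ≤ 1 / 4) {ι : Type*} (s : Finset ι) (y : ι → E)
    (hy : ∀ i, ‖y i‖ ≤ 2) (a : ℝ) :
    Ext m (∑ i ∈ s, a • cap ε (y i)) = m 0 + ∑ i ∈ s, (Ext m (a • cap ε (y i)) - m 0) := by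
  have hb : ∀ i, HasBd (a • cap ε (y i)) := fun i => HasBd.const_smul ⟨_, cap_bd hε hε' (hy i)⟩ a
  have h0 := hs.ext_zero hm
  classical
  have key : ∀ s : Finset ι, ∀ j, Ext m (∑ i ∈ s, a • cap ε (y i) + a • cap ε (y j)) + m 0
      = Ext m (∑ i ∈ s, a • cap ε (y i)) + Ext m (a • cap ε (y j)) := by
    intro s
    induction s using Finset.induction_on with
    | empty => intro j; simp [h0, add_comm]
    | insert k s hk ih =>
      intro j
      have := hs.ext_cap hm hε hε' (HasBd.sum s _ fun i _ => hb i) (hy k) (hy j) a a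
      have h2 := ih j
      have h3 := ih k
      rw [Finset.sum_insert hk, add_comm (a • cap ε (y k)), add_assoc]
      linear_combination this + h2
  induction s using Finset.induction_on with
  | empty => simp [h0]
  | insert k s hk ih =>
    rw [Finset.sum_insert hk, Finset.sum_insert hk, add_comm (a • cap ε (y k))]
    linear_combination key s k + ih

/-- The restriction of an endomorphism to an invariant subspace. -/
def resCpx (J : E →L[ℝ] E) (P : Submodule ℝ E) (h : ∀ x ∈ P, J x ∈ P) : P →L[ℝ] P :=
  (J.comp P.subtypeL).codRestrict P fun x => h x x.2

theorem coe_resCpx (J : E →L[ℝ] E) (P : Submodule ℝ E) (h : ∀ x ∈ P, J x ∈ P) (x : P) :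
    (resCpx J P h x : E) = J x := rfl

theorem IsCpx.res {J : E →L[ℝ] E} (hJ : IsCpx J) (P : Submodule ℝ E) (h : ∀ x ∈ P, J x ∈ P) :
    IsCpx (resCpx J P h) :=
  ⟨fun x => Subtype.ext (by simp [coe_resCpx, hJ.sq]), fun x y => by
    rw [Submodule.coe_inner, coe_resCpx, coe_resCpx, hJ.inner_map, Submodule.coe_inner]⟩

theorem coe_rot (J : E →L[ℝ] E) (P : Submodule ℝ E) (h : ∀ x ∈ P, J x ∈ P) (u x : P) (θ : ℝ) :
    (rot (resCpx J P h) u θ x : E) = rot J (u : E) θ x := by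
  simp only [rot_apply, Submodule.coe_add, Submodule.coe_smul, Submodule.coe_inner, coe_resCpx]

theorem inner_proj (P : Submodule ℝ E) [P.HasOrthogonalProjection] (u : P) (x : E) :
    inner ℝ u (P.orthogonalProjectionOnto x) = inner ℝ (u : E) x := by
  exact Submodule.inner_orthogonalProjectionOnto_eq_of_mem_left u x

/-- A valuation of weight `l`, `3 ≤ |l|`, cannot be detected by second differences in
directions of a complex plane at functions that are unitarily invariant in the plane. -/
theorem DL_D_D_eq_zero_of_invariant [FiniteDimensional ℝ E] {J : E →L[ℝ] E} (hJ : IsCpx J)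
    {P : Submodule ℝ E} (hP4 : Module.finrank ℝ P = 4) (hP : ∀ x ∈ P, J x ∈ P) {l : ℤ}
    (hl : 3 ≤ |l|) {m : (E → ℝ) → ℂ} (hm : IsVal m) (hw : IsWt J l m) {rs : List E}
    (hrs : ∀ r ∈ rs, r ∈ Pᗮ) {a b : E} (ha : a ∈ P) (hb : b ∈ P) {c : E → ℝ} (hc : Sublin c)
    (hinv : ∀ u ∈ P, ‖u‖ = 1 → ∀ θ, c ∘ rot J u θ = c) :
    DL rs (D a (D b m)) c = 0 := by
  set n : (P → ℝ) → ℂ := fun f => DL rs m (f ∘ P.orthogonalProjectionOnto + c) with hn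
  have hnv : IsVal n := (hm.DL rs).comp_add P.orthogonalProjectionOnto hc
  have hnw : IsWt (resCpx J P hP) l n := fun u hu θ f hf => by
    have hu' : ‖(u : E)‖ = 1 := by rw [← hu]; rfl
    have hcov := (hw u hu' θ).DL (rot_inner hJ hu' θ) (l := rs) fun v hv =>
      rot_of_orth J θ ((hrs v hv) _ u.2) ((hrs v hv) _ (hP _ u.2))
    have := hcov _ ((hf.comp P.orthogonalProjectionOnto).add hc)
    rw [hn]
    simp only
    rw [← this]
    congr 1
    ext x
    have e1 : c (rot J u θ x) = c x := congrFun (hinv u u.2 hu' θ) x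
    have e2 : rot (resCpx J P hP) u θ (P.orthogonalProjectionOnto x)
        = P.orthogonalProjectionOnto (rot J u θ x) := by
      refine ext_inner_left ℝ fun v => ?_
      rw [inner_proj, Submodule.coe_inner, coe_rot, ← rot_adjoint, ← rot_adjoint, ← coe_rot J P hP,
        ← Submodule.coe_inner, inner_proj]
    simp only [Pi.add_apply, Function.comp_apply, e1, e2]
  have h0 := ((hnw.eq_zero_of_finrank_four hP4 (hJ.res P hP) hl hnv).D ⟨b, hb⟩).D ⟨a, ha⟩ 0
    Sublin.zero
  have hseg : ∀ u : P, seg u ∘ P.orthogonalProjectionOnto = seg (u : E) := fun u => by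
    ext x; simp [seg]
  rw [D_zero, D_zero] at h0
  rw [← D_DL, ← D_DL]
  have key : ∀ f : P → ℝ, D ⟨b, hb⟩ n f
      = D b (DL rs m) (f ∘ P.orthogonalProjectionOnto + c) := fun f => by
    rw [D, D, hn]
    simp only
    congr 2
    rw [← hseg ⟨b, hb⟩]
    ext x; simp; ring
  rw [D, key, key] at h0
  rw [D, ← hseg ⟨a, ha⟩]
  rw [show (0 + seg (⟨a, ha⟩ : P)) ∘ P.orthogonalProjectionOnto + c
    = c + seg (⟨a, ha⟩ : P) ∘ P.orthogonalProjectionOnto by ext x; simp; ring,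
    show (0 : P → ℝ) ∘ P.orthogonalProjectionOnto + c = c by ext x; simp] at h0
  exact h0

/-- Averaging over the two signs of a direction, with length given by a linear image. -/
theorem Sublin.even_avg_comp {f : E → ℝ} (hf : Sublin f) (B C : F →L[ℝ] E) (u : E) :
    Sublin (fun x => f (B x + ‖C x‖ • u) + f (B x - ‖C x‖ • u)) := by
  have hmono : ∀ x : E, ∀ s t : ℝ, 0 ≤ s → s ≤ t →
      f (x + s • u) + f (x - s • u) ≤ f (x + t • u) + f (x - t • u) := fun x s t hs hst => by
    rcases eq_or_lt_of_le (hs.trans hst) with ht | ht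
    · have : s = t := by linarith
      rw [this]
    set p := (t + s) / (2 * t) with hp
    set q := (t - s) / (2 * t) with hq
    have hp0 : 0 ≤ p := by positivity
    have hq0 : 0 ≤ q := div_nonneg (by linarith) (by linarith)
    have hpq : p + q = 1 := by rw [hp, hq]; field_simp; ring
    have hpq' : p * t - q * t = s := by rw [hp, hq]; field_simp; ring
    have e1 : x + s • u = p • (x + t • u) + q • (x - t • u) := by
      rw [← hpq']; nth_rewrite 1 [← one_smul ℝ x]; rw [← hpq]; module
    have e2 : x - s • u = q • (x + t • u) + p • (x - t • u) := by
      rw [← hpq']; nth_rewrite 1 [← one_smul ℝ x]; rw [← hpq]; module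
    have h1 := hf.add_le (p • (x + t • u)) (q • (x - t • u))
    have h2 := hf.add_le (q • (x + t • u)) (p • (x - t • u))
    rw [hf.smul _ hp0, hf.smul _ hq0, ← e1] at h1
    rw [hf.smul _ hp0, hf.smul _ hq0, ← e2] at h2
    have e3 : p = 1 - q := by linarith
    rw [e3] at h1 h2
    linarith
  refine ⟨fun x y => ?_, fun t ht x => ?_, ?_⟩
  · refine (hmono (B (x + y)) _ (‖C x‖ + ‖C y‖) (norm_nonneg _)
      (by rw [map_add]; exact norm_add_le (C x) (C y))).trans ?_
    have h1 := hf.add_le (B x + ‖C x‖ • u) (B y + ‖C y‖ • u)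
    have h2 := hf.add_le (B x - ‖C x‖ • u) (B y - ‖C y‖ • u)
    have e1 : B (x + y) + (‖C x‖ + ‖C y‖) • u = B x + ‖C x‖ • u + (B y + ‖C y‖ • u) := by
      rw [map_add]; module
    have e2 : B (x + y) - (‖C x‖ + ‖C y‖) • u = B x - ‖C x‖ • u + (B y - ‖C y‖ • u) := by
      rw [map_add]; module
    rw [e1, e2]
    linarith
  · simp only [map_smul, norm_smul, Real.norm_of_nonneg ht, mul_smul, ← smul_add, ← smul_sub,
      hf.smul t ht]
    ring
  · obtain ⟨K, hK0, hK⟩ := hf.abs_bdd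
    refine ⟨K * (‖B‖ + ‖C‖ * ‖u‖) + K * (‖B‖ + ‖C‖ * ‖u‖), fun x => ?_⟩
    have h1 := (le_abs_self _).trans (hK (B x + ‖C x‖ • u))
    have h2 := (le_abs_self _).trans (hK (B x - ‖C x‖ • u))
    have h3 := norm_add_le (B x) (‖C x‖ • u)
    have h4 := norm_sub_le (B x) (‖C x‖ • u)
    rw [norm_smul, norm_norm] at h3 h4
    have h7 : ‖B x‖ + ‖C x‖ * ‖u‖ ≤ (‖B‖ + ‖C‖ * ‖u‖) * ‖x‖ := by
      have := mul_le_mul_of_nonneg_right (C.le_opNorm x) (norm_nonneg u)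
      have := B.le_opNorm x
      linarith
    have h5 := mul_le_mul_of_nonneg_left (h3.trans h7) hK0
    have h6 := mul_le_mul_of_nonneg_left (h4.trans h7) hK0
    linarith

theorem Sublin.integral {G : ℝ → E → ℝ} (hG : ∀ t, Sublin (G t)) (hc : ∀ x, Continuous fun t => G t x)
    {C : ℝ} (hC : ∀ t x, G t x ≤ C * ‖x‖) : Sublin fun x => ∫ t in (0 : ℝ)..1, G t x := by
  refine ⟨fun x y => ?_, fun t _ x => ?_, C, fun x => ?_⟩
  · rw [← intervalIntegral.integral_add ((hc x).intervalIntegrable _ _)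
      ((hc y).intervalIntegrable _ _)]
    exact intervalIntegral.integral_mono zero_le_one ((hc _).intervalIntegrable _ _)
      (((hc x).add (hc y)).intervalIntegrable _ _) fun t => (hG t).add_le x y
  · rw [← intervalIntegral.integral_const_mul]
    congr 1; ext s; exact (hG s).smul t ‹_› x
  · have := intervalIntegral.integral_mono (μ := volume) zero_le_one ((hc x).intervalIntegrable 0 1)
      (continuous_const.intervalIntegrable (μ := volume) 0 1) (fun t => hC t x)
    simpa using this

/-- Riemann sums of periodic Lipschitz functions, uniformly in a shift. -/
theorem riemann_periodic {h : ℝ → ℝ} (hp : Function.Periodic h 1) {K : ℝ}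
    (hK : ∀ s t, |h s - h t| ≤ K * |s - t|) (N : ℕ) (hN : 0 < N) (ψ : ℝ) :
    |(∑ k ∈ Finset.range N, (N : ℝ)⁻¹ * h (k / N + ψ)) - ∫ t in (0 : ℝ)..1, h t| ≤ K / N := by
  have hN' : (0 : ℝ) < N := by exact_mod_cast hN
  have hc : Continuous h := by
    have hK0 : 0 ≤ K := by
      have := (abs_nonneg _).trans (hK 1 0)
      simpa using this
    exact (LipschitzWith.of_dist_le_mul (K := ⟨K, hK0⟩) fun s t => by
      rw [Real.dist_eq, Real.dist_eq]; exact hK s t).continuous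
  have hcψ : Continuous fun t => h (t + ψ) := hc.comp (continuous_id.add continuous_const)
  have e1 : ∫ t in (0 : ℝ)..1, h t = ∫ t in (0 : ℝ)..1, h (t + ψ) := by
    rw [intervalIntegral.integral_comp_add_right]
    have := hp.intervalIntegral_add_eq 0 ψ
    rw [zero_add] at this
    rw [this, zero_add, add_comm]
  have e2 := intervalIntegral.sum_integral_adjacent_intervals (f := fun t => h (t + ψ))
    (μ := volume) (a := fun k : ℕ => (k : ℝ) / N) (n := N)
    fun k _ => hcψ.intervalIntegrable _ _
  simp only [Nat.cast_zero, zero_div, div_self hN'.ne'] at e2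
  rw [e1, ← e2, ← Finset.sum_sub_distrib]
  refine (Finset.abs_sum_le_sum_abs _ _).trans ?_
  have hle : ∀ k ∈ Finset.range N, |(N : ℝ)⁻¹ * h (k / N + ψ)
      - ∫ t in ((k : ℝ) / N)..((k + 1 : ℕ) : ℝ) / N, h (t + ψ)| ≤ K / N * (N : ℝ)⁻¹ := fun k _ => by
    have hd : ((k + 1 : ℕ) : ℝ) / N - (k : ℝ) / N = (N : ℝ)⁻¹ := by push_cast; field_simp; ring
    have hcst : (N : ℝ)⁻¹ * h (k / N + ψ)
        = ∫ t in ((k : ℝ) / N)..((k + 1 : ℕ) : ℝ) / N, h (k / N + ψ) := by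
      rw [intervalIntegral.integral_const, hd, smul_eq_mul]
    rw [hcst, ← intervalIntegral.integral_sub (by simp) (hcψ.intervalIntegrable _ _),
      ← Real.norm_eq_abs]
    have hlt : (k : ℝ) / N ≤ ((k + 1 : ℕ) : ℝ) / N := by rw [← sub_nonneg, hd]; positivity
    refine (intervalIntegral.norm_integral_le_of_norm_le_const (C := K / N) fun t ht => ?_).trans ?_
    · rw [Set.uIoc_of_le hlt] at ht
      rw [Real.norm_eq_abs]
      refine (hK _ _).trans ?_
      have hK0 : 0 ≤ K := by
        have := (abs_nonneg _).trans (hK 1 0)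
        simpa using this
      rw [div_eq_mul_inv K]
      refine mul_le_mul_of_nonneg_left ?_ hK0
      rw [abs_le]
      constructor <;> linarith [ht.1, ht.2, inv_pos.2 hN', hd]
    · rw [hd, abs_of_pos (inv_pos.2 hN')]
  refine (Finset.sum_le_sum hle).trans ?_
  rw [Finset.sum_const, Finset.card_range, nsmul_eq_mul]
  apply le_of_eq; field_simp

/-- The `1`-periodic ellipse with the given semi-axes. -/
def crc (e e' : E) (t : ℝ) : E := Real.cos (2 * Real.pi * t) • e + Real.sin (2 * Real.pi * t) • e'

theorem crc_add_half (e e' : E) (t : ℝ) : crc e e' (t + 1 / 2) = -crc e e' t := by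
  rw [crc, crc, show 2 * Real.pi * (t + 1 / 2) = 2 * Real.pi * t + Real.pi by ring,
    Real.cos_add_pi, Real.sin_add_pi]
  module

theorem crc_add_one (e e' : E) (t : ℝ) : crc e e' (t + 1) = crc e e' t := by
  rw [show t + 1 = t + 1 / 2 + 1 / 2 by ring, crc_add_half, crc_add_half, neg_neg]

theorem crc_continuous (e e' : E) : Continuous (crc e e') := by
  unfold crc; fun_prop

theorem norm_crc_le (e e' : E) (t : ℝ) : ‖crc e e' t‖ ≤ ‖e‖ + ‖e'‖ := by
  refine (norm_add_le _ _).trans (add_le_add ?_ ?_) <;> rw [norm_smul, Real.norm_eq_abs]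
  · exact mul_le_of_le_one_left (norm_nonneg _) (Real.abs_cos_le_one _)
  · exact mul_le_of_le_one_left (norm_nonneg _) (Real.abs_sin_le_one _)

theorem crc_sub_le (e e' : E) (s t : ℝ) :
    ‖crc e e' s - crc e e' t‖ ≤ 2 * Real.pi * (‖e‖ + ‖e'‖) * |s - t| := by
  have h : crc e e' s - crc e e' t = (Real.cos (2 * Real.pi * s) - Real.cos (2 * Real.pi * t)) • e
      + (Real.sin (2 * Real.pi * s) - Real.sin (2 * Real.pi * t)) • e' := by
    rw [crc, crc]; module
  have hd : |2 * Real.pi * s - 2 * Real.pi * t| = 2 * Real.pi * |s - t| := by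
    rw [← mul_sub, abs_mul, abs_of_pos Real.two_pi_pos]
  have h1 := Real.abs_cos_sub_cos_le (2 * Real.pi * s) (2 * Real.pi * t)
  have h2 := Real.abs_sin_sub_sin_le (2 * Real.pi * s) (2 * Real.pi * t)
  rw [hd] at h1 h2
  rw [h]
  refine (norm_add_le _ _).trans ?_
  rw [norm_smul, norm_smul, Real.norm_eq_abs, Real.norm_eq_abs]
  have := mul_le_mul_of_nonneg_right h1 (norm_nonneg e)
  have := mul_le_mul_of_nonneg_right h2 (norm_nonneg e')
  linarith

/-- The average of `f` over ellipses, scaled by the length of a linear image. -/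
def crcAvg (f : E → ℝ) (B C : F →L[ℝ] E) (e e' : E) (x : F) : ℝ :=
  ∫ t in (0 : ℝ)..1, f (B x + ‖C x‖ • crc e e' t)

theorem Sublin.crcAvg {f : E → ℝ} (hf : Sublin f) (B C : F →L[ℝ] E) (e e' : E) :
    Sublin (crcAvg f B C e e') := by
  have hc : ∀ x, Continuous fun t => f (B x + ‖C x‖ • crc e e' t) := fun x =>
    hf.continuous.comp (continuous_const.add ((crc_continuous e e').const_smul _))
  have hc' : ∀ x, Continuous fun t => f (B x - ‖C x‖ • crc e e' t) := fun x =>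
    hf.continuous.comp (continuous_const.sub ((crc_continuous e e').const_smul _))
  obtain ⟨K, hK0, hK⟩ := hf.abs_bdd
  have hb : ∀ t x, f (B x + ‖C x‖ • crc e e' t) + f (B x - ‖C x‖ • crc e e' t)
      ≤ (2 * (K * (‖B‖ + ‖C‖ * (‖e‖ + ‖e'‖)))) * ‖x‖ := fun t x => by
    have h1 := (le_abs_self _).trans (hK (B x + ‖C x‖ • crc e e' t))
    have h2 := (le_abs_self _).trans (hK (B x - ‖C x‖ • crc e e' t))
    have h3 := norm_add_le (B x) (‖C x‖ • crc e e' t)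
    have h4 := norm_sub_le (B x) (‖C x‖ • crc e e' t)
    rw [norm_smul, norm_norm] at h3 h4
    have h7 : ‖B x‖ + ‖C x‖ * ‖crc e e' t‖ ≤ (‖B‖ + ‖C‖ * (‖e‖ + ‖e'‖)) * ‖x‖ := by
      have := mul_le_mul (C.le_opNorm x) (norm_crc_le e e' t) (norm_nonneg _) (by positivity)
      have := B.le_opNorm x
      linarith
    have h5 := mul_le_mul_of_nonneg_left (h3.trans h7) hK0
    have h6 := mul_le_mul_of_nonneg_left (h4.trans h7) hK0
    linarith
  have key := (Sublin.integral (fun t => hf.even_avg_comp B C (crc e e' t))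
    (fun x => (hc x).add (hc' x)) hb).const_smul (c := 1 / 2) (by norm_num)
  convert key using 1
  ext x
  have hp : Function.Periodic (fun t => f (B x + ‖C x‖ • crc e e' t)) 1 := fun t => by
    simp only [crc_add_one]
  have e2 : ∀ t, f (B x - ‖C x‖ • crc e e' t) = f (B x + ‖C x‖ • crc e e' (t + 1 / 2)) := fun t => by
    rw [crc_add_half, smul_neg, sub_eq_add_neg]
  have e1 : ∫ t in (0 : ℝ)..1, f (B x - ‖C x‖ • crc e e' t) = SUVal.crcAvg f B C e e' x := by
    simp only [e2]
    rw [intervalIntegral.integral_comp_add_right (fun t => f (B x + ‖C x‖ • crc e e' t))]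
    have := hp.intervalIntegral_add_eq 0 (1 / 2)
    rw [zero_add] at this
    rw [SUVal.crcAvg, this, zero_add, add_comm (1 : ℝ)]
  rw [Pi.smul_apply, intervalIntegral.integral_add ((hc x).intervalIntegrable _ _)
    ((hc' x).intervalIntegrable _ _), e1, smul_eq_mul]
  change _ = 1 / 2 * (SUVal.crcAvg f B C e e' x + _)
  ring

theorem exists_polar (p q : ℝ) :
    ∃ ψ, p = √(p ^ 2 + q ^ 2) * Real.cos (2 * Real.pi * ψ) ∧
      q = √(p ^ 2 + q ^ 2) * Real.sin (2 * Real.pi * ψ) := by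
  have hn : ‖(⟨p, q⟩ : ℂ)‖ = √(p ^ 2 + q ^ 2) := by
    rw [Complex.norm_eq_sqrt_sq_add_sq]
  refine ⟨Complex.arg ⟨p, q⟩ / (2 * Real.pi), ?_, ?_⟩ <;>
    rw [mul_div_cancel₀ _ Real.two_pi_pos.ne', ← hn]
  · rw [Complex.norm_mul_cos_arg]
  · rw [Complex.norm_mul_sin_arg]

/-- Averages over orbits of a one-parameter group of double rotations are ellipse averages,
up to `O(1 / N)`. -/
theorem sum_orbit_approx {f : E → ℝ} {C : ℝ} (hC : 0 ≤ C) (hf : ∀ x y, |f x - f y| ≤ C * ‖x - y‖)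
    {e e' : E} (he : ‖e‖ = 1) (he' : ‖e'‖ = 1) (hee : inner ℝ e e' = 0) {A : ℝ → E →L[ℝ] E}
    (hAe : ∀ θ, A θ e = Real.cos θ • e + Real.sin θ • e')
    (hAe' : ∀ θ, A θ e' = -Real.sin θ • e + Real.cos θ • e') (B : E →L[ℝ] E) {z : E}
    (hz : ∀ θ, A θ (z - (inner ℝ e z • e + inner ℝ e' z • e'))
      = z - (inner ℝ e z • e + inner ℝ e' z • e'))
    (hB : B z = inner ℝ e z • e + inner ℝ e' z • e') (N : ℕ) (hN : 0 < N) :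
    |(∑ k ∈ Finset.range N, (N : ℝ)⁻¹ * f (A (2 * Real.pi * (k / N)) z))
      - crcAvg f (ContinuousLinearMap.id ℝ E - B) B e e' z|
      ≤ 4 * Real.pi * C * ‖B‖ / N * ‖z‖ := by
  obtain ⟨ψ, h1, h2⟩ := exists_polar (inner ℝ e z) (inner ℝ e' z)
  set p := inner ℝ e z
  set q := inner ℝ e' z
  have hρ : ‖B z‖ = √(p ^ 2 + q ^ 2) := by
    rw [hB, ← Real.sqrt_sq (norm_nonneg (p • e + q • e')), norm_add_sq_real, norm_smul, norm_smul,
      he, he', real_inner_smul_left, real_inner_smul_right, hee, mul_pow, mul_pow,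
      Real.norm_eq_abs, Real.norm_eq_abs, sq_abs, sq_abs]
    congr 1; ring
  rw [← hρ] at h1 h2
  have hA : ∀ k : ℕ, A (2 * Real.pi * (k / N)) z = (z - B z) + ‖B z‖ • crc e e' (k / N + ψ) := by
    intro k
    have e1 : z = (z - B z) + B z := by abel
    nth_rewrite 1 [e1]
    rw [map_add]
    congr 1
    · rw [hB, hz]
    · rw [crc, mul_add, Real.cos_add, Real.sin_add, hB, map_add, map_smul, map_smul, hAe, hAe']
      rw [← hB]
      match_scalars
      · linear_combination Real.cos (2 * Real.pi * (k / N)) * h1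
          - Real.sin (2 * Real.pi * (k / N)) * h2
      · linear_combination Real.sin (2 * Real.pi * (k / N)) * h1
          + Real.cos (2 * Real.pi * (k / N)) * h2
  simp only [hA]
  have hb := riemann_periodic (h := fun t => f ((z - B z) + ‖B z‖ • crc e e' t))
    (K := 4 * Real.pi * C * ‖B z‖) (fun t => by simp only [crc_add_one]) (fun s t => by
      refine (hf _ _).trans ?_
      rw [add_sub_add_left_eq_sub, ← smul_sub, norm_smul, norm_norm]
      have := mul_le_mul_of_nonneg_left (crc_sub_le e e' s t) (mul_nonneg hC (norm_nonneg (B z)))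
      rw [he, he'] at this
      linarith) N hN ψ
  refine hb.trans ?_
  have := mul_le_mul_of_nonneg_left (B.le_opNorm z)
    (by positivity : 0 ≤ 4 * Real.pi * C / (N : ℝ))
  calc _ = 4 * Real.pi * C / N * ‖B z‖ := by ring
    _ ≤ _ := this
    _ = _ := by ring

theorem span_invariant {J : E →L[ℝ] E} {s : Set E} (h : ∀ x ∈ s, J x ∈ Submodule.span ℝ s) :
    ∀ x ∈ Submodule.span ℝ s, J x ∈ Submodule.span ℝ s := fun _ hx =>
  (Submodule.span_le (p := (Submodule.span ℝ s).comap (J : E →ₗ[ℝ] E))).2 h hx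

theorem crcAvg_invariant [FiniteDimensional ℝ E] {J : E →L[ℝ] E} (hJ : IsCpx J)
    {P : Submodule ℝ E} (hP : ∀ x ∈ P, J x ∈ P) (f : E → ℝ) (e e' : E) {u : E} (hu : u ∈ P)
    (hu1 : ‖u‖ = 1) (θ : ℝ) :
    crcAvg f (ContinuousLinearMap.id ℝ E - P.starProjection) P.starProjection e e' ∘ rot J u θ
      = crcAvg f (ContinuousLinearMap.id ℝ E - P.starProjection) P.starProjection e e' := by
  ext x
  have hx : rot J u θ (x - P.starProjection x) = x - P.starProjection x :=
    rot_of_orth J θ (Submodule.sub_starProjection_mem_orthogonal x _ hu)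
      (Submodule.sub_starProjection_mem_orthogonal x _ (hP u hu))
  have hr : rot J u θ (P.starProjection x) ∈ P := by
    rw [rot_apply]
    exact P.add_mem (P.add_mem (Submodule.starProjection_apply_mem _ _) (P.smul_mem _ hu))
      (P.smul_mem _ (hP u hu))
  have hs : rot J u θ x = rot J u θ (P.starProjection x) + (x - P.starProjection x) := by
    rw [← hx, ← map_add]; congr 1; abel
  have hp : P.starProjection (rot J u θ x) = rot J u θ (P.starProjection x) := by
    apply Submodule.eq_starProjection_of_mem_orthogonal hr
    rw [hs, add_sub_cancel_left]
    exact Submodule.sub_starProjection_mem_orthogonal x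
  have hn : ‖rot J u θ (P.starProjection x)‖ = ‖P.starProjection x‖ :=
    inner_isometry_norm (rot_inner hJ hu1 θ) _
  simp only [Function.comp_apply, crcAvg, _root_.sub_apply,
    ContinuousLinearMap.id_apply, hp, hn]
  rw [hs, add_sub_cancel_left]


/-- Second differences along a generic pair vanish at caps. -/
theorem IsWt.ext_cap_eq [FiniteDimensional ℝ E] {J : E →L[ℝ] E} (hJ : IsCpx J) {l : ℤ}
    (hl : 3 ≤ |l|) {m : (E → ℝ) → ℂ} (hm : IsVal m) (hw : IsWt J l m) {a b : E} (ha : ‖a‖ = 1)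
    (hb : ‖b‖ = 1) (hab : inner ℝ a b = 0) (h1 : b ≠ J a) (h2 : b ≠ -J a) {rs : List E}
    (hrs : ∀ r ∈ rs, inner ℝ a r = 0 ∧ inner ℝ b r = 0 ∧ inner ℝ (J a) r = 0 ∧ inner ℝ (J b) r = 0)
    (hs : SegInv (DL rs (D a (D b m)))) {ε : ℝ} (hε : 0 < ε) (hε' : ε ≤ 1 / 4) {y : E}
    (hy : ‖y‖ ≤ 2) :
    Ext (DL rs (D a (D b m))) (cap ε y) = 0 ∧ DL rs (D a (D b m)) 0 = 0 := by
  obtain ⟨e, e', A, ho, ⟨c, s, hs0, hJa, hJb, hJe, hJe'⟩, hAi, hAadj, hAa, hAb, hAe, hAe', hAf, hcov⟩ :=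
    exists_frame hJ ha hb hab h1 h2
  set κ := DL rs (D a (D b m)) with hκ
  have hkv : IsVal κ := ((hm.D b).D a).DL rs
  set P := Submodule.span ℝ (Set.range ![a, b, e, e']) with hPdef
  have hP4 : Module.finrank ℝ P = 4 := by
    rw [finrank_span_eq_card ho.linearIndependent]; simp
  have hmem : ∀ i, ![a, b, e, e'] i ∈ P := fun i => Submodule.subset_span ⟨i, rfl⟩
  have maP : a ∈ P := hmem 0
  have mbP : b ∈ P := hmem 1
  have meP : e ∈ P := hmem 2
  have meP' : e' ∈ P := hmem 3
  have hP : ∀ x ∈ P, J x ∈ P := by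
    apply span_invariant
    rintro _ ⟨i, rfl⟩
    rw [← hPdef]
    fin_cases i
    · change J a ∈ P
      rw [hJa]; exact P.add_mem (P.smul_mem _ mbP) (P.smul_mem _ meP')
    · change J b ∈ P
      rw [hJb]; exact P.sub_mem (P.smul_mem _ maP) (P.smul_mem _ meP)
    · change J e ∈ P
      rw [hJe]; exact P.sub_mem (P.smul_mem _ mbP) (P.smul_mem _ meP')
    · change J e' ∈ P
      rw [hJe']; exact P.add_mem (P.smul_mem _ maP) (P.smul_mem _ meP)
  have horth : ∀ x, inner ℝ a x = 0 → inner ℝ b x = 0 → inner ℝ e x = 0 → inner ℝ e' x = 0 →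
      x ∈ Pᗮ := by
    intro x xa xb xe xe'
    rw [Submodule.mem_orthogonal]
    intro u hu
    induction hu using Submodule.span_induction with
    | mem u hu => obtain ⟨i, rfl⟩ := hu; fin_cases i <;> assumption
    | zero => exact inner_zero_left _
    | add u v _ _ h h' => rw [inner_add_left, h, h', add_zero]
    | smul t u _ h => rw [real_inner_smul_left, h, mul_zero]
  have hr : ∀ r ∈ rs, inner ℝ e r = 0 ∧ inner ℝ e' r = 0 := by
    intro r hr
    obtain ⟨ra, rb, rJa, rJb⟩ := hrs r hr
    rw [hJa, inner_add_left, real_inner_smul_left, real_inner_smul_left, rb, mul_zero,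
      zero_add] at rJa
    rw [hJb, inner_sub_left, real_inner_smul_left, real_inner_smul_left, ra, mul_zero, zero_sub,
      neg_eq_zero] at rJb
    exact ⟨(mul_eq_zero.1 rJb).resolve_left hs0, (mul_eq_zero.1 rJa).resolve_left hs0⟩
  have hrP : ∀ r ∈ rs, r ∈ Pᗮ := fun r h =>
    horth r (hrs r h).1 (hrs r h).2.1 (hr r h).1 (hr r h).2
  have hkcov : ∀ θ, Cov (A θ) 1 κ := fun θ =>
    (Cov.D_D hm (hcov θ l m hw) (hAi θ) (Real.cos_sq_add_sin_sq θ) (hAa θ) (hAb θ)).DL (hAi θ)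
      fun r h => hAf θ r (hrs r h).1 (hrs r h).2.1 (hr r h).1 (hr r h).2
  have hk0 : κ 0 = 0 := DL_D_D_eq_zero_of_invariant hJ hP4 hP hl hm hw hrP maP mbP Sublin.zero
    fun _ _ _ _ => rfl
  refine ⟨?_, hk0⟩
  have hyA : ∀ θ, ‖A θ y‖ ≤ 2 := fun θ => by rw [inner_isometry_norm (hAi θ)]; exact hy
  have hext : ∀ t θ, Ext κ (t • cap ε (A θ y)) = Ext κ (t • cap ε y) := fun t θ => by
    have hb1 := (cap_bd hε hε' (hyA θ)).const_smul t
    rw [hs.ext_eq hkv hb1, hs.ext_eq hkv ((cap_bd hε hε' hy).const_smul t)]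
    have := hkcov θ _ hb1.add
    rw [one_mul] at this
    rw [← this]
    congr 1
    ext x
    have := congrFun (cap_comp_self (ε := ε) (hAi θ) y) x
    simp only [Function.comp_apply] at this
    simp [nrm, this, inner_isometry_norm (hAi θ)]
  set g := (132 : ℝ) • nrm + cap ε y with hg
  have hgs : Sublin g := (cap_bd hε hε' hy).add
  obtain ⟨C, hC0, hC⟩ := hgs.lip
  set L := crcAvg g (ContinuousLinearMap.id ℝ E - P.starProjection) P.starProjection e e' with hL
  have hLs : Sublin L := hgs.crcAvg _ _ _ _
  have hL0 : κ L = 0 := DL_D_D_eq_zero_of_invariant hJ hP4 hP hl hm hw hrP maP mbP hLs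
    fun u hu hu1 θ => crcAvg_invariant hJ hP g e e' hu hu1 θ
  have hpr : ∀ x, inner ℝ a (proj2 a b x) = 0 ∧ inner ℝ b (proj2 a b x) = 0 := fun x => by
    simp only [proj2_apply, inner_sub_right, real_inner_smul_right, real_inner_self_eq_norm_sq,
      ha, hb, hab, real_inner_comm a b]
    constructor <;> ring
  have hkpr : ∀ f, Sublin f → κ (f ∘ proj2 a b) = κ f := fun f hf => by
    rw [hκ, ← D_DL, ← D_DL]
    refine (hm.DL rs).D_D_congr (hf.comp _) hf hab fun x xa xb => ?_
    rw [Function.comp_apply, proj2_apply, xa, xb, zero_smul, zero_smul, sub_zero, sub_zero]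
  rw [← hL0, ← hkpr L hLs]
  symm
  refine hkv.eq_of_approx (hLs.comp _) fun δ hδ => ?_
  obtain ⟨N, hN⟩ := exists_nat_gt
    (4 * Real.pi * C * ‖(P.starProjection : E →L[ℝ] E)‖ * ‖proj2 a b‖ / δ)
  have hN' : (0 : ℝ) < N := lt_of_le_of_lt (by positivity) hN
  have hN0 : 0 < N := by exact_mod_cast hN'
  set θ : ℕ → ℝ := fun k => 2 * Real.pi * (k / N) with hθ
  set q := ∑ k ∈ Finset.range N, (N : ℝ)⁻¹ • cap ε (A (-θ k) y) with hq
  have hbq : Bd 132 q := by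
    have := Bd.sum (Finset.range N) (fun _ => |(N : ℝ)⁻¹| * 132) _
      fun k _ => (cap_bd hε hε' (hyA (-θ k))).const_smul (N : ℝ)⁻¹
    rw [Finset.sum_const, Finset.card_range, nsmul_eq_mul, abs_of_pos (inv_pos.2 hN'),
      ← mul_assoc, mul_inv_cancel₀ hN'.ne', one_mul] at this
    exact this
  refine ⟨((132 : ℝ) • nrm + q) ∘ proj2 a b, hbq.add.comp _, fun x => ?_, ?_⟩
  · set z := proj2 a b x with hz
    obtain ⟨za, zb⟩ := hpr x
    rw [← hz] at za zb
    have hee : ‖e‖ = 1 := ho.1 2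
    have hee' : ‖e'‖ = 1 := ho.1 3
    have oee : inner ℝ e e' = (0 : ℝ) := ho.2 (by decide : (2 : Fin 4) ≠ 3)
    have oae : inner ℝ a e = (0 : ℝ) := ho.2 (by decide : (0 : Fin 4) ≠ 2)
    have oae' : inner ℝ a e' = (0 : ℝ) := ho.2 (by decide : (0 : Fin 4) ≠ 3)
    have obe : inner ℝ b e = (0 : ℝ) := ho.2 (by decide : (1 : Fin 4) ≠ 2)
    have obe' : inner ℝ b e' = (0 : ℝ) := ho.2 (by decide : (1 : Fin 4) ≠ 3)
    have q1 : inner ℝ a (z - (inner ℝ e z • e + inner ℝ e' z • e')) = (0 : ℝ) := by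
      simp [inner_sub_right, inner_add_right, real_inner_smul_right, za, oae, oae']
    have q2 : inner ℝ b (z - (inner ℝ e z • e + inner ℝ e' z • e')) = (0 : ℝ) := by
      simp [inner_sub_right, inner_add_right, real_inner_smul_right, zb, obe, obe']
    have q3 : inner ℝ e (z - (inner ℝ e z • e + inner ℝ e' z • e')) = (0 : ℝ) := by
      rw [inner_sub_right, inner_add_right, real_inner_smul_right, real_inner_smul_right, oee,
        real_inner_self_eq_norm_sq, hee]
      ring
    have q4 : inner ℝ e' (z - (inner ℝ e z • e + inner ℝ e' z • e')) = (0 : ℝ) := by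
      rw [inner_sub_right, inner_add_right, real_inner_smul_right, real_inner_smul_right,
        real_inner_comm e e', oee, real_inner_self_eq_norm_sq, hee']
      ring
    have hsum : ((132 : ℝ) • (nrm : E → ℝ) + q) z = ∑ k ∈ Finset.range N, (N : ℝ)⁻¹ * g (A (θ k) z) := by
      have e1 : ∀ k, g (A (θ k) z) = 132 * ‖z‖ + cap ε (A (-θ k) y) z := fun k => by
        rw [cap_rot (hAi (θ k)) (hAi (-θ k)) (hAadj (θ k))]
        simp [hg, nrm, inner_isometry_norm (hAi (θ k))]
      simp only [e1, mul_add, Finset.sum_add_distrib, Finset.sum_const, Finset.card_range, hq,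
        nsmul_eq_mul, Pi.add_apply, Finset.sum_apply, Pi.smul_apply, smul_eq_mul, nrm]
      rw [mul_inv_cancel_left₀ hN'.ne']
    rw [Function.comp_apply, Function.comp_apply, ← hz, hsum, hL]
    refine (sum_orbit_approx hC0 hC hee hee' oee hAe hAe' P.starProjection
      (fun θ => hAf θ _ q1 q2 q3 q4) ?_ N hN0).trans ?_
    · exact Submodule.eq_starProjection_of_mem_orthogonal
        (P.add_mem (P.smul_mem _ meP) (P.smul_mem _ meP')) (horth _ q1 q2 q3 q4)
    · have hzx := (proj2 a b).le_opNorm x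
      rw [div_lt_iff₀ hδ] at hN
      have hX : 0 ≤ 4 * Real.pi * C * ‖(P.starProjection : E →L[ℝ] E)‖ / N := by positivity
      refine (mul_le_mul_of_nonneg_left hzx hX).trans ?_
      rw [← mul_assoc]
      refine mul_le_mul_of_nonneg_right ?_ (norm_nonneg _)
      rw [div_mul_eq_mul_div, div_le_iff₀ hN']
      linarith
  · rw [hkpr _ hbq.add, ← hs.ext_eq hkv hbq, hq,
      hs.ext_sum_caps hkv hε hε' _ _ (fun k => hyA (-θ k))]
    simp only [hext]
    rw [← hs.ext_sum_caps hkv hε hε' (Finset.range N) (fun _ => y) (fun _ => hy), Finset.sum_const,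
      Finset.card_range, ← Nat.cast_smul_eq_nsmul ℝ, smul_smul, mul_inv_cancel₀ hN'.ne', one_smul]

theorem IsWt.DL_short_eq_zero [FiniteDimensional ℝ E] (hE : 4 < Module.finrank ℝ E)
    {J : E →L[ℝ] E} (hJ : IsCpx J) {l : ℤ} (hl : l ≠ 0) {m : (E → ℝ) → ℂ} (hm : IsVal m)
    (hw : IsWt J l m) {L : List E} (hL : L.length ≤ 1) (hs : SegInv (DL L m)) :
    Eqv (DL L m) 0 := by
  obtain ⟨v, hv⟩ : ∃ v, ∀ w ∈ L, w = v := by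
    match L, hL with
    | [], _ => exact ⟨0, by simp⟩
    | [v], _ => exact ⟨v, by simp⟩
  have hfix : ∀ y : E, ∃ u, ‖u‖ = 1 ∧ Cov (rot J u (Real.pi / l)) (-1) (DL L m) ∧
      rot J u (Real.pi / l) y = y := fun y => by
    obtain ⟨u, hu, h⟩ := exists_unit_orth [v, J v, y, J y] (by simpa using hE)
    have h' : ∀ w, inner ℝ w u = 0 → inner ℝ (J w) u = 0 → rot J u (Real.pi / l) w = w :=
      fun w h1 h2 => rot_of_orth J _ (by rw [real_inner_comm, h1])
        (by rw [hJ.inner_left, real_inner_comm, h2, neg_zero])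
    refine ⟨u, hu, (hw.cov_neg_one hl hu).DL (rot_inner hJ hu _) fun w hwL => ?_, ?_⟩
    · rw [hv w hwL]; exact h' v (h v (by simp)) (h (J v) (by simp))
    · exact h' y (h y (by simp)) (h (J y) (by simp))
  have h0 : DL L m 0 = 0 := by
    obtain ⟨u, -, hc, -⟩ := hfix 0
    exact hc.eq_zero Sublin.zero rfl
  intro f hf
  rw [hs.eq_zero_of_cap (hm.DL L) (fun ε hε hε' y hy => ?_) hf, h0]; · rfl
  obtain ⟨u, hu, hc, hy'⟩ := hfix y
  have hb := cap_bd hε hε' hy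
  rw [hs.ext_eq (hm.DL L) hb, h0]
  refine hc.eq_zero hb.add ?_
  ext x
  have := congrFun (cap_comp_self (ε := ε) (rot_inner hJ hu (Real.pi / l)) y) x
  rw [hy', Function.comp_apply] at this
  simp [nrm, this, inner_isometry_norm (rot_inner hJ hu (Real.pi / l))]

theorem IsWt.DL_long_eq_zero [FiniteDimensional ℝ E] {J : E →L[ℝ] E} (hJ : IsCpx J) {l : ℤ}
    (hl : 3 ≤ |l|) {m : (E → ℝ) → ℂ} (hm : IsVal m) (hw : IsWt J l m) {L : List E}
    (hL : 2 ≤ L.length) (hs : ∀ L' : List E, L'.length = L.length → SegInv (DL L' m)) :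
    Eqv (DL L m) 0 := by
  have hl0 : l ≠ 0 := by rintro rfl; simp at hl
  rcases hm.DL_canonical hJ hL with h | ⟨a, b, rs, c, na, nb, hab, hr, ho, h⟩
  · exact h
  refine h.trans (smul_eqv_zero ?_ c)
  by_cases hJ1 : b = J a ∨ b = -J a
  · exact DL_zero_eqv (hw.D_D_J' hJ hl0 hm na hJ1) rs
  push Not at hJ1
  have hs' : SegInv (SUVal.DL rs (SUVal.D a (SUVal.D b m))) := by
    have := hs (rs ++ [a, b]) (by simpa using hr)
    rwa [DL_append] at this
  have key := fun ε hε hε' y hy =>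
    hw.ext_cap_eq hJ hl hm na nb hab hJ1.1 hJ1.2 ho hs' (ε := ε) hε hε' (y := y) hy
  have h0 : SUVal.DL rs (SUVal.D a (SUVal.D b m)) 0 = 0 :=
    (key (1 / 4) (by norm_num) le_rfl 0 (by simp)).2
  intro f hf
  rw [hs'.eq_zero_of_cap (((hm.D b).D a).DL rs)
    (fun ε hε hε' y hy => by rw [(key ε hε hε' y hy).1, h0]) hf, h0]
  rfl

/-- There are no nonzero valuations of weight `l` with `3 ≤ |l|`. -/
theorem IsWt.eq_zero [FiniteDimensional ℝ E] (hE : 4 ≤ Module.finrank ℝ E) {J : E →L[ℝ] E}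
    (hJ : IsCpx J) {l : ℤ} (hl : 3 ≤ |l|) {m : (E → ℝ) → ℂ} (hm : IsVal m) (hw : IsWt J l m) :
    Eqv m 0 := by
  rcases hE.eq_or_lt with hE | hE
  · exact hw.eq_zero_of_finrank_four hE.symm hJ hl hm
  have hl0 : l ≠ 0 := by rintro rfl; simp at hl
  have key : ∀ k, ∀ L : List E, Module.finrank ℝ E + 1 = L.length + k → Eqv (SUVal.DL L m) 0 := by
    intro k
    induction k with
    | zero => exact fun L hL => hm.DL_dim (by omega)
    | succ k ih =>
      intro L hL
      have hs : ∀ L' : List E, L'.length = L.length → SegInv (SUVal.DL L' m) := fun L' hL' v =>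
        ih (v :: L') (by rw [List.length_cons]; omega)
      rcases le_or_gt L.length 1 with h | h
      · exact hw.DL_short_eq_zero hE hJ hl0 hm h (hs L rfl)
      · exact hw.DL_long_eq_zero hJ hl hm h hs
  exact key (Module.finrank ℝ E + 1) [] (by simp)

/-- The set supported by `f`. -/
def bodySet (f : E → ℝ) : Set E := {y | ∀ x, inner ℝ x y ≤ f x}

theorem Sublin.exists_mem_bodySet [FiniteDimensional ℝ E] {f : E → ℝ} (hf : Sublin f) (x : E) :
    ∃ y ∈ bodySet f, inner ℝ x y = f x := by
  have hcs : CompleteSpace E := FiniteDimensional.complete ℝ E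
  have H : ∀ c : ℝ, c • x = 0 → c • f x = 0 := fun c hc => by
    rcases smul_eq_zero.1 hc with rfl | rfl
    · rw [zero_smul]
    · rw [hf.map_zero, smul_zero]
  obtain ⟨g, h1, h2⟩ := exists_extension_of_le_sublinear
    (LinearPMap.mkSpanSingleton' x (f x) H) f (fun c hc x => hf.smul c hc.le x) hf.add_le
    (fun ⟨z, hz⟩ => by
      obtain ⟨c, rfl⟩ := Submodule.mem_span_singleton.1 hz
      rw [LinearPMap.mkSpanSingleton'_apply, smul_eq_mul]
      change c * f x ≤ f (c • x)
      rcases le_total 0 c with hc | hc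
      · rw [hf.smul c hc]
      · have h1 := hf.neg_le (c • x)
        have h2 := hf.smul (-c) (neg_nonneg.2 hc) x
        rw [neg_smul] at h2
        linarith)
  refine ⟨(InnerProductSpace.toDual ℝ E).symm g.toContinuousLinearMap, fun z => ?_, ?_⟩
  · rw [real_inner_comm, InnerProductSpace.toDual_symm_apply]
    exact h2 z
  · rw [real_inner_comm, InnerProductSpace.toDual_symm_apply]
    have := h1 ⟨x, Submodule.mem_span_singleton_self x⟩
    have h3 := LinearPMap.mkSpanSingleton'_apply (σ := RingHom.id ℝ) x (f x) H (1 : ℝ)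
      (by rw [one_smul]; exact Submodule.mem_span_singleton_self x)
    simp only [one_smul, map_one] at h3
    exact this.trans h3

/-- The convex body with support function `f`. -/
def body [FiniteDimensional ℝ E] {f : E → ℝ} (hf : Sublin f) : ConvexBody E where
  carrier := bodySet f
  convex' := fun y hy z hz a b ha hb hab x => by
    rw [inner_add_right, real_inner_smul_right, real_inner_smul_right]
    have h1 := mul_le_mul_of_nonneg_left (hy x) ha
    have h2 := mul_le_mul_of_nonneg_left (hz x) hb
    have : f x = a * f x + b * f x := by rw [← add_mul, hab, one_mul]
    linarith
  isCompact' := by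
    have : ProperSpace E := FiniteDimensional.proper ℝ E
    refine Metric.isCompact_of_isClosed_isBounded ?_ ?_
    · rw [bodySet, Set.ofPred_forall]
      exact isClosed_iInter fun x => isClosed_le (by fun_prop) continuous_const
    · obtain ⟨C, hC0, hC⟩ := hf.abs_bdd
      refine (Metric.isBounded_closedBall (x := (0 : E)) (r := C)).subset fun y hy => ?_
      rw [mem_closedBall_zero_iff]
      rcases eq_or_ne y 0 with rfl | h0
      · rwa [norm_zero]
      · have := (hy y).trans ((le_abs_self _).trans (hC y))
        rw [real_inner_self_eq_norm_sq, sq] at this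
        exact le_of_mul_le_mul_right this (norm_pos_iff.2 h0)
  nonempty' := by
    obtain ⟨y, hy, -⟩ := hf.exists_mem_bodySet 0
    exact ⟨y, hy⟩


theorem coe_body [FiniteDimensional ℝ E] {f : E → ℝ} (hf : Sublin f) :
    (body hf : Set E) = bodySet f := rfl

/-- Bodies with close support functions are close. -/
theorem bodySet_near [FiniteDimensional ℝ E] {f g : E → ℝ} (hf : Sublin f) {δ : ℝ}
    (h : ∀ x, g x ≤ f x + δ * ‖x‖) (hδ : 0 ≤ δ) {y : E} (hy : y ∈ bodySet g) :
    ∃ z ∈ bodySet f, dist y z ≤ δ := by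
  have hcs : CompleteSpace E := FiniteDimensional.complete ℝ E
  obtain ⟨z, hz, hmin⟩ := exists_norm_eq_iInf_of_complete_convex (K := bodySet f)
    (body hf).nonempty (body hf).isCompact.isComplete (body hf).convex y
  have hle := (norm_eq_iInf_iff_real_inner_le_zero (body hf).convex hz).1 hmin
  refine ⟨z, hz, ?_⟩
  obtain ⟨w, hw, hfw⟩ := hf.exists_mem_bodySet (y - z)
  have h1 := hle w hw
  rw [inner_sub_right, hfw] at h1
  have h2 := (hy (y - z)).trans (h (y - z))
  have h3 : ‖y - z‖ * ‖y - z‖ ≤ δ * ‖y - z‖ := by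
    rw [← sq, ← real_inner_self_eq_norm_sq, inner_sub_right]
    linarith
  rw [dist_eq_norm]
  rcases (norm_nonneg (y - z)).eq_or_lt with h4 | h4
  · rwa [← h4]
  · exact le_of_mul_le_mul_right h3 h4

theorem dist_body_le [FiniteDimensional ℝ E] {f g : E → ℝ} (hf : Sublin f) (hg : Sublin g) {δ : ℝ}
    (hδ : 0 ≤ δ) (h : ∀ x, |g x - f x| ≤ δ * ‖x‖) : dist (body hg) (body hf) ≤ δ := by
  rw [← ConvexBody.hausdorffDist_coe]
  refine Metric.hausdorffDist_le_of_mem_dist hδ (fun y hy => ?_) fun y hy => ?_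
  · exact bodySet_near hf (fun x => by linarith [(abs_le.1 (h x)).2]) hδ hy
  · exact bodySet_near hg (fun x => by linarith [(abs_le.1 (h x)).1]) hδ hy

theorem bodySet_inf (f g : E → ℝ) : bodySet (f ⊓ g) = bodySet f ∩ bodySet g := by
  ext y
  simp only [bodySet, Set.mem_ofPred_eq, Set.mem_inter_iff, Pi.inf_apply, le_inf_iff, forall_and]

theorem bodySet_sup {f g : E → ℝ} (hf : Sublin f) (hg : Sublin g) (hfg : Sublin (f ⊓ g)) :
    bodySet (f ⊔ g) = bodySet f ∪ bodySet g := by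
  ext z
  constructor
  · intro hz
    by_contra hn
    rw [Set.mem_union, not_or] at hn
    simp only [bodySet, Set.mem_ofPred_eq, not_forall, not_le] at hn
    obtain ⟨⟨u, hu⟩, v, hv⟩ := hn
    have hmax : ∀ x, inner ℝ x z ≤ f x ∨ inner ℝ x z ≤ g x := fun x => le_sup_iff.1 (hz x)
    have hu' : inner ℝ u z ≤ g u := (hmax u).resolve_left (not_le.2 hu)
    have hv' : inner ℝ v z ≤ f v := (hmax v).resolve_right (not_le.2 hv)
    have hcf : Continuous fun t : ℝ => f ((1 - t) • u + t • v) - g ((1 - t) • u + t • v) :=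
      (hf.continuous.comp (by fun_prop)).sub (hg.continuous.comp (by fun_prop))
    obtain ⟨t, ⟨ht0, ht1⟩, ht⟩ := intermediate_value_Icc (zero_le_one' ℝ) hcf.continuousOn
      (show (0 : ℝ) ∈ _ from by
        simp only [sub_zero, one_smul, zero_smul, add_zero, sub_self, zero_add]
        exact ⟨by linarith, by linarith⟩)
    have hw := hmax ((1 - t) • u + t • v)
    have h1 := hfg.add_le ((1 - t) • u) (t • v)
    rw [hfg.smul _ (by linarith), hfg.smul _ ht0] at h1
    simp only [Pi.inf_apply] at h1
    have h2 : f ((1 - t) • u + t • v) = g ((1 - t) • u + t • v) := sub_eq_zero.1 ht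
    rw [← h2, or_self, inner_add_left, real_inner_smul_left, real_inner_smul_left] at hw
    rw [← h2, inf_idem] at h1
    have h3 : f u ⊓ g u < inner ℝ u z := lt_of_le_of_lt inf_le_left hu
    have h4 : f v ⊓ g v < inner ℝ v z := lt_of_le_of_lt inf_le_right hv
    have h5 := mul_le_mul_of_nonneg_left h3.le (sub_nonneg.2 ht1)
    have h6 := mul_le_mul_of_nonneg_left h4.le ht0
    rcases ht0.eq_or_lt with h0 | h0
    · rw [← h0] at hw h1; linarith
    · have := mul_lt_mul_of_pos_left h4 h0
      linarith
  · rintro (h | h) x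
    · exact (h x).trans le_sup_left
    · exact (h x).trans le_sup_right

theorem bodySet_add_clm [CompleteSpace E] (f : E → ℝ) (l : E →L[ℝ] ℝ) :
    bodySet (f + ⇑l) = (fun y => (InnerProductSpace.toDual ℝ E).symm l + y) '' bodySet f := by
  have hl : ∀ x, inner ℝ x ((InnerProductSpace.toDual ℝ E).symm l) = l x := fun x => by
    rw [real_inner_comm, InnerProductSpace.toDual_symm_apply]
  ext y
  constructor
  · intro hy
    refine ⟨y - (InnerProductSpace.toDual ℝ E).symm l, fun x => ?_, by simp⟩
    have := hy x
    rw [inner_sub_right, hl]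
    rw [Pi.add_apply] at this
    linarith
  · rintro ⟨z, hz, rfl⟩ x
    have := hz x
    rw [inner_add_right, hl, Pi.add_apply]
    linarith

theorem bodySet_comp {A B : E →L[ℝ] E} (f : E → ℝ) (hA : ∀ x y, inner ℝ (A x) (A y) = inner ℝ x y)
    (hAB : ∀ x, A (B x) = x) (hBA : ∀ x, B (A x) = x) : bodySet (f ∘ A) = B '' bodySet f := by
  ext y
  constructor
  · intro hy
    refine ⟨A y, fun x => ?_, hBA y⟩
    have := hy (B x)
    rwa [← hA, Function.comp_apply, hAB] at this
  · rintro ⟨z, hz, rfl⟩ x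
    rw [← hA, hAB]
    exact hz (A x)

open Classical in
/-- A function on convex bodies as a function of support functions. -/
def ofVal [FiniteDimensional ℝ E] (μ : ConvexBody E → ℂ) (f : E → ℝ) : ℂ :=
  if h : Sublin f then μ (body h) else 0

theorem ofVal_eq [FiniteDimensional ℝ E] (μ : ConvexBody E → ℂ) {f : E → ℝ} (h : Sublin f) :
    ofVal μ f = μ (body h) := dif_pos h

theorem ofVal_isVal [FiniteDimensional ℝ E] {μ : ConvexBody E → ℂ}
    (h1 : ∀ K L U I : ConvexBody E, (U : Set E) = (K : Set E) ∪ (L : Set E) →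
      (I : Set E) = (K : Set E) ∩ (L : Set E) → μ U + μ I = μ K + μ L)
    (h2 : Continuous μ)
    (h3 : ∀ (x : E) (K L : ConvexBody E), (L : Set E) = (fun y => x + y) '' K → μ L = μ K) :
    IsVal (ofVal μ) where
  cont f hf ε hε := by
    obtain ⟨δ, hδ, H⟩ := Metric.continuous_iff.1 h2 (body hf) ε hε
    refine ⟨δ / 2, half_pos hδ, fun g hg h => ?_⟩
    rw [ofVal_eq μ hf, ofVal_eq μ hg, ← dist_eq_norm]
    exact (H _ (lt_of_le_of_lt (dist_body_le hf hg (half_pos hδ).le h) (half_lt_self hδ))).le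
  trans f hf l := by
    have hcs : CompleteSpace E := FiniteDimensional.complete ℝ E
    rw [ofVal_eq μ hf, ofVal_eq μ (hf.add (Sublin.clm l))]
    exact h3 _ _ _ (bodySet_add_clm f l)
  lat f g hf hg hfg := by
    rw [ofVal_eq μ hf, ofVal_eq μ hg, ofVal_eq μ hfg, ofVal_eq μ (hf.sup hg)]
    exact h1 _ _ _ _ (bodySet_sup hf hg hfg) (bodySet_inf f g)

/-- Every convex body has a support function. -/
theorem exists_body_eq [FiniteDimensional ℝ E] (K : ConvexBody E) :
    ∃ (f : E → ℝ) (hf : Sublin f), body hf = K := by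
  have hcs : CompleteSpace E := FiniteDimensional.complete ℝ E
  have hex : ∀ x : E, ∃ y ∈ (K : Set E), ∀ z ∈ (K : Set E), inner ℝ x z ≤ inner ℝ x y := fun x => by
    obtain ⟨y, hy, h⟩ := K.isCompact.exists_isMaxOn K.nonempty
      (f := fun z => inner ℝ x z) (by fun_prop)
    exact ⟨y, hy, fun z hz => h hz⟩
  choose p hp hmax using hex
  obtain ⟨R, hR⟩ := K.isBounded.exists_norm_le
  have hf : Sublin (fun x => inner ℝ x (p x)) := by
    refine ⟨fun x y => ?_, fun t ht x => ?_, R, fun x => ?_⟩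
    · rw [inner_add_left]
      exact add_le_add (hmax x _ (hp _)) (hmax y _ (hp _))
    · apply le_antisymm
      · rw [real_inner_smul_left]
        exact mul_le_mul_of_nonneg_left (hmax x _ (hp _)) ht
      · rw [← real_inner_smul_left]
        exact hmax _ _ (hp _)
    · refine (real_inner_le_norm _ _).trans ?_
      rw [mul_comm]
      exact mul_le_mul_of_nonneg_right (hR _ (hp x)) (norm_nonneg x)
  refine ⟨_, hf, SetLike.coe_injective ?_⟩
  rw [coe_body]
  ext y
  constructor
  · intro hy
    by_contra hn
    obtain ⟨φ, u, h1, h2⟩ := geometric_hahn_banach_closed_point K.convex K.isClosed hn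
    have h3 := hy ((InnerProductSpace.toDual ℝ E).symm φ)
    simp only [InnerProductSpace.toDual_symm_apply] at h3
    have := h1 _ (hp ((InnerProductSpace.toDual ℝ E).symm φ))
    linarith
  · exact fun hy x => hmax x y hy

theorem eq_zero_of_ofVal [FiniteDimensional ℝ E] {μ : ConvexBody E → ℂ} (h : Eqv (ofVal μ) 0) :
    μ = 0 := by
  ext K
  obtain ⟨f, hf, rfl⟩ := exists_body_eq K
  rw [← ofVal_eq μ hf, h f hf]
  rfl

end

/-- Multiplication by `i` on `ℂⁿ`. -/
def cpxJ (n : ℕ) : Cn n →L[ℝ] Cn n :=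
  (Complex.I • ContinuousLinearMap.id ℂ (Cn n)).restrictScalars ℝ

theorem cpxJ_apply {n : ℕ} (x : Cn n) : cpxJ n x = Complex.I • x := rfl

theorem real_inner_Cn {n : ℕ} (x y : Cn n) : inner ℝ x y = (inner ℂ x y).re := by
  rw [PiLp.inner_apply, PiLp.inner_apply, Complex.re_sum]
  rfl

theorem isCpx_cpxJ (n : ℕ) : IsCpx (cpxJ n) where
  sq x := by simp only [cpxJ_apply, smul_smul, Complex.I_mul_I, neg_smul, one_smul]
  inner_map x y := by
    simp only [real_inner_Cn, cpxJ_apply, inner_smul_left, inner_smul_right, ← mul_assoc]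
    simp

theorem finrank_Cn (n : ℕ) : Module.finrank ℝ (Cn n) = 2 * n := by
  rw [← Module.finrank_mul_finrank ℝ ℂ (Cn n), Complex.finrank_real_complex,
    finrank_euclideanSpace_fin]

/-- The matrix of the complex reflection `x ↦ x + (c - 1)⟨u, x⟩u`. -/
def reflMat {n : ℕ} (u : Cn n) (c : ℂ) : Matrix (Fin n) (Fin n) ℂ :=
  1 + (c - 1) • Matrix.vecMulVec u.ofLp (star u.ofLp)

theorem star_dotProduct_self {n : ℕ} {u : Cn n} (hu : ‖u‖ = 1) : star u.ofLp ⬝ᵥ u.ofLp = 1 := by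
  have h := inner_self_eq_norm_sq_to_K (𝕜 := ℂ) u
  rw [hu, EuclideanSpace.inner_eq_star_dotProduct, dotProduct_comm] at h
  simpa using h

theorem reflMat_mem {n : ℕ} {u : Cn n} (hu : ‖u‖ = 1) {c : ℂ} (hc : c * star c = 1) :
    reflMat u c ∈ Matrix.unitaryGroup (Fin n) ℂ := by
  rw [Matrix.mem_unitaryGroup_iff]
  have hP : Matrix.vecMulVec u.ofLp (star u.ofLp) * Matrix.vecMulVec u.ofLp (star u.ofLp)
      = Matrix.vecMulVec u.ofLp (star u.ofLp) := by
    rw [Matrix.vecMulVec_mul_vecMulVec, star_dotProduct_self hu, one_smul]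
  have hs : star (Matrix.vecMulVec u.ofLp (star u.ofLp)) = Matrix.vecMulVec u.ofLp (star u.ofLp) := by
    rw [Matrix.star_eq_conjTranspose, Matrix.conjTranspose_vecMulVec, star_star]
  simp only [reflMat, star_add, star_one, star_smul, hs, add_mul, mul_add, one_mul, mul_one,
    smul_mul_smul_comm, hP, star_sub]
  rw [mul_comm] at hc
  match_scalars
  · ring
  · linear_combination hc

theorem det_reflMat {n : ℕ} {u : Cn n} (hu : ‖u‖ = 1) (c : ℂ) : (reflMat u c).det = c := by
  rw [reflMat, ← Matrix.smul_vecMulVec, Matrix.vecMulVec_eq Unit,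
    Matrix.det_one_add_replicateCol_mul_replicateRow, dotProduct_smul, star_dotProduct_self hu]
  simp

theorem toEuclideanLin_reflMat {n : ℕ} (u x : Cn n) (c : ℂ) :
    Matrix.toEuclideanLin (reflMat u c) x = x + ((c - 1) * inner ℂ u x) • u := by
  ext i
  rw [EuclideanSpace.inner_eq_star_dotProduct, dotProduct_comm]
  simp [reflMat, Matrix.vecMulVec_mulVec]
  ring

theorem rot_cpxJ {n : ℕ} (u x : Cn n) (θ : ℝ) :
    rot (cpxJ n) u θ x = Matrix.toEuclideanLin (reflMat u (Complex.exp (θ * Complex.I))) x := by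
  have hI : (inner ℂ (Complex.I • u) x).re = (inner ℂ u x).im := by
    rw [inner_smul_left]; simp
  rw [toEuclideanLin_reflMat, rot_apply, real_inner_Cn, cpxJ_apply, real_inner_Cn, hI, add_assoc]
  congr 1
  rw [← Complex.coe_smul, ← Complex.coe_smul, smul_smul, ← add_smul]
  congr 1
  rw [Complex.exp_mul_I]
  apply Complex.ext <;> simp [← Complex.ofReal_cos, ← Complex.ofReal_sin]

theorem toEuclideanLin_mul {n : ℕ} (g h : Matrix (Fin n) (Fin n) ℂ) (x : Cn n) :
    Matrix.toEuclideanLin (g * h) x = Matrix.toEuclideanLin g (Matrix.toEuclideanLin h x) := by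
  ext i; simp [Matrix.mulVec_mulVec]

theorem exp_I_mul_star (θ : ℝ) :
    Complex.exp (θ * Complex.I) * star (Complex.exp (θ * Complex.I)) = 1 := by
  rw [Complex.star_def, Complex.mul_conj, Complex.normSq_eq_norm_sq, Complex.norm_exp_ofReal_mul_I]
  simp

theorem reflMat_mul {n : ℕ} {u : Cn n} (hu : ‖u‖ = 1) (c d : ℂ) (x : Cn n) :
    Matrix.toEuclideanLin (reflMat u c) (Matrix.toEuclideanLin (reflMat u d) x) =
      Matrix.toEuclideanLin (reflMat u (c * d)) x := by
  have h1 : inner ℂ u u = (1 : ℂ) := by rw [inner_self_eq_norm_sq_to_K, hu]; simp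
  simp only [toEuclideanLin_reflMat, inner_add_right, inner_smul_right, h1]
  match_scalars <;> ring

theorem reflMat_one {n : ℕ} (u : Cn n) : reflMat u 1 = 1 := by
  simp [reflMat]

theorem toEuclideanLin_one {n : ℕ} (x : Cn n) :
    Matrix.toEuclideanLin (1 : Matrix (Fin n) (Fin n) ℂ) x = x := by
  ext i; simp

theorem isWt_ofVal {n : ℕ} {μ : ConvexBody (Cn n) → ℂ} {l : ℤ} (h : HasWeight l μ) :
    IsWt (cpxJ n) (-l) (ofVal μ) := by
  intro u hu θ f hf
  have hJ := isCpx_cpxJ n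
  have hee (φ : ℝ) : Complex.exp (φ * Complex.I) * Complex.exp (((-φ : ℝ) : ℂ) * Complex.I) = 1 := by
    rw [← Complex.exp_add]; simp
  have hee' : Complex.exp (((-θ : ℝ) : ℂ) * Complex.I) * Complex.exp (θ * Complex.I) = 1 := by
    rw [mul_comm, hee]
  have hfr : Sublin (f ∘ rot (cpxJ n) u θ) := hf.comp _
  rw [ofVal_eq μ hf, ofVal_eq μ hfr]
  rw [h (reflMat u (Complex.exp (((-θ : ℝ) : ℂ) * Complex.I))) (reflMat_mem hu (exp_I_mul_star _))
    (body hf) (body hfr), det_reflMat hu, ← Complex.exp_int_mul]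
  · congr 2
    push_cast; ring
  · rw [coe_body, coe_body, bodySet_comp (B := rot (cpxJ n) u (-θ)) f (rot_inner hJ hu θ)]
    · exact Set.image_congr fun x _ => rot_cpxJ u x (-θ)
    · intro x
      rw [rot_cpxJ, rot_cpxJ, reflMat_mul hu, hee θ, reflMat_one, toEuclideanLin_one]
    · intro x
      rw [rot_cpxJ, rot_cpxJ, reflMat_mul hu, hee', reflMat_one, toEuclideanLin_one]

theorem eq_zero_of_hasWeight {n : ℕ} (hn : 2 ≤ n) {μ : ConvexBody (Cn n) → ℂ} {l : ℤ}
    (hl : l < -2 ∨ 2 < l) (h1 : IsValuation μ) (h2 : Continuous μ) (h3 : TranslationInvariant μ)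
    (h4 : HasWeight l μ) : μ = 0 := by
  refine eq_zero_of_ofVal (IsWt.eq_zero ?_ (isCpx_cpxJ n) ?_ (ofVal_isVal h1 h2 h3) (isWt_ofVal h4))
  · rw [finrank_Cn]; omega
  · rw [abs_neg, le_abs]; omega

theorem toEuclideanLin_unitary_injective {n : ℕ} {g : Matrix (Fin n) (Fin n) ℂ}
    (hg : g ∈ Matrix.unitaryGroup (Fin n) ℂ) : Function.Injective (Matrix.toEuclideanLin g) := by
  intro x y h
  have h1 := congrArg (Matrix.toEuclideanLin (star g)) h
  rwa [← toEuclideanLin_mul, ← toEuclideanLin_mul, Matrix.mem_unitaryGroup_iff'.1 hg,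
    toEuclideanLin_one, toEuclideanLin_one] at h1

/-- The image of a convex body under a complex matrix. -/
def img {n : ℕ} (g : Matrix (Fin n) (Fin n) ℂ) (K : ConvexBody (Cn n)) : ConvexBody (Cn n) where
  carrier := Matrix.toEuclideanLin g '' (K : Set (Cn n))
  convex' := K.convex.linear_image ((Matrix.toEuclideanLin g).restrictScalars ℝ)
  isCompact' := K.isCompact.image (LinearMap.continuous_of_finiteDimensional _)
  nonempty' := K.nonempty.image _

theorem coe_img {n : ℕ} (g : Matrix (Fin n) (Fin n) ℂ) (K : ConvexBody (Cn n)) :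
    (img g K : Set (Cn n)) = Matrix.toEuclideanLin g '' (K : Set (Cn n)) := rfl

theorem img_mul {n : ℕ} (g h : Matrix (Fin n) (Fin n) ℂ) (K : ConvexBody (Cn n)) :
    img (g * h) K = img g (img h K) := by
  apply ConvexBody.ext
  simp only [coe_img, Set.image_image, toEuclideanLin_mul]

theorem img_one {n : ℕ} (K : ConvexBody (Cn n)) : img 1 K = K := by
  apply ConvexBody.ext
  simp only [coe_img, toEuclideanLin_one, Set.image_id']

theorem reflMat_mul_reflMat {n : ℕ} {u : Cn n} (hu : ‖u‖ = 1) (c d : ℂ) :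
    reflMat u c * reflMat u d = reflMat u (c * d) := by
  apply Matrix.toEuclideanLin.injective
  ext1 x
  rw [toEuclideanLin_mul, reflMat_mul hu]

theorem norm_toEuclideanLin_reflMat {n : ℕ} {u : Cn n} (hu : ‖u‖ = 1) {c : ℂ} (hc : ‖c‖ = 1)
    (x : Cn n) : ‖Matrix.toEuclideanLin (reflMat u c) x‖ = ‖x‖ := by
  have hcc : c = Complex.exp (c.arg * Complex.I) := by
    conv_lhs => rw [← Complex.norm_mul_exp_arg_mul_I c, hc]
    simp
  rw [hcc, ← rot_cpxJ, ← sq_eq_sq₀ (norm_nonneg _) (norm_nonneg _), ← real_inner_self_eq_norm_sq,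
    rot_inner (isCpx_cpxJ n) hu, real_inner_self_eq_norm_sq]

theorem isometry_reflMat {n : ℕ} {u : Cn n} (hu : ‖u‖ = 1) {c : ℂ} (hc : ‖c‖ = 1) :
    Isometry (Matrix.toEuclideanLin (reflMat u c)) :=
  AddMonoidHomClass.isometry_of_norm _ (norm_toEuclideanLin_reflMat hu hc)

theorem dist_img_reflMat {n : ℕ} {u : Cn n} (hu : ‖u‖ = 1) {c : ℂ} (hc : ‖c‖ = 1)
    (K L : ConvexBody (Cn n)) : dist (img (reflMat u c) K) (img (reflMat u c) L) = dist K L := by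
  rw [← ConvexBody.hausdorffDist_coe, ← ConvexBody.hausdorffDist_coe, coe_img, coe_img,
    Metric.hausdorffDist_image (isometry_reflMat hu hc)]

theorem dist_img_img_le {n : ℕ} {u : Cn n} (hu : ‖u‖ = 1) (c d : ℂ) {K : ConvexBody (Cn n)} {R : ℝ}
    (hR0 : 0 ≤ R) (hR : ∀ x ∈ (K : Set (Cn n)), ‖x‖ ≤ R) :
    dist (img (reflMat u c) K) (img (reflMat u d) K) ≤ ‖c - d‖ * R := by
  have key (x : Cn n) (hx : x ∈ (K : Set (Cn n))) (c d : ℂ) :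
      dist (Matrix.toEuclideanLin (reflMat u c) x) (Matrix.toEuclideanLin (reflMat u d) x)
        ≤ ‖c - d‖ * R := by
    rw [dist_eq_norm, toEuclideanLin_reflMat, toEuclideanLin_reflMat]
    have : x + ((c - 1) * inner ℂ u x) • u - (x + ((d - 1) * inner ℂ u x) • u)
        = ((c - d) * inner ℂ u x) • u := by module
    rw [this, norm_smul, hu, mul_one, norm_mul]
    refine mul_le_mul_of_nonneg_left ?_ (norm_nonneg _)
    have := norm_inner_le_norm (𝕜 := ℂ) u x
    rw [hu, one_mul] at this
    exact this.trans (hR x hx)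
  rw [← ConvexBody.hausdorffDist_coe]
  refine Metric.hausdorffDist_le_of_mem_dist (by positivity) ?_ ?_
  · rintro _ ⟨x, hx, rfl⟩
    exact ⟨_, ⟨x, hx, rfl⟩, key x hx c d⟩
  · rintro _ ⟨x, hx, rfl⟩
    refine ⟨_, ⟨x, hx, rfl⟩, ?_⟩
    rw [norm_sub_rev]
    exact key x hx d c

theorem norm_fourier_apply (l : ℤ) (t : UnitAddCircle) : ‖fourier l t‖ = 1 := Circle.norm_coe _

/-- The action of the circle on convex bodies by complex reflections fixing `u^⊥`. -/
def circ {n : ℕ} (u : Cn n) (t : UnitAddCircle) : Matrix (Fin n) (Fin n) ℂ :=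
  reflMat u (fourier 1 t)

theorem fourier_zpow (l : ℤ) (t : UnitAddCircle) : (fourier 1 t) ^ l = fourier l t := by
  rw [fourier_apply, fourier_apply, one_zsmul, AddCircle.toCircle_zsmul, Circle.coe_zpow]

theorem fourier_add_arg (l : ℤ) (s t : UnitAddCircle) :
    fourier l (s + t) = fourier l s * fourier l t := by
  rw [fourier_apply, fourier_apply, fourier_apply, zsmul_add, AddCircle.toCircle_add,
    Circle.coe_mul]

theorem fourier_neg_mul (l : ℤ) (t : UnitAddCircle) : fourier (-l) t * fourier l t = 1 := by
  rw [← fourier_add, neg_add_cancel, fourier_zero]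

theorem circ_mul {n : ℕ} {u : Cn n} (hu : ‖u‖ = 1) (s t : UnitAddCircle) :
    circ u s * circ u t = circ u (s + t) := by
  rw [circ, circ, circ, reflMat_mul_reflMat hu, fourier_add_arg]

theorem circ_zero {n : ℕ} (u : Cn n) : circ u 0 = 1 := by
  rw [circ, fourier_eval_zero, reflMat_one]

theorem circ_mem {n : ℕ} {u : Cn n} (hu : ‖u‖ = 1) (t : UnitAddCircle) :
    circ u t ∈ Matrix.unitaryGroup (Fin n) ℂ := by
  refine reflMat_mem hu ?_
  rw [Complex.star_def, Complex.mul_conj, Complex.normSq_eq_norm_sq, norm_fourier_apply]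
  simp

theorem det_circ {n : ℕ} {u : Cn n} (hu : ‖u‖ = 1) (t : UnitAddCircle) :
    (circ u t).det = fourier 1 t := det_reflMat hu _

theorem continuous_img_circ {n : ℕ} {u : Cn n} (hu : ‖u‖ = 1) :
    Continuous fun p : ConvexBody (Cn n) × UnitAddCircle => img (circ u p.2) p.1 := by
  rw [continuous_iff_continuousAt]
  rintro ⟨K, t⟩
  obtain ⟨R, hR⟩ := K.isBounded.exists_norm_le
  have hR0 : 0 ≤ R := by
    obtain ⟨x, hx⟩ := K.nonempty
    exact (norm_nonneg x).trans (hR x hx)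
  rw [ContinuousAt, tendsto_iff_dist_tendsto_zero]
  have hlim : Filter.Tendsto (fun p : ConvexBody (Cn n) × UnitAddCircle =>
      dist p.1 K + ‖fourier 1 p.2 - fourier 1 t‖ * R) (nhds (K, t)) (nhds 0) := by
    have hc : Continuous (fun p : ConvexBody (Cn n) × UnitAddCircle =>
      dist p.1 K + ‖fourier 1 p.2 - fourier 1 t‖ * R) :=
      (continuous_fst.dist continuous_const).add
        ((((fourier 1).continuous.comp continuous_snd).sub continuous_const).norm.mul
          continuous_const)
    have := hc.tendsto (K, t)
    simpa using this
  refine squeeze_zero (fun _ => dist_nonneg) (fun p => ?_) hlim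
  calc dist (img (circ u p.2) p.1) (img (circ u t) K)
      ≤ dist (img (circ u p.2) p.1) (img (circ u p.2) K)
        + dist (img (circ u p.2) K) (img (circ u t) K) := dist_triangle _ _ _
    _ ≤ _ := add_le_add (dist_img_reflMat hu (norm_fourier_apply 1 _) _ _).le
        (dist_img_img_le hu _ _ hR0 hR)

theorem exists_fourier_eq {z : ℂ} (hz : ‖z‖ = 1) : ∃ s : UnitAddCircle, fourier 1 s = z := by
  obtain ⟨s, hs⟩ := (AddCircle.homeomorphCircle (one_ne_zero (α := ℝ))).surjective
    ⟨z, mem_sphere_zero_iff_norm.2 hz⟩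
  refine ⟨s, ?_⟩
  rw [AddCircle.homeomorphCircle_apply] at hs
  rw [fourier_one, hs]

/-- The orbit function of a functional on convex bodies under the circle action. -/
def orb {n : ℕ} (u : Cn n) (μ : ConvexBody (Cn n) → ℂ) (K : ConvexBody (Cn n))
    (t : UnitAddCircle) : ℂ := μ (img (circ u t) K)

/-- The component of weight `l`. -/
def comp {n : ℕ} (u : Cn n) (μ : ConvexBody (Cn n) → ℂ) (l : ℤ) (K : ConvexBody (Cn n)) : ℂ :=
  fourierCoeff (orb u μ K) l

section
variable {n : ℕ} {u : Cn n} {μ : ConvexBody (Cn n) → ℂ}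

theorem continuous_orb_uncurry (hu : ‖u‖ = 1) (h2 : Continuous μ) :
    Continuous (Function.uncurry (orb u μ)) := h2.comp (continuous_img_circ hu)

theorem continuous_orb (hu : ‖u‖ = 1) (h2 : Continuous μ) (K : ConvexBody (Cn n)) :
    Continuous (orb u μ K) := by
  have h : Continuous fun t : UnitAddCircle => (K, t) := by fun_prop
  have h' := (continuous_img_circ hu).comp h
  exact h2.comp h'

theorem integrable_of_continuous {f : UnitAddCircle → ℂ} (hf : Continuous f) :
    Integrable f AddCircle.haarAddCircle :=
  hf.integrable_of_hasCompactSupport (HasCompactSupport.of_compactSpace f)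

theorem comp_continuous (hu : ‖u‖ = 1) (h2 : Continuous μ) (l : ℤ) : Continuous (comp u μ l) := by
  rw [Metric.continuous_iff]
  intro K ε hε
  let Φ : C(ConvexBody (Cn n), C(UnitAddCircle, ℂ)) :=
    ContinuousMap.curry ⟨_, continuous_orb_uncurry hu h2⟩
  obtain ⟨δ, hδ, H⟩ := Metric.continuous_iff.1 Φ.continuous K (ε / 2) (half_pos hε)
  refine ⟨δ, hδ, fun L hL => ?_⟩
  have hd := H L hL
  have hpt (t : UnitAddCircle) : ‖orb u μ L t - orb u μ K t‖ ≤ ε / 2 := by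
    rw [← dist_eq_norm]
    exact (ContinuousMap.dist_apply_le_dist (f := Φ L) (g := Φ K) t).trans hd.le
  rw [dist_eq_norm, comp, comp, fourierCoeff, fourierCoeff, ← integral_sub]
  · refine (norm_integral_le_of_norm_le_const (C := ε / 2)
      (Filter.Eventually.of_forall fun t => ?_)).trans_lt ?_
    · rw [← smul_sub, norm_smul, norm_fourier_apply, one_mul]
      exact hpt t
    · simp only [probReal_univ, mul_one]
      linarith
  all_goals
    exact integrable_of_continuous ((fourier (-l)).continuous.smul (continuous_orb hu h2 _))

theorem comp_isValuation (hu : ‖u‖ = 1) (h1 : IsValuation μ) (h2 : Continuous μ) (l : ℤ) :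
    IsValuation (comp u μ l) := by
  intro K L U I hU hI
  have ho : orb u μ U + orb u μ I = orb u μ K + orb u μ L := by
    funext t
    refine h1 _ _ _ _ ?_ ?_
    · rw [coe_img, coe_img, coe_img, hU, Set.image_union]
    · rw [coe_img, coe_img, coe_img, hI,
        Set.image_inter (toEuclideanLin_unitary_injective (circ_mem hu t))]
  have hi (K : ConvexBody (Cn n)) := integrable_of_continuous (continuous_orb hu h2 K)
  have := congrArg (fun f => fourierCoeff f l) ho
  simp only [fourierCoeff.add (hi _) (hi _), Pi.add_apply] at this
  exact this

theorem comp_translationInvariant (h3 : TranslationInvariant μ) (l : ℤ) :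
    TranslationInvariant (comp u μ l) := by
  intro x K L hL
  have : orb u μ L = orb u μ K := by
    funext t
    refine h3 (Matrix.toEuclideanLin (circ u t) x) _ _ ?_
    rw [coe_img, coe_img, hL, Set.image_image, Set.image_image]
    simp only [map_add]
  rw [comp, comp, this]

theorem orb_img (hu : ‖u‖ = 1) (h4 : SUInvariant μ) {g : Matrix (Fin n) (Fin n) ℂ}
    (hg : g ∈ Matrix.unitaryGroup (Fin n) ℂ) {s : UnitAddCircle} (hs : fourier 1 s = g.det)
    (K : ConvexBody (Cn n)) (t : UnitAddCircle) : orb u μ (img g K) t = orb u μ K (t + s) := by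
  have e : circ u t * g = circ u t * g * circ u (-(t + s)) * circ u (t + s) := by
    rw [mul_assoc _ (circ u _), circ_mul hu, neg_add_cancel, circ_zero, mul_one]
  rw [orb, orb, ← img_mul, e, img_mul]
  refine h4 (circ u t * g * circ u (-(t + s))) ?_ _ _ rfl
  rw [Matrix.mem_specialUnitaryGroup_iff]
  refine ⟨mul_mem (mul_mem (circ_mem hu _) hg) (circ_mem hu _), ?_⟩
  rw [Matrix.det_mul, Matrix.det_mul, det_circ hu, det_circ hu, ← hs, ← fourier_add_arg,
    ← fourier_add_arg, add_neg_cancel, fourier_eval_zero]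

theorem norm_det_unitary {g : Matrix (Fin n) (Fin n) ℂ}
    (hg : g ∈ Matrix.unitaryGroup (Fin n) ℂ) : ‖g.det‖ = 1 :=
  CStarRing.norm_of_mem_unitary (Matrix.det_of_mem_unitary hg)

theorem comp_hasWeight (hu : ‖u‖ = 1) (h4 : SUInvariant μ) (l : ℤ) : HasWeight l (comp u μ l) := by
  intro g hg K L hL
  obtain rfl : L = img g K := ConvexBody.ext hL
  obtain ⟨s, hs⟩ := exists_fourier_eq (norm_det_unitary hg)
  rw [← hs, fourier_zpow, comp, comp, fourierCoeff, fourierCoeff,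
    ← integral_add_right_eq_self (fun t => fourier (-l) t • orb u μ K t) s, ← integral_const_mul]
  congr 1
  funext t
  rw [orb_img hu h4 hg hs, fourier_add_arg, smul_eq_mul, smul_eq_mul]
  linear_combination (-(fourier (-l) t) * orb u μ K (t + s)) * fourier_neg_mul l s

theorem eq_sum_comp (hn : 2 ≤ n) (hu : ‖u‖ = 1) (h1 : IsValuation μ) (h2 : Continuous μ)
    (h3 : TranslationInvariant μ) (h4 : SUInvariant μ) :
    (∀ l : ℤ, l < -2 ∨ 2 < l → comp u μ l = 0) ∧
      μ = comp u μ (-2) + comp u μ (-1) + comp u μ 0 + comp u μ 1 + comp u μ 2 := by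
  have h0 (l : ℤ) (hl : l < -2 ∨ 2 < l) : comp u μ l = 0 :=
    eq_zero_of_hasWeight hn hl (comp_isValuation hu h1 h2 l) (comp_continuous hu h2 l)
      (comp_translationInvariant h3 l) (comp_hasWeight hu h4 l)
  refine ⟨h0, ?_⟩
  funext K
  let f : C(UnitAddCircle, ℂ) := ⟨orb u μ K, continuous_orb hu h2 K⟩
  have hz (l : ℤ) (hl : l ∉ ({-2, -1, 0, 1, 2} : Finset ℤ)) : fourierCoeff f l = 0 := by
    refine congrFun (h0 l ?_) K
    simp only [Finset.mem_insert, Finset.mem_singleton] at hl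
    omega
  have hs : Summable (fourierCoeff f) := summable_of_ne_finset_zero hz
  have h := (has_pointwise_sum_fourier_series_of_summable hs 0).unique
    (hasSum_sum_of_ne_finset_zero (s := {-2, -1, 0, 1, 2}) fun l hl => by rw [hz l hl, zero_smul])
  have hf : f 0 = μ K := by
    change μ (img (circ u 0) K) = μ K
    rw [circ_zero, img_one]
  rw [hf] at h
  rw [h]
  simp only [fourier_eval_zero, smul_eq_mul, mul_one]
  rw [Finset.sum_insert (by decide), Finset.sum_insert (by decide), Finset.sum_insert (by decide),
    Finset.sum_insert (by decide), Finset.sum_singleton]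
  simp only [Pi.add_apply, comp]
  rw [← add_assoc, ← add_assoc, ← add_assoc]
  rfl

theorem orb_of_hasWeight (hu : ‖u‖ = 1) {l : ℤ} {ν : ConvexBody (Cn n) → ℂ} (h : HasWeight l ν)
    (K : ConvexBody (Cn n)) : orb u ν K = ν K • ⇑(fourier l : C(UnitAddCircle, ℂ)) := by
  funext t
  rw [orb, h (circ u t) (circ_mem hu t) K _ rfl, det_circ hu, fourier_zpow, mul_comm]
  rfl

theorem comp_of_hasWeight (hu : ‖u‖ = 1) {l k : ℤ} {ν : ConvexBody (Cn n) → ℂ}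
    (h : HasWeight l ν) : comp u ν k = if k = l then ν else 0 := by
  funext K
  rw [comp, orb_of_hasWeight hu h, fourierCoeff.const_smul, fourierCoeff_fourier, Pi.single_apply]
  split_ifs <;> simp

theorem comp_add (hu : ‖u‖ = 1) {μ ν : ConvexBody (Cn n) → ℂ} (hμ : Continuous μ)
    (hν : Continuous ν) (l : ℤ) : comp u (μ + ν) l = comp u μ l + comp u ν l := by
  funext K
  have := congrFun (fourierCoeff.add (integrable_of_continuous (continuous_orb hu hμ K))
    (integrable_of_continuous (continuous_orb hu hν K))) l
  exact this

end

end SUVal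

/-- Every continuous, translation invariant, `SU(n)`-invariant valuation on `ℂⁿ` splits in
exactly one way as `μ = μ₋₂ + μ₋₁ + μ₀ + μ₁ + μ₂` where `μ_l` is a continuous,
translation invariant valuation of weight `l`. -/
theorem weight_decomposition (n : ℕ) (hn : 2 ≤ n) (μ : ConvexBody (Cn n) → ℂ)
    (h1 : IsValuation μ) (h2 : Continuous μ) (h3 : TranslationInvariant μ)
    (h4 : SUInvariant μ) :
    ∃! ν : ℤ → ConvexBody (Cn n) → ℂ,
      (∀ l : ℤ, IsValuation (ν l) ∧ Continuous (ν l) ∧ TranslationInvariant (ν l) ∧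
        HasWeight l (ν l)) ∧
      (∀ l : ℤ, l < -2 ∨ 2 < l → ν l = 0) ∧
      μ = ν (-2) + ν (-1) + ν 0 + ν 1 + ν 2 := by
  have hu : ‖(EuclideanSpace.single (⟨0, by omega⟩ : Fin n) 1 : Cn n)‖ = 1 := by simp
  set u : Cn n := EuclideanSpace.single (⟨0, by omega⟩ : Fin n) 1
  obtain ⟨h0, hsum⟩ := SUVal.eq_sum_comp hn hu h1 h2 h3 h4
  refine ⟨SUVal.comp u μ, ⟨fun l => ⟨SUVal.comp_isValuation hu h1 h2 l,
    SUVal.comp_continuous hu h2 l, SUVal.comp_translationInvariant h3 l,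
    SUVal.comp_hasWeight hu h4 l⟩, h0, hsum⟩, ?_⟩
  rintro ν ⟨hν, hν0, hνs⟩
  funext l
  by_cases hl : l < -2 ∨ 2 < l
  · rw [hν0 l hl, h0 l hl]
  · have hc (k : ℤ) := (hν k).2.1
    have hw (k : ℤ) := SUVal.comp_of_hasWeight (k := l) hu (hν k).2.2.2
    rw [hνs, SUVal.comp_add hu ((((hc _).add (hc _)).add (hc _)).add (hc _)) (hc _),
      SUVal.comp_add hu (((hc _).add (hc _)).add (hc _)) (hc _),
      SUVal.comp_add hu ((hc _).add (hc _)) (hc _), SUVal.comp_add hu (hc _) (hc _),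
      hw, hw, hw, hw, hw]
    obtain rfl | rfl | rfl | rfl | rfl : l = -2 ∨ l = -1 ∨ l = 0 ∨ l = 1 ∨ l = 2 := by omega
    all_goals simp

end
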